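/- arXiv:1502.05205 — 2 statements merged into one kernel-verified Lean document; each statement's English description precedes it below -/
import Mathlib

section
/- Agmon–Allegretto–Piepenbrink theorem for Schrödinger operators: let n ≥ 1, let Ω ⊆ ℝⁿ be a domain (nonempty open connected set), and let V : Ω → ℝ be locally Hölder continuous. Then ∫_Ω (|∇φ(x)|² + V(x) φ(x)²) dx ≥ 0 for every φ ∈ C_c^∞(Ω) if and only if there exists a function u ∈ C²(Ω) with u > 0 on Ω satisfying −Δu + V u = 0 on Ω. -/
open MeasureTheory

noncomputable section

/-- Test functions: smooth compactly supported functions with support in `Ω`. -/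
def IsTestFun {n : ℕ} (Ω : Set (EuclideanSpace ℝ (Fin n)))
    (φ : EuclideanSpace ℝ (Fin n) → ℝ) : Prop :=
  ContDiff ℝ (⊤ : ℕ∞) φ ∧ HasCompactSupport φ ∧ tsupport φ ⊆ Ω

/-- The Euclidean Laplacian: sum of pure second partial derivatives. -/
def lap {n : ℕ} (f : EuclideanSpace ℝ (Fin n) → ℝ) (x : EuclideanSpace ℝ (Fin n)) : ℝ :=
  ∑ i : Fin n, fderiv ℝ (fun y => fderiv ℝ f y (EuclideanSpace.single i 1)) x
    (EuclideanSpace.single i 1)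

/-- `V` is locally Hölder continuous on `Ω`. -/
def LocallyHolderOn {n : ℕ} (Ω : Set (EuclideanSpace ℝ (Fin n)))
    (V : EuclideanSpace ℝ (Fin n) → ℝ) : Prop :=
  ∀ x ∈ Ω, ∃ U ∈ nhds x, ∃ C α : ℝ, 0 < α ∧ α ≤ 1 ∧
    ∀ y ∈ U ∩ Ω, ∀ z ∈ U ∩ Ω, |V y - V z| ≤ C * ‖y - z‖ ^ α

namespace AAP

open Filter Topology Set

/-- Euclidean space. -/
abbrev EE (n : ℕ) := EuclideanSpace ℝ (Fin n)

/-- Partial derivative. -/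
def pd {n : ℕ} (i : Fin n) (f : (EE n) → ℝ) (x : EE n) : ℝ :=
  fderiv ℝ f x (EuclideanSpace.single i 1)

lemma lap_eq {n : ℕ} (f : (EE n) → ℝ) (x : EE n) : lap f x = ∑ i, pd i (pd i f) x := rfl

lemma pd_contDiff {n : ℕ} (i : Fin n) {f : (EE n) → ℝ} (hf : ContDiff ℝ (⊤ : ℕ∞) f) :
    ContDiff ℝ (⊤ : ℕ∞) (pd i f) := by
  unfold pd
  exact (hf.fderiv_right (m := (⊤ : ℕ∞)) (by simp)).clm_apply contDiff_const

lemma diff_of_smooth {n : ℕ} {f : (EE n) → ℝ} (hf : ContDiff ℝ (⊤ : ℕ∞) f) :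
    Differentiable ℝ f := hf.differentiable (by simp)

lemma sum_single {n : ℕ} (x : EE n) :
    x = ∑ i, x i • (EuclideanSpace.single i (1:ℝ) : EE n) := by
  ext j
  simp [Finset.sum_apply, Pi.single_apply]

lemma fderiv_apply_sum {n : ℕ} (L : (EE n) →L[ℝ] ℝ) (x : EE n) :
    L x = ∑ i, x i * L (EuclideanSpace.single i (1:ℝ)) := by
  conv_lhs => rw [sum_single x]
  simp [map_sum]

lemma pd_comm {n : ℕ} (i j : Fin n) {f : (EE n) → ℝ} (hf : ContDiff ℝ (⊤ : ℕ∞) f) (x : EE n) :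
    pd i (pd j f) x = pd j (pd i f) x := by
  have hs : IsSymmSndFDerivAt ℝ f x :=
    hf.contDiffAt.isSymmSndFDerivAt (by simpa using WithTop.coe_le_coe.2 (le_top (a := (2:ℕ∞))))
  have hd : DifferentiableAt ℝ (fderiv ℝ f) x :=
    ((hf.fderiv_right (m := (⊤ : ℕ∞)) (by simp)).differentiable (by simp)) x
  have key : ∀ k l : Fin n, pd k (pd l f) x = fderiv ℝ (fderiv ℝ f) x
      (EuclideanSpace.single k 1) (EuclideanSpace.single l 1) := by
    intro k l
    have : HasFDerivAt (pd l f) (((fderiv ℝ (fderiv ℝ f) x).flip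
        (EuclideanSpace.single l 1))) x := by
      have := hd.hasFDerivAt.clm_apply (hasFDerivAt_const
        (EuclideanSpace.single l (1:ℝ) : EE n) x)
      have h0 : (fderiv ℝ f x ∘SL (0 : (EE n) →L[ℝ] (EE n))) +
          (fderiv ℝ (fderiv ℝ f) x).flip (EuclideanSpace.single l 1) =
          (fderiv ℝ (fderiv ℝ f) x).flip (EuclideanSpace.single l 1) := by simp
      rw [h0] at this
      exact this
    unfold pd at this ⊢
    rw [this.fderiv]; rfl
  rw [key, key]
  exact hs _ _

lemma pd_zero_of {n : ℕ} (i : Fin n) {f : (EE n) → ℝ}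
    (h : ∀ x, 1 < ‖x‖ → f x = 0) : ∀ x, 1 < ‖x‖ → pd i f x = 0 := by
  intro x hx
  have : f =ᶠ[𝓝 x] fun _ => 0 := by
    filter_upwards [(isOpen_lt continuous_const continuous_norm).mem_nhds hx] with y hy
    exact h y hy
  unfold pd
  rw [this.fderiv_eq]; simp

lemma pd_tsupport {n : ℕ} (i : Fin n) (f : (EE n) → ℝ) : tsupport (pd i f) ⊆ tsupport f := by
  refine closure_minimal ?_ (isClosed_tsupport f)
  intro x hx
  by_contra h
  have : f =ᶠ[𝓝 x] fun _ => 0 := notMem_tsupport_iff_eventuallyEq.1 h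
  apply hx
  unfold pd
  rw [this.fderiv_eq]; simp

lemma lap_contDiff {n : ℕ} {f : (EE n) → ℝ} (hf : ContDiff ℝ (⊤ : ℕ∞) f) :
    ContDiff ℝ (⊤ : ℕ∞) (lap f) := by
  have : lap f = fun x => ∑ i, pd i (pd i f) x := rfl
  rw [this]
  exact ContDiff.sum fun i _ => pd_contDiff i (pd_contDiff i hf)

lemma lap_tsupport {n : ℕ} (f : (EE n) → ℝ) : tsupport (lap f) ⊆ tsupport f := by
  refine closure_minimal ?_ (isClosed_tsupport f)
  intro x hx
  by_contra h
  apply hx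
  rw [lap_eq]
  refine Finset.sum_eq_zero fun i _ => ?_
  by_contra h2
  exact h (pd_tsupport i f (pd_tsupport i _ (subset_tsupport _ h2)))

lemma IsTestFun.lap_test {n : ℕ} {U : Set (EE n)} {f : (EE n) → ℝ} (hf : IsTestFun U f) :
    IsTestFun U (lap f) :=
  ⟨lap_contDiff hf.1, hf.2.1.of_isClosed_subset (isClosed_tsupport _) (lap_tsupport f),
    (lap_tsupport f).trans hf.2.2⟩

lemma pd_lap {n : ℕ} (i : Fin n) {f : (EE n) → ℝ} (hf : ContDiff ℝ (⊤ : ℕ∞) f) (x : EE n) :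
    pd i (lap f) x = lap (pd i f) x := by
  have h1 : pd i (lap f) x = ∑ j, pd i (pd j (pd j f)) x := by
    have : HasFDerivAt (lap f) (∑ j, fderiv ℝ (pd j (pd j f)) x) x := by
      have : lap f = fun x => ∑ i, pd i (pd i f) x := rfl
      rw [this]
      exact HasFDerivAt.fun_sum fun j _ =>
        (diff_of_smooth (pd_contDiff j (pd_contDiff j hf)) x).hasFDerivAt
    unfold pd at this ⊢
    rw [this.fderiv]; simp
  rw [h1, lap_eq]
  refine Finset.sum_congr rfl fun j _ => ?_
  rw [pd_comm i j (pd_contDiff j hf)]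
  congr 1
  funext y
  exact pd_comm i j hf y

/-- A compatible pair of kernels of homogeneity `N`. -/
structure Pair {n : ℕ} (N : ℕ) (a b : (EE n) → ℝ) : Prop where
  sa : ContDiff ℝ (⊤ : ℕ∞) a
  sb : ContDiff ℝ (⊤ : ℕ∞) b
  za : ∀ x, 1 < ‖x‖ → a x = 0
  zb : ∀ x, 1 < ‖x‖ → b x = 0
  eq : ∀ x, N * a x + fderiv ℝ a x x = - lap b x

lemma Pair.deriv {n N : ℕ} {a b : (EE n) → ℝ} (h : Pair N a b) (i : Fin n) :
    Pair (N+1) (pd i a) (pd i b) := by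
  refine ⟨pd_contDiff i h.sa, pd_contDiff i h.sb, pd_zero_of i h.za, pd_zero_of i h.zb, ?_⟩
  intro x
  rw [← pd_lap i h.sb]
  have h1 : (fun x => N * a x + fderiv ℝ a x x) = fun x => - lap b x := funext h.eq
  have hL : HasFDerivAt (fun x => (N:ℝ) * a x + ∑ j, x j * pd j a x)
      ((N:ℝ) • fderiv ℝ a x + ∑ j, (x j • fderiv ℝ (pd j a) x +
        pd j a x • (EuclideanSpace.proj j : (EE n) →L[ℝ] ℝ))) x := by
    refine ((diff_of_smooth h.sa x).hasFDerivAt.const_mul (N:ℝ)).add ?_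
    refine HasFDerivAt.fun_sum fun j _ => ?_
    exact (EuclideanSpace.proj j : (EE n) →L[ℝ] ℝ).hasFDerivAt.mul
      (diff_of_smooth (pd_contDiff j h.sa) x).hasFDerivAt
  have h2 : (fun x => (N:ℝ) * a x + ∑ j, x j * pd j a x) = fun x => - lap b x := by
    rw [← h1]; funext y; rw [fderiv_apply_sum (fderiv ℝ a y) y]; rfl
  rw [h2] at hL
  have h3 : HasFDerivAt (fun x => - lap b x) (-(fderiv ℝ (lap b) x)) x :=
    (diff_of_smooth (lap_contDiff h.sb) x).hasFDerivAt.neg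
  have h4 := congrArg (fun L : (EE n) →L[ℝ] ℝ => L (EuclideanSpace.single i 1)) (h3.unique hL)
  simp only [_root_.neg_apply, _root_.add_apply,
    _root_.smul_apply, _root_.sum_apply, smul_eq_mul,
    Finset.sum_add_distrib] at h4
  have h5 : ∑ j, pd j a x * (EuclideanSpace.proj j : (EE n) →L[ℝ] ℝ)
      (EuclideanSpace.single i 1) = pd i a x := by
    simp
  have h6 : ∑ j, x j * fderiv ℝ (pd j a) x (EuclideanSpace.single i 1)
      = fderiv ℝ (pd i a) x x := by
    rw [fderiv_apply_sum]
    refine Finset.sum_congr rfl fun j _ => ?_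
    congr 1
    exact pd_comm i j h.sa x
  rw [h5, h6] at h4
  push_cast
  have h7 : pd i (lap b) x = fderiv ℝ (lap b) x (EuclideanSpace.single i 1) := rfl
  have h8 : pd i a x = fderiv ℝ a x (EuclideanSpace.single i 1) := rfl
  rw [h7, h4]; rw [← h8]; ring

/-- The basic kernel. -/
def K {n : ℕ} (x : EE n) : ℝ := expNegInvGlue (1 - ‖x‖^2)

/-- The averaging kernel. -/
def S {n : ℕ} (x : EE n) : ℝ := 2 * (((1 - ‖x‖^2)⁻¹)^2 * expNegInvGlue (1 - ‖x‖^2))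

lemma smooth_one_sub {n : ℕ} : ContDiff ℝ (⊤ : ℕ∞) (fun x : EE n => 1 - ‖x‖^2) :=
  contDiff_const.sub (contDiff_norm_sq ℝ)

lemma K_smooth {n : ℕ} : ContDiff ℝ (⊤ : ℕ∞) (K : (EE n) → ℝ) :=
  expNegInvGlue.contDiff.comp smooth_one_sub

lemma S_smooth {n : ℕ} : ContDiff ℝ (⊤ : ℕ∞) (S : (EE n) → ℝ) := by
  have := (expNegInvGlue.contDiff_polynomial_eval_inv_mul (n := ⊤)
    ((Polynomial.X : Polynomial ℝ)^2)).comp (smooth_one_sub (n := n))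
  have h2 := (contDiff_const (c := (2:ℝ))).mul this
  have h3 : (S : (EE n) → ℝ) = fun x => 2 * ((fun x => Polynomial.eval x⁻¹
      ((Polynomial.X : Polynomial ℝ)^2) * expNegInvGlue x) ∘ fun x : EE n => 1 - ‖x‖ ^ 2) x := by
    funext x; simp [S]
  rw [h3]; exact h2

lemma K_nonneg {n : ℕ} (x : EE n) : 0 ≤ K x := expNegInvGlue.nonneg _

lemma S_nonneg {n : ℕ} (x : EE n) : 0 ≤ S x := by
  have := expNegInvGlue.nonneg (1 - ‖x‖^2)
  unfold S; positivity

lemma S_pos {n : ℕ} (x : EE n) (h : ‖x‖ < 1) : 0 < S x := by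
  have h1 : 0 < 1 - ‖x‖^2 := by nlinarith [norm_nonneg x]
  have := expNegInvGlue.pos_of_pos h1
  unfold S; positivity

lemma K_zero {n : ℕ} (x : EE n) (h : 1 < ‖x‖) : K x = 0 :=
  expNegInvGlue.zero_of_nonpos (by nlinarith)

lemma S_zero {n : ℕ} (x : EE n) (h : 1 < ‖x‖) : S x = 0 := by
  unfold S
  rw [expNegInvGlue.zero_of_nonpos (by nlinarith)]; simp

lemma K_le {n : ℕ} (x : EE n) : 2 * K x ≤ S x := by
  unfold S K
  have h0 := expNegInvGlue.nonneg (1 - ‖x‖^2)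
  rcases le_or_gt (1 - ‖x‖^2) 0 with h | h
  · rw [expNegInvGlue.zero_of_nonpos h]; simp
  · have : 1 ≤ (1 - ‖x‖^2)⁻¹ := (one_le_inv₀ h).2 (by nlinarith [norm_nonneg x])
    nlinarith [mul_le_mul_of_nonneg_right (one_le_pow₀ this (n := 2)) h0]

lemma pd_K {n : ℕ} (i : Fin n) (x : EE n) : pd i K x = - (x i * S x) := by
  have h1 := expNegInvGlue.hasDerivAt_polynomial_eval_inv_mul 1 (1 - ‖x‖^2)
  have h2 : HasFDerivAt (fun x : EE n => 1 - ‖x‖^2) (-(2 • (innerSL ℝ x))) x := by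
    simpa using (hasStrictFDerivAt_norm_sq x).hasFDerivAt.const_sub 1
  have h3 := h1.comp_hasFDerivAt x h2
  have h4 : (K : (EE n) → ℝ) = ((fun x => Polynomial.eval x⁻¹ (1 : Polynomial ℝ) *
      expNegInvGlue x) ∘ fun x : EE n => 1 - ‖x‖ ^ 2) := by
    funext y; simp [K]
  unfold pd
  rw [h4, h3.fderiv]
  simp [S, EuclideanSpace.inner_single_right]
  ring

lemma pair_SK {n : ℕ} : Pair n (S : (EE n) → ℝ) K := by
  refine ⟨S_smooth, K_smooth, S_zero, K_zero, fun x => ?_⟩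
  rw [lap_eq, fderiv_apply_sum]
  have : ∀ i : Fin n, pd i (pd i K) x = - (S x + x i * pd i S x) := by
    intro i
    have h1 : pd i K = fun x : EE n => - (x i * S x) := funext (pd_K i)
    have h2 : HasFDerivAt (fun x : EE n => - (x i * S x)) (-(x i • fderiv ℝ S x +
        S x • (EuclideanSpace.proj i : (EE n) →L[ℝ] ℝ))) x :=
      ((EuclideanSpace.proj i : (EE n) →L[ℝ] ℝ).hasFDerivAt.mul
      (diff_of_smooth S_smooth x).hasFDerivAt).neg
    rw [h1]
    unfold pd
    rw [h2.fderiv]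
    simp
    ring
  simp only [this]
  simp [Finset.sum_add_distrib, pd]

end AAP

namespace AAP
open Filter Topology Set

/-- `Δ u = g` weakly on `U`. -/
structure WeakLap {n : ℕ} (U : Set (EE n)) (u g : (EE n) → ℝ) : Prop where
  iu : LocallyIntegrable u volume
  ig : LocallyIntegrable g volume
  eq : ∀ φ, IsTestFun U φ → ∫ y, u y * lap φ y = ∫ y, g y * φ y

/-- Kernel averages. -/
def FF {n : ℕ} (a : (EE n) → ℝ) (N : ℕ) (u : (EE n) → ℝ) (x : EE n) (s : ℝ) : ℝ :=
  s^N * ∫ y, a (s • (x - y)) * u y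

lemma hcs_of_zero {n : ℕ} {a : (EE n) → ℝ} (h : ∀ x, 1 < ‖x‖ → a x = 0) :
    HasCompactSupport a := by
  refine HasCompactSupport.of_support_subset_isCompact (isCompact_closedBall (0 : EE n) 1) ?_
  intro x hx
  by_contra h2
  exact hx (h x (by simpa using h2))

lemma bdd_of_zero {n : ℕ} {a : (EE n) → ℝ} (hc : Continuous a) (h : ∀ x, 1 < ‖x‖ → a x = 0) :
    ∃ C, 0 < C ∧ ∀ x, |a x| ≤ C := by
  obtain ⟨C, hC⟩ := hc.bounded_above_of_compact_support (hcs_of_zero h)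
  refine ⟨max C 1, by positivity, fun x => (hC x).trans (le_max_left _ _)⟩

lemma ker_zero {n : ℕ} {a : (EE n) → ℝ} (h : ∀ x, 1 < ‖x‖ → a x = 0) {s : ℝ} (hs : 0 < s)
    {x y : EE n} (hy : y ∉ Metric.closedBall x (1/s)) : a (s • (x - y)) = 0 := by
  apply h
  rw [norm_smul, Real.norm_of_nonneg hs.le]
  rw [Metric.mem_closedBall, not_le, dist_comm, dist_eq_norm, div_lt_iff₀ hs] at hy
  linarith

lemma ker_tsupport {n : ℕ} {a : (EE n) → ℝ} (h : ∀ x, 1 < ‖x‖ → a x = 0) {s : ℝ} (hs : 0 < s)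
    (x : EE n) : tsupport (fun y => a (s • (x - y))) ⊆ Metric.closedBall x (1/s) := by
  refine closure_minimal ?_ Metric.isClosed_closedBall
  intro y hy
  by_contra h2
  exact hy (ker_zero h hs h2)

lemma ker_hcs {n : ℕ} {a : (EE n) → ℝ} (h : ∀ x, 1 < ‖x‖ → a x = 0) {s : ℝ} (hs : 0 < s)
    (x : EE n) : HasCompactSupport (fun y => a (s • (x - y))) :=
  (isCompact_closedBall x (1/s)).of_isClosed_subset (isClosed_tsupport _) (ker_tsupport h hs x)

lemma ker_smooth {n : ℕ} {a : (EE n) → ℝ} (h : ContDiff ℝ (⊤ : ℕ∞) a) (s : ℝ)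
    (x : EE n) : ContDiff ℝ (⊤ : ℕ∞) (fun y => a (s • (x - y))) :=
  h.comp (by fun_prop)

lemma ker_cont {n : ℕ} {a : (EE n) → ℝ} (h : Continuous a) (s : ℝ)
    (x : EE n) : Continuous (fun y => a (s • (x - y))) :=
  h.comp (by fun_prop)

lemma ker_integrable {n : ℕ} {a : (EE n) → ℝ} (hc : Continuous a) (h : ∀ x, 1 < ‖x‖ → a x = 0)
    {s : ℝ} (hs : 0 < s) (x : EE n) {u : (EE n) → ℝ} (hu : LocallyIntegrable u volume) :
    Integrable (fun y => a (s • (x - y)) * u y) := by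
  simpa using hu.integrable_smul_left_of_hasCompactSupport (ker_cont hc s x) (ker_hcs h hs x)

lemma pd_ker {n : ℕ} {a : (EE n) → ℝ} (h : ContDiff ℝ (⊤ : ℕ∞) a) (s : ℝ)
    (x y : EE n) (i : Fin n) : pd i (fun y => a (s • (x - y))) y = -s * pd i a (s • (x - y)) := by
  have h1 : HasFDerivAt (fun y : EE n => s • (x - y)) (s • (-(ContinuousLinearMap.id ℝ (EE n)))) y :=
    ((hasFDerivAt_id y).const_sub x).const_smul s
  have h2 := (diff_of_smooth h (s • (x - y))).hasFDerivAt.comp y h1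
  have h3 : (fun y => a (s • (x - y))) = a ∘ fun y : EE n => s • (x - y) := rfl
  unfold pd
  rw [h3, h2.fderiv]
  simp

lemma pd_const_mul {n : ℕ} {f : (EE n) → ℝ} (h : Differentiable ℝ f) (c : ℝ) (y : EE n)
    (i : Fin n) : pd i (fun y => c * f y) y = c * pd i f y := by
  unfold pd
  rw [((h y).hasFDerivAt.const_mul c).fderiv]; rfl

lemma lap_ker {n : ℕ} {a : (EE n) → ℝ} (h : ContDiff ℝ (⊤ : ℕ∞) a) (s : ℝ)
    (x y : EE n) : lap (fun y => a (s • (x - y))) y = s^2 * lap a (s • (x - y)) := by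
  rw [lap_eq, lap_eq, Finset.mul_sum]
  refine Finset.sum_congr rfl fun i _ => ?_
  have : pd i (fun y => a (s • (x - y))) = fun y => -s * pd i a (s • (x - y)) :=
    funext fun y => pd_ker h s x y i
  rw [this, pd_const_mul (diff_of_smooth (ker_smooth (pd_contDiff i h) s x)),
    pd_ker (pd_contDiff i h)]
  ring

lemma lap_zero_of {n : ℕ} {f : (EE n) → ℝ}
    (h : ∀ x, 1 < ‖x‖ → f x = 0) : ∀ x, 1 < ‖x‖ → lap f x = 0 := by
  intro x hx
  rw [lap_eq]
  exact Finset.sum_eq_zero fun i _ => pd_zero_of i (pd_zero_of i h) x hx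

lemma ker_test {n : ℕ} {a : (EE n) → ℝ} (h : ContDiff ℝ (⊤ : ℕ∞) a)
    (h0 : ∀ x, 1 < ‖x‖ → a x = 0) {s R : ℝ} (hR : 0 < R) (hs : 1 / R < s)
    {x : EE n} {U : Set (EE n)} (hU : Metric.ball x R ⊆ U) :
    IsTestFun U (fun y => a (s • (x - y))) := by
  have hs0 : 0 < s := lt_trans (by positivity) hs
  refine ⟨ker_smooth h s x, ker_hcs h0 hs0 x, (ker_tsupport h0 hs0 x).trans
    ((Metric.closedBall_subset_ball ?_).trans hU)⟩
  rw [div_lt_iff₀ hs0]; rwa [div_lt_iff₀ hR, mul_comm] at hs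

lemma weak_ker {n : ℕ} {U : Set (EE n)} {u g a : (EE n) → ℝ} (hw : WeakLap U u g)
    (h : ContDiff ℝ (⊤ : ℕ∞) a)
    (h0 : ∀ x, 1 < ‖x‖ → a x = 0) {s R : ℝ} (hR : 0 < R) (hs : 1 / R < s)
    {x : EE n} (hU : Metric.ball x R ⊆ U) :
    s^2 * ∫ y, lap a (s • (x - y)) * u y = ∫ y, a (s • (x - y)) * g y := by
  have := hw.eq _ (ker_test h h0 hR hs hU)
  simp only [lap_ker h] at this
  rw [← integral_const_mul]
  convert this using 1
  · congr 1; funext y; ring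
  · congr 1; funext y; ring

lemma FF_hasDerivAt {n N : ℕ} {a b : (EE n) → ℝ} (hp : Pair N a b) {U : Set (EE n)}
    {u g : (EE n) → ℝ} (hw : WeakLap U u g) {s R : ℝ} (hR : 0 < R) (hs : 1 / R < s)
    {x : EE n} (hU : Metric.ball x R ⊆ U) :
    HasDerivAt (FF a N u x) (-(s^N / s^3 * ∫ y, b (s • (x - y)) * g y)) s := by
  have hs0 : 0 < s := lt_trans (by positivity) hs
  have hlc := (lap_contDiff hp.sb).continuous
  have hlz := lap_zero_of hp.zb
  obtain ⟨C, hC0, hC⟩ := bdd_of_zero hlc hlz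
  have key := (hasDerivAt_integral_of_dominated_loc_of_deriv_le (μ := volume)
    (F := fun s y => s^N * (a (s • (x - y)) * u y))
    (F' := fun s y => -(s^N / s) * (lap b (s • (x - y)) * u y))
    (bound := (Metric.closedBall x (2/s)).indicator
      (fun y => ((2*s)^N / (s/2) * C) * |u y|)) (s := Ioo (s/2) (2*s)) (x₀ := s)
    (Ioo_mem_nhds (by linarith) (by linarith)) ?_ ?_ ?_ ?_ ?_ ?_).2
  · have e1 : FF a N u x = fun s => ∫ y, s^N * (a (s • (x - y)) * u y) := by
      funext t; rw [integral_const_mul]; rfl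
    rw [e1]
    refine key.congr_deriv ?_
    rw [integral_const_mul, ← weak_ker hw hp.sb hp.zb hR hs hU]
    field_simp
  · filter_upwards [lt_mem_nhds hs0] with t ht
    exact ((ker_integrable hp.sa.continuous hp.za ht x hw.iu).const_mul _).aestronglyMeasurable
  · exact ((ker_integrable hp.sa.continuous hp.za hs0 x hw.iu).const_mul _)
  · exact ((ker_integrable hlc hlz hs0 x hw.iu).const_mul _).aestronglyMeasurable
  · refine Eventually.of_forall fun y t ht => ?_
    have ht0 : 0 < t := lt_trans (by positivity) ht.1
    by_cases hy : y ∈ Metric.closedBall x (2/s)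
    · rw [indicator_of_mem hy, norm_mul, norm_mul, norm_neg, Real.norm_eq_abs, Real.norm_eq_abs,
        Real.norm_eq_abs, ← mul_assoc]
      gcongr
      · rw [abs_of_pos (by positivity)]
        gcongr
        · exact ht.2.le
        · exact ht.1.le
      · exact hC _
    · rw [indicator_of_notMem hy]
      have : y ∉ Metric.closedBall x (1/t) := by
        intro h
        refine hy (Metric.closedBall_subset_closedBall ?_ h)
        rw [div_le_div_iff₀ ht0 hs0]; linarith [ht.1]
      rw [ker_zero hlz ht0 this]; simp
  · rw [integrable_indicator_iff Metric.isClosed_closedBall.measurableSet]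
    exact ((hw.iu.integrableOn_isCompact (isCompact_closedBall _ _)).norm).const_mul _
  · refine Eventually.of_forall fun y t ht => ?_
    have ht0 : 0 < t := lt_trans (by positivity) ht.1
    have h1 : HasDerivAt (fun t : ℝ => t • (x - y)) (x - y) t := by
      simpa using (hasDerivAt_id t).smul_const (x - y)
    have h2 := (diff_of_smooth hp.sa (t • (x - y))).hasFDerivAt.comp_hasDerivAt t h1
    have h3 := (hasDerivAt_pow N t).mul (h2.mul_const (u y))
    refine h3.congr_deriv ?_
    have e := hp.eq (t • (x - y))
    rw [map_smul, smul_eq_mul] at e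
    have e2 : lap b (t • (x - y)) = -(N * a (t • (x - y)) + t * fderiv ℝ a (t • (x - y)) (x - y)) := by
      linarith
    rw [e2]
    simp only [Function.comp]
    rcases N with _ | N
    · simp; field_simp
    · simp only [Nat.add_sub_cancel, pow_succ]; field_simp

end AAP

namespace AAP
open Filter Topology Set

lemma S_cont {n : ℕ} : Continuous (S : (EE n) → ℝ) := S_smooth.continuous
lemma K_cont {n : ℕ} : Continuous (K : (EE n) → ℝ) := K_smooth.continuous

lemma FF_S_nonneg {n : ℕ} {u : (EE n) → ℝ} (hu : ∀ᵐ y, 0 ≤ u y) {s : ℝ} (hs : 0 ≤ s) (x : EE n) :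
    0 ≤ FF S n u x s := by
  refine mul_nonneg (by positivity) (integral_nonneg_of_ae ?_)
  filter_upwards [hu] with y hy
  exact mul_nonneg (S_nonneg _) hy

lemma K_int_le {n : ℕ} {U : Set (EE n)} {u g : (EE n) → ℝ} (hu : ∀ᵐ y, 0 ≤ u y)
    (iu : LocallyIntegrable u volume) (ig : LocallyIntegrable g volume) {M : ℝ} (hM : 0 ≤ M)
    (hg : ∀ᵐ y, y ∈ U → g y ≤ M * u y) {s R : ℝ} (hR : 0 < R) (hs : 1 / R < s)
    {x : EE n} (hU : Metric.ball x R ⊆ U) :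
    s^n / s^3 * ∫ y, K (s • (x - y)) * g y ≤ M / (2 * s^3) * FF S n u x s := by
  have hs0 : 0 < s := lt_trans (by positivity) hs
  have h1 : ∫ y, K (s • (x - y)) * g y ≤ ∫ y, M / 2 * (S (s • (x - y)) * u y) := by
    refine integral_mono_ae (ker_integrable K_cont K_zero hs0 x ig)
      ((ker_integrable S_cont S_zero hs0 x iu).const_mul _) ?_
    filter_upwards [hu, hg] with y hy hgy
    by_cases hyU : y ∈ U
    · have h2 := hgy hyU
      have h3 := K_le (s • (x - y))
      have h4 := K_nonneg (s • (x - y))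
      calc K (s • (x - y)) * g y ≤ K (s • (x - y)) * (M * u y) := by gcongr
        _ = (M * u y / 2) * (2 * K (s • (x - y))) := by ring
        _ ≤ (M * u y / 2) * S (s • (x - y)) := by gcongr
        _ = _ := by ring
    · have : y ∉ Metric.closedBall x (1/s) := by
        intro h
        refine hyU (hU (Metric.closedBall_subset_ball ?_ h))
        rw [div_lt_iff₀ hs0]; rwa [div_lt_iff₀ hR, mul_comm] at hs
      simp only [ker_zero K_zero hs0 this, ker_zero S_zero hs0 this]; simp
  rw [integral_const_mul] at h1
  calc s^n / s^3 * ∫ y, K (s • (x - y)) * g y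
      ≤ s^n / s^3 * (M / 2 * ∫ y, S (s • (x - y)) * u y) := by gcongr
    _ = _ := by unfold FF; field_simp

lemma hasDerivAt_exp_inv {c s : ℝ} (hs : 0 < s) :
    HasDerivAt (fun s : ℝ => Real.exp (c / (4 * s^2))) (Real.exp (c / (4*s^2)) * (-(c / (2 * s^3)))) s := by
  have h1 : HasDerivAt (fun s : ℝ => 4 * s^2) (4 * (2 * s)) s := by
    simpa using (hasDerivAt_pow 2 s).const_mul 4
  have h2 := ((hasDerivAt_const s c).div h1 (by positivity)).exp
  refine h2.congr_deriv ?_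
  simp only [Pi.div_apply]
  congr 1
  field_simp
  ring

lemma FF_super {n : ℕ} {U : Set (EE n)} {u g : (EE n) → ℝ} (hw : WeakLap U u g)
    (hu : ∀ᵐ y, 0 ≤ u y) {M : ℝ} (hM : 0 ≤ M)
    (hg : ∀ᵐ y, y ∈ U → g y ≤ M * u y) {R : ℝ} (hR : 0 < R)
    {x : EE n} (hU : Metric.ball x R ⊆ U) :
    MonotoneOn (fun s => FF S n u x s * Real.exp (-M / (4 * s^2))) (Ioi (1/R)) := by
  have hd : ∀ s ∈ Ioi (1/R), HasDerivAt (fun s => FF S n u x s * Real.exp (-M / (4 * s^2)))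
      (-(s^n / s^3 * ∫ y, K (s • (x - y)) * g y) * Real.exp (-M / (4 * s^2)) +
        FF S n u x s * (Real.exp (-M / (4*s^2)) * (-(-M / (2 * s^3))))) s := by
    intro s hs
    have hs0 : 0 < s := lt_trans (by positivity) hs
    exact (FF_hasDerivAt pair_SK hw hR hs hU).mul (hasDerivAt_exp_inv hs0)
  refine monotoneOn_of_deriv_nonneg (convex_Ioi _) (fun s hs => (hd s hs).continuousAt.continuousWithinAt)
    (fun s hs => ?_) (fun s hs => ?_)
  · rw [interior_Ioi] at hs; exact (hd s hs).differentiableAt.differentiableWithinAt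
  · rw [interior_Ioi] at hs
    rw [(hd s hs).deriv]
    have := K_int_le hu hw.iu hw.ig hM hg hR hs hU
    have he := Real.exp_pos (-M / (4 * s^2))
    have : -(s^n / s^3 * ∫ y, K (s • (x - y)) * g y) * Real.exp (-M / (4 * s^2)) +
        FF S n u x s * (Real.exp (-M / (4*s^2)) * (-(-M / (2 * s^3)))) =
        Real.exp (-M / (4 * s^2)) * (M / (2 * s^3) * FF S n u x s -
          s^n / s^3 * ∫ y, K (s • (x - y)) * g y) := by ring
    rw [this]
    exact mul_nonneg he.le (by linarith)

lemma FF_sub {n : ℕ} {U : Set (EE n)} {u g : (EE n) → ℝ} (hw : WeakLap U u g)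
    (hu : ∀ᵐ y, 0 ≤ u y) {M : ℝ} (hM : 0 ≤ M)
    (hg : ∀ᵐ y, y ∈ U → -(M * u y) ≤ g y) {R : ℝ} (hR : 0 < R)
    {x : EE n} (hU : Metric.ball x R ⊆ U) :
    AntitoneOn (fun s => FF S n u x s * Real.exp (M / (4 * s^2))) (Ioi (1/R)) := by
  have hd : ∀ s ∈ Ioi (1/R), HasDerivAt (fun s => FF S n u x s * Real.exp (M / (4 * s^2)))
      (-(s^n / s^3 * ∫ y, K (s • (x - y)) * g y) * Real.exp (M / (4 * s^2)) +
        FF S n u x s * (Real.exp (M / (4*s^2)) * (-(M / (2 * s^3))))) s := by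
    intro s hs
    have hs0 : 0 < s := lt_trans (by positivity) hs
    exact (FF_hasDerivAt pair_SK hw hR hs hU).mul (hasDerivAt_exp_inv hs0)
  refine antitoneOn_of_deriv_nonpos (convex_Ioi _) (fun s hs => (hd s hs).continuousAt.continuousWithinAt)
    (fun s hs => ?_) (fun s hs => ?_)
  · rw [interior_Ioi] at hs; exact (hd s hs).differentiableAt.differentiableWithinAt
  · rw [interior_Ioi] at hs
    rw [(hd s hs).deriv]
    have := K_int_le (g := fun y => - g y) hu hw.iu hw.ig.neg hM (by
      filter_upwards [hg] with y hy hyU; linarith [hy hyU]) hR hs hU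
    simp only [mul_neg, integral_neg] at this
    have he := Real.exp_pos (M / (4 * s^2))
    have : -(s^n / s^3 * ∫ y, K (s • (x - y)) * g y) * Real.exp (M / (4 * s^2)) +
        FF S n u x s * (Real.exp (M / (4*s^2)) * (-(M / (2 * s^3)))) =
        - (Real.exp (M / (4 * s^2)) * (M / (2 * s^3) * FF S n u x s +
          s^n / s^3 * ∫ y, K (s • (x - y)) * g y)) := by ring
    rw [this]
    exact neg_nonpos.2 (mul_nonneg he.le (by linarith))

/-- Total mass of the kernel. -/
def mS (n : ℕ) : ℝ := ∫ y : EE n, S y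

lemma integrable_of_zero {n : ℕ} {a : (EE n) → ℝ} (hc : Continuous a)
    (h : ∀ x, 1 < ‖x‖ → a x = 0) : Integrable a :=
  hc.integrable_of_hasCompactSupport (hcs_of_zero h)

lemma mS_pos (n : ℕ) : 0 < mS n := by
  unfold mS
  rw [integral_pos_iff_support_of_nonneg S_nonneg (integrable_of_zero S_cont S_zero)]
  refine lt_of_lt_of_le (Metric.measure_ball_pos volume (0 : EE n) one_pos) (measure_mono ?_)
  intro y hy
  exact (S_pos y (by simpa using hy)).ne'

lemma integral_ker {n : ℕ} (a : (EE n) → ℝ) {s : ℝ} (hs : 0 < s) (x : EE n) :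
    s^n * ∫ y, a (s • (x - y)) = ∫ y, a y := by
  rw [integral_sub_left_eq_self (fun y => a (s • y)) volume x, Measure.integral_comp_smul]
  rw [abs_of_pos (by positivity)]
  simp
  field_simp

lemma FF_sub_eq {n : ℕ} {u : (EE n) → ℝ} (hu : LocallyIntegrable u volume) {s : ℝ} (hs : 0 < s)
    (x : EE n) (c : ℝ) :
    FF S n u x s - mS n * c = s^n * ∫ y, S (s • (x - y)) * (u y - c) := by
  have h1 : Integrable (fun y => S (s • (x - y)) * u y) := ker_integrable S_cont S_zero hs x hu
  have h2 : Integrable (fun y => S (s • (x - y)) * c) :=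
    ker_integrable S_cont S_zero hs x (locallyIntegrable_const c)
  simp only [mul_sub]
  rw [integral_sub h1 h2, integral_mul_const, mul_sub, ← mul_assoc, integral_ker _ hs]
  rfl

lemma FF_ae_tendsto {n : ℕ} {u : (EE n) → ℝ} (hu : LocallyIntegrable u volume) :
    ∀ᵐ x, Tendsto (FF S n u x) atTop (𝓝 (mS n * u x)) := by
  obtain ⟨C, hC0, hC⟩ := bdd_of_zero (n := n) S_cont S_zero
  filter_upwards [IsUnifLocDoublingMeasure.ae_tendsto_average_norm_sub volume hu 1] with x hx
  have h1 := hx (ι := ℝ) (l := atTop) (fun _ => x) (fun s => 1/s) ?_ ?_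
  · rw [tendsto_iff_norm_sub_tendsto_zero]
    have h2 := h1.const_mul (C * (volume.real (Metric.closedBall (0 : EE n) 1)))
    rw [mul_zero] at h2
    refine squeeze_zero' (Eventually.of_forall fun s => norm_nonneg _) ?_ h2
    filter_upwards [eventually_gt_atTop 0] with s hs
    rw [FF_sub_eq hu hs]
    rw [norm_mul, Real.norm_of_nonneg (by positivity)]
    have hInt1 : IntegrableOn (fun y => ‖u y - u x‖) (Metric.closedBall x (1/s)) :=
      ((hu.integrableOn_isCompact (isCompact_closedBall _ _)).sub
        (integrableOn_const (isCompact_closedBall x (1/s)).measure_lt_top.ne)).norm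
    have h3 : ‖∫ y, S (s • (x - y)) * (u y - u x)‖ ≤
        ∫ y in Metric.closedBall x (1/s), C * ‖u y - u x‖ := by
      rw [← integral_indicator Metric.isClosed_closedBall.measurableSet]
      refine norm_integral_le_of_norm_le ?_ (Eventually.of_forall fun y => ?_)
      · rw [integrable_indicator_iff Metric.isClosed_closedBall.measurableSet]
        exact hInt1.const_mul C
      · by_cases hy : y ∈ Metric.closedBall x (1/s)
        · rw [indicator_of_mem hy, norm_mul]
          gcongr; exact hC _
        · rw [indicator_of_notMem hy, ker_zero S_zero hs hy]; simp
    rw [integral_const_mul] at h3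
    have hvol : volume.real (Metric.closedBall x (1/s)) =
        (s^n)⁻¹ * volume.real (Metric.closedBall (0 : EE n) 1) := by
      rw [measureReal_def, Measure.addHaar_closedBall' _ _ (by positivity), measureReal_def,
        ENNReal.toReal_mul, ENNReal.toReal_ofReal (by positivity)]
      simp
    rw [setAverage_eq, hvol]
    refine (mul_le_mul_of_nonneg_left h3 (by positivity)).trans (le_of_eq ?_)
    have hv : volume.real (Metric.closedBall (0 : EE n) 1) ≠ 0 := by
      rw [measureReal_def]
      exact (ENNReal.toReal_pos (Metric.measure_closedBall_pos volume _ one_pos).ne'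
        (isCompact_closedBall _ _).measure_lt_top.ne).ne'
    rw [smul_eq_mul]
    field_simp
  · refine tendsto_nhdsWithin_iff.2 ⟨?_, ?_⟩
    · simpa using tendsto_inv_atTop_zero (𝕜 := ℝ)
    · filter_upwards [eventually_gt_atTop 0] with s hs
      simp only [mem_Ioi]; positivity
  · filter_upwards [eventually_gt_atTop 0] with s hs
    simp only [Metric.mem_closedBall, dist_self]; positivity

lemma FF_tendsto_of_continuousAt {n : ℕ} {u : (EE n) → ℝ} (hu : LocallyIntegrable u volume)
    {x : EE n} (hc : ContinuousAt u x) :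
    Tendsto (FF S n u x) atTop (𝓝 (mS n * u x)) := by
  rw [Metric.tendsto_atTop]
  intro ε hε
  have hm := mS_pos n
  obtain ⟨δ, hδ, h⟩ := Metric.continuousAt_iff.1 hc (ε / (2 * mS n)) (by positivity)
  refine ⟨2 / δ, fun s hs => ?_⟩
  have hs0 : 0 < s := lt_of_lt_of_le (by positivity) hs
  rw [Real.dist_eq, FF_sub_eq hu hs0, abs_mul, abs_of_pos (by positivity)]
  have h3 : |∫ y, S (s • (x - y)) * (u y - u x)| ≤
      ∫ y, S (s • (x - y)) * (ε / (2 * mS n)) := by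
    rw [← Real.norm_eq_abs]
    refine norm_integral_le_of_norm_le (ker_integrable S_cont S_zero hs0 x
      (locallyIntegrable_const _)) (Eventually.of_forall fun y => ?_)
    rw [norm_mul, Real.norm_of_nonneg (S_nonneg _)]
    by_cases hy : y ∈ Metric.closedBall x (1/s)
    · refine mul_le_mul_of_nonneg_left ?_ (S_nonneg _)
      have : dist y x < δ := by
        refine lt_of_le_of_lt hy ?_
        rw [ge_iff_le, div_le_iff₀ hδ] at hs
        rw [div_lt_iff₀ hs0]; linarith
      exact (h this).le
    · rw [ker_zero S_zero hs0 hy]; simp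
  refine lt_of_le_of_lt (mul_le_mul_of_nonneg_left h3 (by positivity)) ?_
  rw [integral_mul_const, ← mul_assoc, integral_ker _ hs0]
  change mS n * _ < ε
  rw [mul_div_assoc', div_lt_iff₀ (by positivity)]
  nlinarith [mul_pos hm hε]

end AAP

namespace AAP
open Filter Topology Set

/-- The precise representative. -/
def uhat {n : ℕ} (u : (EE n) → ℝ) (x : EE n) : ℝ := limUnder atTop (FF S n u x) / mS n

lemma uhat_eq_of_tendsto {n : ℕ} {u : (EE n) → ℝ} {x : EE n} {c : ℝ}
    (h : Tendsto (FF S n u x) atTop (𝓝 (mS n * c))) : uhat u x = c := by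
  unfold uhat
  rw [h.limUnder_eq]
  have := (mS_pos n).ne'
  field_simp

lemma uhat_ae {n : ℕ} {u : (EE n) → ℝ} (hu : LocallyIntegrable u volume) :
    ∀ᵐ x, uhat u x = u x := by
  filter_upwards [FF_ae_tendsto hu] with x hx
  exact uhat_eq_of_tendsto hx

/-- Nonnegative local weak solution with a bounded potential. -/
structure Loc {n : ℕ} (U : Set (EE n)) (u g : (EE n) → ℝ) (M : ℝ) : Prop where
  hw : WeakLap U u g
  hu : ∀ᵐ y, 0 ≤ u y
  hM : 0 ≤ M
  hg1 : ∀ᵐ y, y ∈ U → g y ≤ M * u y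
  hg2 : ∀ᵐ y, y ∈ U → -(M * u y) ≤ g y

lemma tendsto_exp_one (c : ℝ) : Tendsto (fun s : ℝ => Real.exp (c / (4 * s^2))) atTop (𝓝 1) := by
  have h : Tendsto (fun s : ℝ => c / (4 * s^2)) atTop (𝓝 0) :=
    Tendsto.div_atTop tendsto_const_nhds
      ((tendsto_pow_atTop (two_ne_zero)).const_mul_atTop (by norm_num))
  have h2 := (Real.continuous_exp.tendsto 0).comp h
  rw [Real.exp_zero] at h2
  exact h2

lemma Loc.tendsto {n : ℕ} {U : Set (EE n)} {u g : (EE n) → ℝ} {M : ℝ} (h : Loc U u g M)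
    {x : EE n} {R : ℝ} (hR : 0 < R) (hU : Metric.ball x R ⊆ U) :
    Tendsto (FF S n u x) atTop (𝓝 (mS n * uhat u x)) := by
  have h1 := FF_super h.hw h.hu h.hM h.hg1 hR hU
  have h2 := FF_sub h.hw h.hu h.hM h.hg2 hR hU
  set s0 := 1 / R + 1 with hs0
  have hs0R : s0 ∈ Ioi (1/R) := by simp [hs0]
  have hmx : ∀ t, max t s0 ∈ Ioi (1/R) := fun t => mem_Ioi.2 (lt_of_lt_of_le (mem_Ioi.1 hs0R) (le_max_right _ _))
  set G := fun s => FF S n u x s * Real.exp (-M / (4 * s^2)) with hG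
  have hmono : Monotone (fun t => G (max t s0)) := by
    intro t t' htt
    exact h1 (hmx t) (hmx t') (max_le_max_right _ htt)
  have hbd : BddAbove (range (fun t => G (max t s0))) := by
    refine ⟨FF S n u x s0 * Real.exp (M / (4 * s0^2)), ?_⟩
    rintro _ ⟨t, rfl⟩
    refine le_trans ?_ (h2 hs0R (hmx t) (le_max_right _ _))
    simp only [hG]
    have hpos : 0 ≤ max t s0 := le_trans (by positivity) (hmx t).le
    refine mul_le_mul_of_nonneg_left ?_ (FF_S_nonneg h.hu hpos x)
    refine Real.exp_le_exp.2 ?_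
    have := h.hM
    gcongr
    linarith
  have h3 := tendsto_atTop_ciSup hmono hbd
  set L := ⨆ t, G (max t s0)
  have h4 : Tendsto (FF S n u x) atTop (𝓝 (L * 1)) := by
    refine (h3.mul (tendsto_exp_one M)).congr' ?_
    filter_upwards [eventually_ge_atTop s0] with t ht
    simp only [hG, max_eq_left ht, mul_assoc, ← Real.exp_add]
    rw [show -M / (4 * t^2) + M / (4 * t^2) = 0 by ring]; simp
  have h5 : uhat u x = L / mS n := uhat_eq_of_tendsto (by
    have := (mS_pos n).ne'
    rw [mul_one] at h4
    convert h4 using 2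
    field_simp)
  rw [h5]
  have := (mS_pos n).ne'
  rw [mul_one] at h4
  convert h4 using 2
  field_simp

lemma super_lower {n : ℕ} {U : Set (EE n)} {u g : (EE n) → ℝ} (hw : WeakLap U u g)
    (hu : ∀ᵐ y, 0 ≤ u y) {M : ℝ} (hM : 0 ≤ M)
    (hg : ∀ᵐ y, y ∈ U → g y ≤ M * u y) {R : ℝ} (hR : 0 < R)
    {x : EE n} (hU : Metric.ball x R ⊆ U) {c : ℝ}
    (ht : Tendsto (FF S n u x) atTop (𝓝 (mS n * c))) {s : ℝ} (hs : 1 / R < s) :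
    FF S n u x s * Real.exp (-M / (4 * s^2)) ≤ mS n * c := by
  have h1 := FF_super hw hu hM hg hR hU
  have h3 := ht.mul (tendsto_exp_one (-M))
  rw [mul_one] at h3
  refine ge_of_tendsto h3 ?_
  filter_upwards [eventually_ge_atTop s] with t ht
  exact h1 hs (lt_of_lt_of_le hs ht) ht

lemma Loc.lower {n : ℕ} {U : Set (EE n)} {u g : (EE n) → ℝ} {M : ℝ} (h : Loc U u g M)
    {x : EE n} {R : ℝ} (hR : 0 < R) (hU : Metric.ball x R ⊆ U) {s : ℝ} (hs : 1 / R < s) :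
    FF S n u x s * Real.exp (-M / (4 * s^2)) ≤ mS n * uhat u x :=
  super_lower h.hw h.hu h.hM h.hg1 hR hU (h.tendsto hR hU) hs

lemma Loc.upper {n : ℕ} {U : Set (EE n)} {u g : (EE n) → ℝ} {M : ℝ} (h : Loc U u g M)
    {x : EE n} {R : ℝ} (hR : 0 < R) (hU : Metric.ball x R ⊆ U) {s : ℝ} (hs : 1 / R < s) :
    mS n * uhat u x ≤ FF S n u x s * Real.exp (M / (4 * s^2)) := by
  have h1 := FF_sub h.hw h.hu h.hM h.hg2 hR hU
  have h3 := (h.tendsto hR hU).mul (tendsto_exp_one M)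
  rw [mul_one] at h3
  refine le_of_tendsto h3 ?_
  filter_upwards [eventually_ge_atTop s] with t ht
  exact h1 hs (lt_of_lt_of_le hs ht) ht

lemma Loc.uhat_nonneg {n : ℕ} {U : Set (EE n)} {u g : (EE n) → ℝ} {M : ℝ} (h : Loc U u g M)
    {x : EE n} {R : ℝ} (hR : 0 < R) (hU : Metric.ball x R ⊆ U) : 0 ≤ uhat u x := by
  have h1 := h.lower hR hU (s := 1/R + 1) (by linarith)
  have h2 : 0 ≤ FF S n u x (1/R+1) := FF_S_nonneg h.hu (by positivity) x
  have h3 : 0 ≤ mS n * uhat u x := le_trans (mul_nonneg h2 (Real.exp_pos _).le) h1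
  exact nonneg_of_mul_nonneg_right h3 (mS_pos n)

lemma S_lower (n : ℕ) : ∃ c : ℝ, 0 < c ∧ ∀ z : EE n, ‖z‖ ≤ 3/4 → c ≤ S z := by
  obtain ⟨z0, hz0, hm⟩ := (isCompact_closedBall (0 : EE n) (3/4)).exists_isMinOn
    ⟨0, by simp; norm_num⟩ S_cont.continuousOn
  refine ⟨S z0, S_pos z0 ?_, fun z hz => hm (by simpa using hz)⟩
  have : ‖z0‖ ≤ 3/4 := by simpa using hz0
  linarith

/-- The mass of `u` on a ball is bounded by a kernel average. -/
lemma mass_le (n : ℕ) {r : ℝ} (hr : 0 < r) : ∃ C : ℝ, 0 < C ∧ ∀ (u : (EE n) → ℝ) (p : EE n),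
    LocallyIntegrable u volume → (∀ᵐ y, 0 ≤ u y) →
    ∫ y in Metric.closedBall p (3*r), u y ≤ C * FF S n u p (1/(4*r)) := by
  obtain ⟨c, hc0, hc⟩ := S_lower n
  refine ⟨(4*r)^n / c, by positivity, fun u p iu hu => ?_⟩
  have h1 : ∫ y in Metric.closedBall p (3*r), u y ≤
      ∫ y, c⁻¹ * (S ((1/(4*r)) • (p - y)) * u y) := by
    rw [← integral_indicator Metric.isClosed_closedBall.measurableSet]
    refine integral_mono_ae ?_ ((ker_integrable S_cont S_zero (by positivity) p iu).const_mul _) ?_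
    · rw [integrable_indicator_iff Metric.isClosed_closedBall.measurableSet]
      exact iu.integrableOn_isCompact (isCompact_closedBall _ _)
    · filter_upwards [hu] with y hy
      by_cases hyb : y ∈ Metric.closedBall p (3*r)
      · rw [indicator_of_mem hyb]
        have h2 : c ≤ S ((1/(4*r)) • (p - y)) := by
          apply hc
          rw [norm_smul, Real.norm_of_nonneg (by positivity), ← dist_eq_norm, dist_comm]
          rw [Metric.mem_closedBall] at hyb
          calc 1/(4*r) * dist y p ≤ 1/(4*r) * (3*r) := by gcongr
            _ = 3/4 := by field_simp
        rw [← mul_assoc]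
        have : 1 ≤ c⁻¹ * S ((1/(4*r)) • (p - y)) := by
          rw [inv_mul_eq_div, le_div_iff₀ hc0]; linarith
        nlinarith
      · rw [indicator_of_notMem hyb]
        have := S_nonneg ((1/(4*r)) • (p - y))
        positivity
  rw [integral_const_mul] at h1
  refine h1.trans (le_of_eq ?_)
  unfold FF
  rw [one_div, inv_pow]
  field_simp

lemma mass_le_uhat (n : ℕ) {r M : ℝ} (hr : 0 < r) : ∃ C : ℝ, 0 < C ∧
    ∀ (U : Set (EE n)) (u g : (EE n) → ℝ) (p : EE n), Loc U u g M → Metric.ball p (8*r) ⊆ U →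
    ∫ y in Metric.closedBall p (3*r), u y ≤ C * uhat u p := by
  obtain ⟨C, hC0, hC⟩ := mass_le n hr
  have hm := mS_pos n
  refine ⟨C * (mS n * Real.exp (M / (4 * (1/(4*r))^2))), by positivity, fun U u g p h hU => ?_⟩
  refine (hC u p h.hw.iu h.hu).trans ?_
  have h1 := h.lower (by positivity) hU (s := 1/(4*r))
    (one_div_lt_one_div_of_lt (by positivity) (by linarith))
  rw [mul_assoc]
  refine mul_le_mul_of_nonneg_left ?_ hC0.le
  calc FF S n u p (1/(4*r)) = (FF S n u p (1/(4*r)) * Real.exp (-M / (4 * (1/(4*r))^2))) *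
        Real.exp (M / (4 * (1/(4*r))^2)) := by
        rw [mul_assoc, ← Real.exp_add, neg_div, neg_add_cancel, Real.exp_zero, mul_one]
    _ ≤ (mS n * uhat u p) * Real.exp (M / (4 * (1/(4*r))^2)) := by gcongr
    _ = _ := by ring

/-- Harnack inequality. -/
lemma harnack (n : ℕ) {r M : ℝ} (hr : 0 < r) : ∃ C : ℝ, 0 < C ∧
    ∀ (U : Set (EE n)) (u g : (EE n) → ℝ) (x y : EE n), Loc U u g M →
    Metric.ball x (8*r) ⊆ U → Metric.ball y (8*r) ⊆ U → dist x y ≤ 2*r →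
    uhat u x ≤ C * uhat u y := by
  obtain ⟨C1, hC10, hC1⟩ := mass_le_uhat n (M := M) hr
  obtain ⟨C0, hC00, hC0⟩ := bdd_of_zero (n := n) S_cont S_zero
  have hm := mS_pos n
  refine ⟨(mS n)⁻¹ * (Real.exp (M / (4 * (1/r)^2)) * ((1/r)^n * (C0 * C1))), by positivity,
    fun U u g x y h hx hy hxy => ?_⟩
  have h1 := h.upper (by positivity) hx (s := 1/r)
    (one_div_lt_one_div_of_lt (by positivity) (by linarith))
  have h2 := hC1 U u g y h hy
  have h3 : ∫ z, S ((1/r) • (x - z)) * u z ≤ ∫ z in Metric.closedBall y (3*r), C0 * u z := by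
    rw [← integral_indicator Metric.isClosed_closedBall.measurableSet]
    refine integral_mono_ae (ker_integrable S_cont S_zero (by positivity) x h.hw.iu) ?_ ?_
    · rw [integrable_indicator_iff Metric.isClosed_closedBall.measurableSet]
      exact (h.hw.iu.integrableOn_isCompact (isCompact_closedBall _ _)).const_mul _
    · filter_upwards [h.hu] with z hz
      by_cases hzb : z ∈ Metric.closedBall y (3*r)
      · rw [indicator_of_mem hzb]
        exact mul_le_mul_of_nonneg_right ((le_abs_self _).trans (hC0 _)) hz
      · rw [indicator_of_notMem hzb]
        have : z ∉ Metric.closedBall x (1/(1/r)) := by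
          intro hzx
          apply hzb
          rw [one_div_one_div] at hzx
          rw [Metric.mem_closedBall] at *
          linarith [dist_triangle z x y]
        rw [ker_zero S_zero (by positivity) this]; simp
  rw [integral_const_mul] at h3
  have h4 : FF S n u x (1/r) ≤ (1/r)^n * (C0 * (C1 * uhat u y)) := by
    unfold FF
    gcongr
    exact h3.trans (by gcongr)
  calc uhat u x = (mS n)⁻¹ * (mS n * uhat u x) := by field_simp
    _ ≤ (mS n)⁻¹ * (((1/r)^n * (C0 * (C1 * uhat u y))) * Real.exp (M / (4 * (1/r)^2))) := by
      refine mul_le_mul_of_nonneg_left (h1.trans ?_) (by positivity)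
      gcongr
    _ = _ := by ring

end AAP

namespace AAP
open Filter Topology Set

lemma S_lip (n : ℕ) : ∃ L : ℝ, 0 ≤ L ∧ ∀ x y : EE n, |S x - S y| ≤ L * ‖x - y‖ := by
  obtain ⟨C, hC⟩ := (S_smooth (n := n)).lipschitzWith_of_hasCompactSupport
    (hcs_of_zero S_zero) (by simp)
  refine ⟨C, C.2, fun x y => ?_⟩
  have := hC.dist_le_mul x y
  rwa [Real.dist_eq, dist_eq_norm] at this

lemma exp_sub_one_le (δ : ℝ) : Real.exp δ - 1 ≤ δ * Real.exp δ := by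
  have h1 := Real.add_one_le_exp (-δ)
  have h2 := Real.exp_pos δ
  have h3 : Real.exp (-δ) * Real.exp δ = 1 := by rw [← Real.exp_add]; simp
  nlinarith [mul_le_mul_of_nonneg_right h1 h2.le]

lemma Loc.approx {n : ℕ} {U : Set (EE n)} {u g : (EE n) → ℝ} {M : ℝ} (h : Loc U u g M)
    {x : EE n} {r : ℝ} (hr : 0 < r) (hU : Metric.ball x (8*r) ⊆ U) {s : ℝ} (hs : 1 / r ≤ s) :
    |mS n * uhat u x - FF S n u x s| ≤
      M / 4 * Real.exp (M * r^2 / 2) * mS n * uhat u x / s^2 := by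
  have hs0 : 0 < s := lt_of_lt_of_le (by positivity) hs
  have hs1 : 1 / (8*r) < s :=
    lt_of_lt_of_le (one_div_lt_one_div_of_lt hr (by linarith)) hs
  have h1 := h.lower (by positivity) hU hs1
  have h2 := h.upper (by positivity) hU hs1
  have hm := mS_pos n
  have hM := h.hM
  have hu := h.uhat_nonneg (by positivity) hU
  have hF := FF_S_nonneg h.hu hs0.le x
  set F := FF S n u x s
  set w := mS n * uhat u x with hw
  have hw0 : 0 ≤ w := by positivity
  set δ := M / (4 * s^2) with hδ
  have hδ0 : 0 ≤ δ := by positivity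
  have hδ1 : δ ≤ M * r^2 / 4 := by
    have : 1 ≤ r * s := by rwa [div_le_iff₀ hr, mul_comm] at hs
    have h3 : 1 ≤ (r*s)^2 := one_le_pow₀ this
    rw [hδ, div_le_div_iff₀ (by positivity) (by norm_num)]
    nlinarith [mul_le_mul_of_nonneg_left h3 hM]
  have he : Real.exp (-M / (4 * s^2)) = Real.exp (-δ) := by rw [hδ, neg_div]
  rw [he] at h1
  have h3 : Real.exp (-δ) * Real.exp δ = 1 := by rw [← Real.exp_add]; simp
  have hF1 : F ≤ Real.exp δ * w := by
    calc F = Real.exp δ * (F * Real.exp (-δ)) := by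
          rw [mul_comm, mul_assoc, h3, mul_one]
      _ ≤ _ := by gcongr
  have h4 := exp_sub_one_le δ
  have h5 : 1 ≤ Real.exp δ := Real.one_le_exp hδ0
  have h6 : Real.exp δ * Real.exp δ ≤ Real.exp (M * r^2/2) := by
    rw [← Real.exp_add]; exact Real.exp_le_exp.2 (by linarith)
  have goal1 : |w - F| ≤ δ * (Real.exp δ * Real.exp δ) * w := by
    rw [abs_le]
    constructor
    · have : F - w ≤ (Real.exp δ - 1) * w := by linarith
      have h7 : (Real.exp δ - 1) * w ≤ δ * Real.exp δ * w := by gcongr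
      have h8 : δ * Real.exp δ * w ≤ δ * (Real.exp δ * Real.exp δ) * w := by
        gcongr; nlinarith
      linarith
    · calc w - F ≤ (Real.exp δ - 1) * F := by linarith
        _ ≤ δ * Real.exp δ * (Real.exp δ * w) := by gcongr
        _ = _ := by ring
  calc |w - F| ≤ δ * (Real.exp δ * Real.exp δ) * w := goal1
    _ ≤ δ * Real.exp (M * r^2/2) * w := by gcongr
    _ = _ := by rw [hδ, hw]; field_simp

lemma holder (n : ℕ) {r M : ℝ} (hr : 0 < r) : ∃ C h0 : ℝ, 0 < C ∧ 0 < h0 ∧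
    ∀ (U : Set (EE n)) (u g : (EE n) → ℝ) (p x y : EE n), Loc U u g M →
    Metric.ball p (9*r) ⊆ U → x ∈ Metric.ball p r → y ∈ Metric.ball p r → dist x y ≤ h0 →
    |uhat u x - uhat u y| ≤ C * uhat u p * (dist x y) ^ ((((n+2 : ℕ) : ℝ))⁻¹) := by
  by_cases hM : 0 ≤ M
  swap
  · exact ⟨1, 1, one_pos, one_pos, fun U u g p x y h => absurd h.hM hM⟩
  obtain ⟨C1, hC10, hC1⟩ := harnack n (M := M) hr
  obtain ⟨C2, hC20, hC2⟩ := mass_le_uhat n (M := M) hr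
  obtain ⟨L, hL0, hL⟩ := S_lip n
  have hm := mS_pos n
  set A := M / 4 * Real.exp (M * r^2 / 2) * mS n with hA
  have hA0 : 0 ≤ A := by positivity
  refine ⟨(mS n)⁻¹ * (2 * A * C1 + L * C2 + 1), min 1 (r^(n+2)), by positivity, by positivity,
    fun U u g p x y h hU hx hy hd => ?_⟩
  rcases eq_or_ne x y with rfl | hne
  · rw [dist_self, Real.zero_rpow (by positivity)]; simp
  have hd0 : 0 < dist x y := dist_pos.2 hne
  set d := dist x y with hdd
  set t := d ^ ((((n+2 : ℕ) : ℝ))⁻¹) with ht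
  have ht0 : 0 < t := by positivity
  have htn : t^(n+2) = d := Real.rpow_inv_natCast_pow hd0.le (by omega)
  have ht1 : t ≤ 1 := by
    by_contra hc
    have := one_lt_pow₀ (not_le.1 hc) (n := n+2) (by omega)
    rw [htn] at this
    exact absurd (hd.trans (min_le_left _ _)) (not_le.2 this)
  have htr : t ≤ r := by
    refine le_of_pow_le_pow_left₀ (n := n+2) (by omega) hr.le ?_
    rw [htn]; exact hd.trans (min_le_right _ _)
  have hball : ∀ z ∈ Metric.ball p r, Metric.ball z (8*r) ⊆ U := by
    intro z hz
    refine (Metric.ball_subset_ball' ?_).trans hU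
    rw [Metric.mem_ball] at hz; linarith
  have hpU : Metric.ball p (8*r) ⊆ U := hball p (by simpa using hr)
  have hup := h.uhat_nonneg (by positivity) hpU
  have hs : 1 / r ≤ 1 / t := one_div_le_one_div_of_le ht0 htr
  have happ : ∀ z ∈ Metric.ball p r, |mS n * uhat u z - FF S n u z (1/t)| ≤
      A * C1 * uhat u p * t^2 := by
    intro z hz
    refine (h.approx hr (hball z hz) hs).trans ?_
    have := hC1 U u g z p h (hball z hz) hpU (by rw [Metric.mem_ball] at hz; linarith)
    rw [← hA]
    calc A * uhat u z / (1/t)^2 = A * uhat u z * t^2 := by field_simp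
      _ ≤ A * (C1 * uhat u p) * t^2 := by gcongr
      _ = _ := by ring
  have hFd : |FF S n u x (1/t) - FF S n u y (1/t)| ≤ L * C2 * uhat u p * t := by
    have hst : 0 < 1/t := by positivity
    unfold FF
    rw [← mul_sub, ← integral_sub (ker_integrable S_cont S_zero hst x h.hw.iu)
      (ker_integrable S_cont S_zero hst y h.hw.iu), abs_mul, abs_of_pos (by positivity)]
    have h3 : |∫ z, (S ((1/t) • (x - z)) * u z - S ((1/t) • (y - z)) * u z)| ≤
        ∫ z in Metric.closedBall p (3*r), (L * ((1/t) * d)) * u z := by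
      rw [← integral_indicator Metric.isClosed_closedBall.measurableSet, ← Real.norm_eq_abs]
      refine norm_integral_le_of_norm_le ?_ ?_
      · rw [integrable_indicator_iff Metric.isClosed_closedBall.measurableSet]
        exact (h.hw.iu.integrableOn_isCompact (isCompact_closedBall _ _)).const_mul _
      · filter_upwards [h.hu] with z hz
        by_cases hzb : z ∈ Metric.closedBall p (3*r)
        · rw [indicator_of_mem hzb, ← sub_mul, norm_mul, Real.norm_of_nonneg hz]
          refine mul_le_mul_of_nonneg_right ?_ hz
          refine (hL _ _).trans ?_
          rw [← smul_sub, norm_smul, Real.norm_of_nonneg hst.le, sub_sub_sub_cancel_right,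
            ← dist_eq_norm]
        · rw [indicator_of_notMem hzb]
          have : ∀ w ∈ Metric.ball p r, z ∉ Metric.closedBall w (1/(1/t)) := by
            intro w hw hzx
            apply hzb
            rw [one_div_one_div] at hzx
            rw [Metric.mem_closedBall] at *
            rw [Metric.mem_ball] at hw
            linarith [dist_triangle z w p]
          rw [ker_zero S_zero hst (this x hx), ker_zero S_zero hst (this y hy)]; simp
    rw [integral_const_mul] at h3
    calc (1/t)^n * |∫ z, (S ((1/t) • (x - z)) * u z - S ((1/t) • (y - z)) * u z)|
        ≤ (1/t)^n * ((L * ((1/t) * d)) * (C2 * uhat u p)) := by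
          gcongr
          refine h3.trans ?_
          gcongr
          exact hC2 U u g p h hpU
      _ = L * C2 * uhat u p * t := by
          rw [← htn, pow_add, one_div, inv_pow]; field_simp
  have hfin : |mS n * (uhat u x - uhat u y)| ≤ (2 * A * C1 + L * C2) * uhat u p * t := by
    have e : mS n * (uhat u x - uhat u y) = (mS n * uhat u x - FF S n u x (1/t)) +
      (FF S n u x (1/t) - FF S n u y (1/t)) - (mS n * uhat u y - FF S n u y (1/t)) := by ring
    rw [e]
    have hh := abs_sub ((mS n * uhat u x - FF S n u x (1/t)) +
      (FF S n u x (1/t) - FF S n u y (1/t))) (mS n * uhat u y - FF S n u y (1/t))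
    have hh2 := abs_add_le (mS n * uhat u x - FF S n u x (1/t))
      (FF S n u x (1/t) - FF S n u y (1/t))
    have ha := happ x hx
    have hb := happ y hy
    have htt : A * C1 * uhat u p * t^2 ≤ A * C1 * uhat u p * t := by
      gcongr; nlinarith
    nlinarith
  rw [abs_mul, abs_of_pos hm] at hfin
  calc |uhat u x - uhat u y| = (mS n)⁻¹ * (mS n * |uhat u x - uhat u y|) := by field_simp
    _ ≤ (mS n)⁻¹ * ((2 * A * C1 + L * C2) * uhat u p * t) := by gcongr
    _ ≤ (mS n)⁻¹ * ((2 * A * C1 + L * C2 + 1) * uhat u p * t) := by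
        refine mul_le_mul_of_nonneg_left ?_ (by positivity)
        nlinarith [mul_nonneg hup ht0.le]
    _ = _ := by ring

end AAP

namespace AAP
open Filter Topology Set

lemma integral_pd_zero {n : ℕ} (i : Fin n) {f : (EE n) → ℝ} (hf : ContDiff ℝ 1 f)
    (hc : HasCompactSupport f) : ∫ x, pd i f x = 0 := by
  have hcont : Continuous (pd i f) := (hf.continuous_fderiv (by simp)).clm_apply continuous_const
  have hcs : HasCompactSupport (pd i f) :=
    HasCompactSupport.mono' hc ((subset_tsupport _).trans (pd_tsupport i f))
  have h := integral_mul_fderiv_eq_neg_fderiv_mul_of_integrable (μ := (volume : Measure (EE n)))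
    (f := fun _ => (1:ℝ)) (g := f) (v := EuclideanSpace.single i 1)
    (by simp) (by simp only [one_mul]; exact hcont.integrable_of_hasCompactSupport hcs)
    (by simpa using hf.continuous.integrable_of_hasCompactSupport hc)
    (fun x _ => by fun_prop) (fun x _ => hf.differentiable (by simp) x)
  simpa [pd] using h

lemma ker_bound {n : ℕ} {b g : (EE n) → ℝ} (hb : Continuous b) (zb : ∀ x, 1 < ‖x‖ → b x = 0)
    (ib : ∫ x, b x = 0) (ig : LocallyIntegrable g volume) {C α : ℝ} (hC : 0 ≤ C) (hα : 0 < α)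
    {x : EE n} {R : ℝ} (hR : 0 < R)
    (hg : ∀ y ∈ Metric.ball x R, |g y - g x| ≤ C * ‖y - x‖ ^ α) {s : ℝ} (hs : 1 / R < s) :
    s^n * |∫ y, b (s • (x - y)) * g y| ≤ C * (∫ z, |b z|) * s ^ (-α) := by
  have hs0 : 0 < s := lt_trans (by positivity) hs
  have hbs : Integrable (fun y => b (s • (x - y))) :=
    (ker_cont hb s x).integrable_of_hasCompactSupport (ker_hcs zb hs0 x)
  have h0 : ∫ y, b (s • (x - y)) = 0 := by
    have := integral_ker b hs0 x
    rw [ib] at this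
    exact (mul_eq_zero.1 this).resolve_left (by positivity)
  have e : ∫ y, b (s • (x - y)) * g y = ∫ y, b (s • (x - y)) * (g y - g x) := by
    simp_rw [mul_sub]
    rw [integral_sub (ker_integrable hb zb hs0 x ig) (hbs.mul_const _), integral_mul_const, h0]
    simp
  have h1 : |∫ y, b (s • (x - y)) * (g y - g x)| ≤ ∫ y, |b (s • (x - y))| * (C * s ^ (-α)) := by
    rw [← Real.norm_eq_abs]
    refine norm_integral_le_of_norm_le (hbs.abs.mul_const _) (ae_of_all _ fun y => ?_)
    rw [norm_mul, Real.norm_eq_abs, Real.norm_eq_abs]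
    by_cases hy : y ∈ Metric.closedBall x (1/s)
    · refine mul_le_mul_of_nonneg_left ?_ (abs_nonneg _)
      have h2 : 1 / s < R := by rwa [one_div_lt hs0 hR]
      refine (hg y (Metric.closedBall_subset_ball h2 hy)).trans ?_
      refine mul_le_mul_of_nonneg_left ?_ hC
      rw [Real.rpow_neg hs0.le, ← Real.inv_rpow hs0.le, ← one_div]
      refine Real.rpow_le_rpow (norm_nonneg _) ?_ hα.le
      rwa [Metric.mem_closedBall, dist_eq_norm] at hy
    · rw [ker_zero zb hs0 hy]; simp
  rw [integral_mul_const] at h1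
  rw [e]
  calc s^n * |∫ y, b (s • (x - y)) * (g y - g x)|
      ≤ s^n * ((∫ y, |b (s • (x - y))|) * (C * s ^ (-α))) := by gcongr
    _ = (s^n * (∫ y, |b (s • (x - y))|)) * (C * s ^ (-α)) := by ring
    _ = _ := by rw [integral_ker (fun z => |b z|) hs0 x]; ring

lemma deriv_cauchy {F F' : ℝ → ℝ} {D α s0 : ℝ} (hs0 : 0 ≤ s0) (hα : 0 < α)
    (hF : ∀ s, s0 < s → HasDerivAt F (F' s) s) (hb : ∀ s, s0 < s → |F' s| ≤ D * s ^ (-α-1))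
    {s t : ℝ} (hs : s0 < s) (hst : s ≤ t) : |F t - F s| ≤ D / α * s ^ (-α) := by
  have key : ∀ G G' : ℝ → ℝ, (∀ s, s0 < s → HasDerivAt G (G' s) s) →
      (∀ s, s0 < s → G' s ≤ D * s ^ (-α-1)) → G t - G s ≤ D / α * s ^ (-α) := by
    intro G G' hG hb
    have hd : ∀ r ∈ Ioi s0, HasDerivAt (fun r => G r + D / α * r ^ (-α))
        (G' r + D / α * (-α * r ^ (-α-1))) r := by
      intro r hr
      exact (hG r hr).add ((Real.hasDerivAt_rpow_const
        (Or.inl (lt_of_le_of_lt hs0 hr).ne')).const_mul _)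
    have ha : AntitoneOn (fun r => G r + D / α * r ^ (-α)) (Ioi s0) := by
      refine antitoneOn_of_deriv_nonpos (convex_Ioi _)
        (fun r hr => (hd r hr).continuousAt.continuousWithinAt) (fun r hr => ?_) (fun r hr => ?_)
      · rw [interior_Ioi] at hr; exact (hd r hr).differentiableAt.differentiableWithinAt
      · rw [interior_Ioi] at hr
        rw [(hd r hr).deriv]
        have := hb r hr
        have e : D / α * (-α * r ^ (-α-1)) = -(D * r ^ (-α-1)) := by field_simp
        rw [e]; linarith
    have h1 := ha (mem_Ioi.2 hs) (mem_Ioi.2 (hs.trans_le hst)) hst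
    simp only at h1
    have hD : 0 ≤ D := by
      have h2 : 0 ≤ |F' s| := abs_nonneg _
      have h3 := h2.trans (‹∀ s, s0 < s → |F' s| ≤ D * s ^ (-α-1)› s hs)
      have hsp : 0 < s ^ (-α-1) := Real.rpow_pos_of_pos (lt_of_le_of_lt hs0 hs) _
      exact nonneg_of_mul_nonneg_left h3 hsp
    have h4 : 0 ≤ D / α * t ^ (-α) :=
      mul_nonneg (by positivity) (Real.rpow_nonneg (by linarith) _)
    linarith
  rw [abs_le]
  constructor
  · have := key (fun s => - F s) (fun s => - F' s) (fun s hs => (hF s hs).neg)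
      (fun s hs => (neg_le_abs _).trans (hb s hs))
    linarith
  · exact key F F' hF (fun s hs => (le_abs_self _).trans (hb s hs))

lemma unif_lim {X : Type*} {F : X → ℝ → ℝ} {A : Set X} {D α s0 : ℝ} (hα : 0 < α)
    (h : ∀ x ∈ A, ∀ s t, s0 < s → s ≤ t → |F x t - F x s| ≤ D * s ^ (-α)) :
    ∃ l : X → ℝ, TendstoUniformlyOn (fun s x => F x s) l atTop A := by
  have hz : Tendsto (fun s : ℝ => D * s ^ (-α)) atTop (𝓝 0) := by
    simpa using (tendsto_rpow_neg_atTop hα).const_mul D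
  have hu : UniformCauchySeqOn (fun s x => F x s) atTop A := by
    rw [Metric.uniformCauchySeqOn_iff]
    intro ε hε
    have h1 := (hz.eventually (gt_mem_nhds (half_pos hε))).and (eventually_gt_atTop s0)
    obtain ⟨N, hN1, hN2⟩ := h1.exists
    refine ⟨N, fun m hm k hk x hx => ?_⟩
    have a1 := h x hx N m hN2 hm
    have a2 := h x hx N k hN2 hk
    rw [Real.dist_eq]
    have : F x m - F x k = (F x m - F x N) - (F x k - F x N) := by ring
    rw [this]
    have := abs_sub (F x m - F x N) (F x k - F x N)
    linarith
  have hc : ∀ x ∈ A, ∃ l, Tendsto (F x) atTop (𝓝 l) := by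
    intro x hx
    exact cauchySeq_tendsto_of_complete (hu.cauchySeq hx)
  choose! l hl using hc
  exact ⟨l, hu.tendstoUniformlyOn_of_tendsto hl⟩

lemma FF_unif {n N : ℕ} {a b : (EE n) → ℝ} (hp : Pair N a b) (ib : ∫ x, b x = 0) (hN : N ≤ n + 2)
    {U : Set (EE n)}
    {u g : (EE n) → ℝ} (hw : WeakLap U u g) {p : EE n} {R C α : ℝ} (hR : 0 < R) (hC : 0 ≤ C)
    (hα : 0 < α) (hU : Metric.ball p (2*R) ⊆ U)
    (hg : ∀ y ∈ Metric.ball p (2*R), ∀ z ∈ Metric.ball p (2*R), |g y - g z| ≤ C * ‖y - z‖ ^ α) :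
    ∃ l : EE n → ℝ, TendstoUniformlyOn (fun s x => FF a N u x s) l atTop (Metric.ball p R) := by
  refine unif_lim (s0 := 1/R + 1) (D := C * (∫ z, |b z|) / α) hα (fun x hx s t hs hst => ?_)
  have hRp : 0 < 1 / R := by positivity
  have hb : Metric.ball x R ⊆ Metric.ball p (2*R) := by
    refine Metric.ball_subset_ball' ?_
    rw [Metric.mem_ball] at hx; linarith
  refine deriv_cauchy (s0 := 1/R+1) (by positivity) hα
    (fun s hs => FF_hasDerivAt hp hw hR (by linarith) (hb.trans hU)) (fun s hs => ?_) hs hst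
  have hs1 : 1 ≤ s := by linarith
  have hs0 : 0 < s := by linarith
  have h1 := ker_bound hp.sb.continuous hp.zb ib hw.ig hC hα hR
    (fun y hy => hg y (hb hy) x (hb (Metric.mem_ball_self hR))) (s := s) (by linarith)
  rw [abs_neg, abs_mul, abs_of_nonneg (by positivity)]
  have h2 : s^N / s^3 ≤ s^n / s := by
    rw [div_le_div_iff₀ (by positivity) hs0, ← pow_succ, ← pow_add]
    exact pow_le_pow_right₀ hs1 (by omega)
  have h3 : s ^ (-α - 1) = s ^ (-α) / s := by rw [Real.rpow_sub hs0, Real.rpow_one]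
  calc s^N / s^3 * |∫ y, b (s • (x - y)) * g y| ≤ s^n / s * |∫ y, b (s • (x - y)) * g y| := by
        gcongr
    _ = (s^n * |∫ y, b (s • (x - y)) * g y|) / s := by ring
    _ ≤ (C * (∫ z, |b z|) * s ^ (-α)) / s := by gcongr
    _ = _ := by rw [h3]; ring

open scoped Convolution in
lemma FF_hasFDerivAt {n N : ℕ} {a : (EE n) → ℝ} (sa : ContDiff ℝ (⊤ : ℕ∞) a)
    (za : ∀ x, 1 < ‖x‖ → a x = 0) {u : (EE n) → ℝ} (hu : LocallyIntegrable u volume)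
    {s : ℝ} (hs : 0 < s) (x : EE n) :
    HasFDerivAt (fun x => FF a N u x s)
      (∑ i, FF (pd i a) (N+1) u x s • (EuclideanSpace.proj i : EE n →L[ℝ] ℝ)) x := by
  set k : EE n → ℝ := fun z => a (s • z) with hk
  have hkz : ∀ z, k z = a (s • (z - 0)) := by simp [hk]
  have hkc : ContDiff ℝ (⊤ : ℕ∞) k := sa.comp (contDiff_const_smul s)
  have hcs : HasCompactSupport k := by
    have h1 : HasCompactSupport (fun z => a (s • z)) :=
      (hcs_of_zero za).comp_homeomorph (Homeomorph.smulOfNeZero s hs.ne')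
    exact h1
  have hfd : ∀ z, fderiv ℝ k z = s • fderiv ℝ a (s • z) := by
    intro z
    have h1 := (diff_of_smooth sa (s • z)).hasFDerivAt.comp z
      ((hasFDerivAt_id z).const_smul s)
    refine (HasFDerivAt.fderiv h1).trans ?_
    ext v; simp
  have h1 := hcs.hasFDerivAt_convolution_right (ContinuousLinearMap.mul ℝ ℝ) hu
    (hkc.of_le (by simp)) x
  have h2 := h1.const_mul (s^N)
  have e : (fun x => FF a N u x s) = fun y => s^N * (u ⋆[ContinuousLinearMap.mul ℝ ℝ, volume] k) y := by
    ext y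
    simp only [FF, convolution_def, hk, ContinuousLinearMap.mul_apply', mul_comm]
  rw [e]
  refine h2.congr_fderiv ?_
  ext v
  rw [fderiv_apply_sum]
  conv_rhs => rw [fderiv_apply_sum]
  refine Finset.sum_congr rfl fun i _ => ?_
  congr 1
  have h3 := convolution_precompR_apply (ContinuousLinearMap.mul ℝ ℝ) hu (hcs.fderiv ℝ)
    (hkc.continuous_fderiv (by simp)) x (EuclideanSpace.single i (1:ℝ))
  simp only [_root_.smul_apply, smul_eq_mul]
  rw [h3]
  simp only [convolution_def, hfd, ContinuousLinearMap.mul_apply', _root_.smul_apply, smul_eq_mul]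
  rw [_root_.sum_apply, Finset.sum_eq_single i]
  · have e1 : (FF (pd i a) (N+1) u x s • (EuclideanSpace.proj i : EE n →L[ℝ] ℝ))
        (EuclideanSpace.single i 1) = FF (pd i a) (N+1) u x s := by simp
    rw [e1, FF, pow_succ, mul_assoc, ← integral_const_mul s]
    congr 1
    refine integral_congr_ae (ae_of_all _ fun y => ?_)
    simp only [pd]; ring
  · intro j _ hj
    simp [hj]
  · simp

lemma hasFDerivAt_lim {n N : ℕ} {a : (EE n) → ℝ} (sa : ContDiff ℝ (⊤ : ℕ∞) a)
    (za : ∀ x, 1 < ‖x‖ → a x = 0) {u : (EE n) → ℝ} (hu : LocallyIntegrable u volume)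
    {A : Set (EE n)} (hA : IsOpen A) {G : EE n → ℝ} {H : Fin n → EE n → ℝ}
    (hG : ∀ x ∈ A, Tendsto (FF a N u x) atTop (𝓝 (G x)))
    (hH : ∀ i, TendstoUniformlyOn (fun s x => FF (pd i a) (N+1) u x s) (H i) atTop A) :
    ∀ x ∈ A, HasFDerivAt G (∑ i, H i x • (EuclideanSpace.proj i : EE n →L[ℝ] ℝ)) x := by
  intro x hx
  have hk : Tendsto (fun k : ℕ => (k : ℝ) + 1) atTop atTop :=
    tendsto_atTop_add_const_right _ _ tendsto_natCast_atTop_atTop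
  refine hasFDerivAt_of_tendstoUniformlyOn (l := (atTop : Filter ℕ)) hA
    (f := fun k x => FF a N u x ((k:ℝ) + 1))
    (f' := fun k x => ∑ i, FF (pd i a) (N+1) u x ((k:ℝ)+1) •
      (EuclideanSpace.proj i : EE n →L[ℝ] ℝ))
    (g' := fun x => ∑ i, H i x • (EuclideanSpace.proj i : EE n →L[ℝ] ℝ)) ?_
    (fun k y hy => FF_hasFDerivAt sa za hu (by positivity) y)
    (fun y hy => (hG y hy).comp hk) hx
  rw [Metric.tendstoUniformlyOn_iff]
  intro ε hε
  set P : ℝ := ∑ i : Fin n, ‖(EuclideanSpace.proj i : EE n →L[ℝ] ℝ)‖ with hP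
  have hP0 : 0 ≤ P := Finset.sum_nonneg fun i _ => norm_nonneg _
  have h1 : ∀ i : Fin n, ∀ᶠ k : ℕ in atTop, ∀ y ∈ A,
      dist (H i y) (FF (pd i a) (N+1) u y ((k:ℝ)+1)) < ε / (P + 1) := fun i =>
    hk.eventually (Metric.tendstoUniformlyOn_iff.1 (hH i) (ε / (P+1)) (by positivity))
  filter_upwards [eventually_all.2 h1] with k hk y hy
  rw [dist_eq_norm, ← Finset.sum_sub_distrib]
  have h2 : ‖∑ i, (H i y • (EuclideanSpace.proj i : EE n →L[ℝ] ℝ) -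
      FF (pd i a) (N+1) u y ((k:ℝ)+1) • (EuclideanSpace.proj i : EE n →L[ℝ] ℝ))‖ ≤
      ∑ i : Fin n, (ε / (P+1)) * ‖(EuclideanSpace.proj i : EE n →L[ℝ] ℝ)‖ := by
    refine norm_sum_le_of_le _ fun i _ => ?_
    rw [← sub_smul, norm_smul]
    refine mul_le_mul_of_nonneg_right ?_ (norm_nonneg _)
    rw [← dist_eq_norm]; exact (hk i y hy).le
  refine h2.trans_lt ?_
  rw [← Finset.mul_sum, ← hP, div_mul_eq_mul_div, div_lt_iff₀ (by positivity)]
  nlinarith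

/-- Interior regularity. -/
lemma regularity {n : ℕ} {U : Set (EE n)} (hUo : IsOpen U)
    {u g : (EE n) → ℝ} (hw : WeakLap U u g) (hu : ContinuousOn u U) {p : EE n} (hp : p ∈ U)
    (hg : ∃ R C α : ℝ, 0 < R ∧ 0 < α ∧ ∀ y ∈ Metric.ball p R, ∀ z ∈ Metric.ball p R,
      |g y - g z| ≤ C * ‖y - z‖ ^ α) :
    ContDiffAt ℝ 2 u p ∧ lap u p = g p := by
  obtain ⟨R0, C0, α, hR0, hα, hg⟩ := hg
  obtain ⟨R1, hR1, hR1U⟩ := Metric.isOpen_iff.1 hUo p hp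
  set R := min R0 R1 / 2 with hRd
  have hR : 0 < R := by positivity
  have h2R : 2 * R = min R0 R1 := by rw [hRd]; ring
  have hU : Metric.ball p (2*R) ⊆ U :=
    (Metric.ball_subset_ball (by rw [h2R]; exact min_le_right _ _)).trans hR1U
  have hb0 : Metric.ball p (2*R) ⊆ Metric.ball p R0 :=
    Metric.ball_subset_ball (by rw [h2R]; exact min_le_left _ _)
  have hg' : ∀ y ∈ Metric.ball p (2*R), ∀ z ∈ Metric.ball p (2*R),
      |g y - g z| ≤ |C0| * ‖y - z‖ ^ α := fun y hy z hz =>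
    (hg y (hb0 hy) z (hb0 hz)).trans
      (mul_le_mul_of_nonneg_right (le_abs_self _) (Real.rpow_nonneg (norm_nonneg _) _))
  have hbU : Metric.ball p R ⊆ U := (Metric.ball_subset_ball (by linarith)).trans hU
  set A := Metric.ball p R with hAdef
  have hA : IsOpen A := Metric.isOpen_ball
  have hpA : p ∈ A := Metric.mem_ball_self hR
  have hu0 := hw.iu
  have pair1 : ∀ i : Fin n, Pair (n+1) (pd i (S : EE n → ℝ)) (pd i K) := fun i => pair_SK.deriv i
  have pair2 : ∀ i j : Fin n, Pair (n+2) (pd j (pd i (S : EE n → ℝ))) (pd j (pd i K)) :=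
    fun i j => (pair1 i).deriv j
  have i1 : ∀ i : Fin n, ∫ x, pd i (K : EE n → ℝ) x = 0 := fun i =>
    integral_pd_zero i (K_smooth.of_le (by simp)) (hcs_of_zero K_zero)
  have i2 : ∀ i j : Fin n, ∫ x, pd j (pd i (K : EE n → ℝ)) x = 0 := fun i j =>
    integral_pd_zero j ((pd_contDiff i K_smooth).of_le (by simp))
      (hcs_of_zero (pd_zero_of i K_zero))
  have e1 := fun i : Fin n => FF_unif (pair1 i) (i1 i) (by omega) hw hR (abs_nonneg C0) hα hU hg'
  choose G hG using e1
  have e2 := fun i j : Fin n => FF_unif (pair2 i j) (i2 i j) (by omega) hw hR (abs_nonneg C0) hα hU hg'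
  choose H hH using e2
  have hm := mS_pos n
  have hcont : ∀ x ∈ A, ContinuousAt u x := fun x hx => hu.continuousAt (hUo.mem_nhds (hbU hx))
  have hd0 := hasFDerivAt_lim S_smooth S_zero hu0 hA (N := n) (G := fun x => mS n * u x)
    (fun x hx => FF_tendsto_of_continuousAt hu0 (hcont x hx)) hG
  have hd1 := fun i => hasFDerivAt_lim (pair1 i).sa (pair1 i).za hu0 hA (N := n+1) (G := G i)
    (fun x hx => (hG i).tendsto_at hx) (hH i)
  have hu1 : ∀ x ∈ A, HasFDerivAt u
      ((mS n)⁻¹ • ∑ i, G i x • (EuclideanSpace.proj i : EE n →L[ℝ] ℝ)) x := by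
    intro x hx
    have h := (hd0 x hx).const_mul (mS n)⁻¹
    refine h.congr_of_eventuallyEq (Eventually.of_forall fun y => ?_)
    simp only; field_simp
  have hHc : ∀ i j, ContinuousOn (H i j) A := by
    intro i j
    refine (hH i j).continuousOn (Eventually.frequently ?_)
    filter_upwards [eventually_gt_atTop 0] with s hs
    exact fun x _ => (FF_hasFDerivAt (pair2 i j).sa (pair2 i j).za hu0 hs x).continuousAt.continuousWithinAt
  have hGC : ∀ i, ContDiffOn ℝ 1 (G i) A := by
    intro i
    rw [show (1 : WithTop ℕ∞) = 0 + 1 by simp, contDiffOn_succ_iff_fderiv_of_isOpen hA]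
    refine ⟨fun x hx => (hd1 i x hx).differentiableAt.differentiableWithinAt, by simp, ?_⟩
    rw [contDiffOn_zero]
    refine ContinuousOn.congr (f := fun x => ∑ j, H i j x • (EuclideanSpace.proj j : EE n →L[ℝ] ℝ)) ?_
      (fun x hx => (hd1 i x hx).fderiv)
    exact continuousOn_finsetSum _ fun j _ => (hHc i j).smul continuousOn_const
  have huC : ContDiffOn ℝ 2 u A := by
    rw [show (2 : WithTop ℕ∞) = 1 + 1 by norm_num, contDiffOn_succ_iff_fderiv_of_isOpen hA]
    refine ⟨fun x hx => (hu1 x hx).differentiableAt.differentiableWithinAt, by simp, ?_⟩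
    refine ContDiffOn.congr (f := fun x => (mS n)⁻¹ • ∑ j, G j x • (EuclideanSpace.proj j : EE n →L[ℝ] ℝ)) ?_
      (fun x hx => (hu1 x hx).fderiv)
    exact (ContDiffOn.sum fun j _ => (hGC j).smul contDiffOn_const).const_smul _
  refine ⟨huC.contDiffAt (hA.mem_nhds hpA), ?_⟩
  have proj_sum : ∀ (c : Fin n → ℝ) (i : Fin n),
      (∑ j, c j • (EuclideanSpace.proj j : EE n →L[ℝ] ℝ)) (EuclideanSpace.single i 1) = c i := by
    intro c i
    rw [_root_.sum_apply, Finset.sum_eq_single i]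
    · simp
    · intro j _ hj; simp [hj]
    · simp
  have hpd1 : ∀ i, ∀ x ∈ A, pd i u x = (mS n)⁻¹ * G i x := by
    intro i x hx
    rw [pd, (hu1 x hx).fderiv, _root_.smul_apply, proj_sum, smul_eq_mul]
  have hpd2 : ∀ i, pd i (pd i u) p = (mS n)⁻¹ * H i i p := by
    intro i
    have h := ((hd1 i p hpA).const_mul (mS n)⁻¹).congr_of_eventuallyEq (f₁ := pd i u)
      (by filter_upwards [hA.mem_nhds hpA] with x hx using hpd1 i x hx)
    rw [pd, h.fderiv, _root_.smul_apply, proj_sum, smul_eq_mul]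
  have hsum : ∑ i, H i i p = mS n * g p := by
    have t1 : Tendsto (fun s => ∑ i, FF (pd i (pd i S)) (n+2) u p s) atTop (𝓝 (∑ i, H i i p)) :=
      tendsto_finsetSum _ fun i _ => (hH i i).tendsto_at hpA
    have hgc : ContinuousAt g p := by
      rw [Metric.continuousAt_iff]
      intro ε hε
      have ht : Tendsto (fun y => |C0| * ‖y - p‖ ^ α) (𝓝 p) (𝓝 0) := by
        have hc : Continuous (fun y : EE n => |C0| * ‖y - p‖ ^ α) :=
          continuous_const.mul ((continuous_id.sub continuous_const).norm.rpow_const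
            (fun _ => Or.inr hα.le))
        have := hc.tendsto p
        simpa [Real.zero_rpow hα.ne'] using this
      have hev := (ht.eventually (gt_mem_nhds hε)).and
        (Metric.ball_mem_nhds p (by positivity : 0 < 2*R))
      obtain ⟨δ, hδ, hδ2⟩ := Metric.eventually_nhds_iff.1 hev
      refine ⟨δ, hδ, fun {y} hy => ?_⟩
      rw [Real.dist_eq]
      exact (hg' y (hδ2 hy).2 p (Metric.mem_ball_self (by positivity))).trans_lt (hδ2 hy).1
    have t2 := FF_tendsto_of_continuousAt hw.ig hgc
    refine tendsto_nhds_unique t1 (t2.congr' ?_)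
    filter_upwards [eventually_gt_atTop (1/R)] with s hs
    have hs0 : 0 < s := lt_trans (by positivity) hs
    have h3 := weak_ker hw (a := S) S_smooth S_zero hR hs hbU
    rw [FF, ← h3]
    simp only [FF]
    rw [← Finset.mul_sum, ← integral_finsetSum _ (fun i _ =>
      ker_integrable (pair2 i i).sa.continuous (pair2 i i).za hs0 p hu0), pow_add, mul_assoc]
    congr 2
    refine integral_congr_ae (ae_of_all _ fun y => ?_)
    simp only [lap_eq, Finset.sum_mul]
  rw [lap_eq, Finset.sum_congr rfl (fun i _ => hpd2 i), ← Finset.mul_sum, hsum]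
  field_simp

end AAP

namespace AAP
open Filter Topology Set

lemma test_cont {n : ℕ} {Ω : Set (EE n)} {φ : EE n → ℝ} (h : IsTestFun Ω φ) : Continuous φ :=
  h.1.continuous

lemma test_add {n : ℕ} {Ω : Set (EE n)} {φ ψ : EE n → ℝ} (h : IsTestFun Ω φ)
    (h' : IsTestFun Ω ψ) (t : ℝ) : IsTestFun Ω (fun x => φ x + t * ψ x) := by
  have hs : tsupport (fun x => φ x + t * ψ x) ⊆ tsupport φ ∪ tsupport ψ := by
    refine closure_minimal (fun x hx => ?_) ((isClosed_tsupport _).union (isClosed_tsupport _))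
    by_contra hc
    rw [mem_union, not_or] at hc
    apply hx
    simp only [image_eq_zero_of_notMem_tsupport hc.1, image_eq_zero_of_notMem_tsupport hc.2]
    simp
  refine ⟨h.1.add (contDiff_const.mul h'.1), ?_, hs.trans (union_subset h.2.2 h'.2.2)⟩
  exact IsCompact.of_isClosed_subset (h.2.1.union h'.2.1) (isClosed_tsupport _) hs

lemma pd_add_mul {n : ℕ} {φ ψ : EE n → ℝ} (h : Differentiable ℝ φ) (h' : Differentiable ℝ ψ)
    (t : ℝ) (i : Fin n) (x : EE n) :
    pd i (fun x => φ x + t * ψ x) x = pd i φ x + t * pd i ψ x := by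
  have h1 : HasFDerivAt (fun x => φ x + t * ψ x) (fderiv ℝ φ x + t • fderiv ℝ ψ x) x :=
    (h x).hasFDerivAt.add ((h' x).hasFDerivAt.const_mul t)
  rw [pd, h1.fderiv]; simp [pd]

lemma cont_mul {n : ℕ} {Ω : Set (EE n)} (hΩ : IsOpen Ω) {W φ : EE n → ℝ} (hW : ContinuousOn W Ω)
    (hφ : Continuous φ) (hs : tsupport φ ⊆ Ω) : Continuous (fun x => W x * φ x) := by
  rw [continuous_iff_continuousAt]
  intro x
  by_cases hx : x ∈ Ω
  · exact (hW.continuousAt (hΩ.mem_nhds hx)).mul hφ.continuousAt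
  · have hx' : x ∉ tsupport φ := fun h => hx (hs h)
    have h0 : (fun x => W x * φ x) =ᶠ[𝓝 x] fun _ => 0 := by
      filter_upwards [notMem_tsupport_iff_eventuallyEq.1 hx'] with y hy
      rw [hy]; simp
    exact continuousAt_const.congr h0.symm

lemma int_mul {n : ℕ} {Ω : Set (EE n)} (hΩ : IsOpen Ω) {W φ : EE n → ℝ} (hW : ContinuousOn W Ω)
    (hφ : Continuous φ) (hc : HasCompactSupport φ) (hs : tsupport φ ⊆ Ω) :
    Integrable (fun x => W x * φ x) :=
  (cont_mul hΩ hW hφ hs).integrable_of_hasCompactSupport hc.mul_left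

/-- The bilinear form. -/
def BB {n : ℕ} (W φ ψ : EE n → ℝ) : ℝ :=
  ∫ x, ((∑ i, pd i φ x * pd i ψ x) + W x * (φ x * ψ x))

lemma test_pd {n : ℕ} {Ω : Set (EE n)} {φ : EE n → ℝ} (h : IsTestFun Ω φ) (i : Fin n) :
    IsTestFun Ω (pd i φ) :=
  ⟨pd_contDiff i h.1, HasCompactSupport.mono' h.2.1 ((subset_tsupport _).trans (pd_tsupport i φ)),
    (pd_tsupport i φ).trans h.2.2⟩

lemma int_mul_test {n : ℕ} {Ω : Set (EE n)} {φ ψ : EE n → ℝ} (h : Continuous φ)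
    (h' : IsTestFun Ω ψ) : Integrable (fun x => φ x * ψ x) :=
  (h.mul (test_cont h')).integrable_of_hasCompactSupport h'.2.1.mul_left

lemma tsupport_mul_r {n : ℕ} {Ω : Set (EE n)} (φ : EE n → ℝ) {ψ : EE n → ℝ}
    (h' : IsTestFun Ω ψ) : tsupport (fun x => φ x * ψ x) ⊆ Ω :=
  (tsupport_mul_subset_right).trans h'.2.2

lemma int_W {n : ℕ} {Ω : Set (EE n)} (hΩ : IsOpen Ω) {W : EE n → ℝ} (hW : ContinuousOn W Ω)
    {φ ψ : EE n → ℝ} (h : Continuous φ) (h' : IsTestFun Ω ψ) :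
    Integrable (fun x => W x * (φ x * ψ x)) :=
  int_mul hΩ hW (h.mul (test_cont h')) h'.2.1.mul_left (tsupport_mul_r φ h')

lemma int_sum {n : ℕ} {Ω : Set (EE n)} {φ ψ : EE n → ℝ} (h : IsTestFun Ω φ)
    (h' : IsTestFun Ω ψ) : Integrable (fun x => ∑ i, pd i φ x * pd i ψ x) :=
  integrable_finsetSum _ fun i _ => int_mul_test (test_cont (test_pd h i)) (test_pd h' i)

lemma int_BB {n : ℕ} {Ω : Set (EE n)} (hΩ : IsOpen Ω) {W : EE n → ℝ} (hW : ContinuousOn W Ω)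
    {φ ψ : EE n → ℝ} (h : IsTestFun Ω φ) (h' : IsTestFun Ω ψ) :
    Integrable (fun x => (∑ i, pd i φ x * pd i ψ x) + W x * (φ x * ψ x)) :=
  (int_sum h h').add (int_W hΩ hW (test_cont h) h')

lemma BB_expand {n : ℕ} {Ω : Set (EE n)} (hΩ : IsOpen Ω) {W : EE n → ℝ} (hW : ContinuousOn W Ω)
    {φ ψ : EE n → ℝ} (h : IsTestFun Ω φ) (h' : IsTestFun Ω ψ) (t : ℝ) :
    BB W (fun x => φ x + t * ψ x) (fun x => φ x + t * ψ x) =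
      BB W φ φ + t * (2 * BB W φ ψ) + t^2 * BB W ψ ψ := by
  have i1 := int_BB hΩ hW h h
  have i2 := int_BB hΩ hW h h'
  have i3 := int_BB hΩ hW h' h'
  have i4 : Integrable (fun x => t * (2 * ((∑ i, pd i φ x * pd i ψ x) + W x * (φ x * ψ x)))) :=
    (i2.const_mul 2).const_mul t
  have i5 : Integrable (fun x => ((∑ i, pd i φ x * pd i φ x) + W x * (φ x * φ x)) +
    t * (2 * ((∑ i, pd i φ x * pd i ψ x) + W x * (φ x * ψ x)))) := i1.add i4
  unfold BB
  rw [← integral_const_mul, ← integral_const_mul, ← integral_const_mul,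
    ← integral_add i1 i4, ← integral_add i5 (i3.const_mul (t^2))]
  refine integral_congr_ae (ae_of_all _ fun x => ?_)
  simp only [pd_add_mul (diff_of_smooth h.1) (diff_of_smooth h'.1)]
  have e : ∑ i, (pd i φ x + t * pd i ψ x) * (pd i φ x + t * pd i ψ x) =
      (∑ i, pd i φ x * pd i φ x) + t * (2 * ∑ i, pd i φ x * pd i ψ x) +
        t^2 * ∑ i, pd i ψ x * pd i ψ x := by
    simp only [Finset.mul_sum, ← Finset.sum_add_distrib]
    refine Finset.sum_congr rfl fun i _ => ?_
    ring
  rw [e]; ring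

lemma BB_parts {n : ℕ} {Ω : Set (EE n)} (hΩ : IsOpen Ω) {W : EE n → ℝ} (hW : ContinuousOn W Ω)
    {φ ψ : EE n → ℝ} (h : IsTestFun Ω φ) (h' : IsTestFun Ω ψ) :
    BB W φ ψ = ∫ x, (W x * ψ x - lap ψ x) * φ x := by
  have e : ∀ i : Fin n, ∫ x, pd i φ x * pd i ψ x = - ∫ x, φ x * pd i (pd i ψ) x := by
    intro i
    have := integral_mul_fderiv_eq_neg_fderiv_mul_of_integrable (μ := (volume : Measure (EE n)))
      (f := φ) (g := pd i ψ) (v := EuclideanSpace.single i 1)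
      (int_mul_test (test_cont (test_pd h i)) (test_pd h' i))
      (int_mul_test (test_cont h) (test_pd (test_pd h' i) i))
      (int_mul_test (test_cont h) (test_pd h' i))
      (fun x _ => diff_of_smooth h.1 x) (fun x _ => diff_of_smooth (test_pd h' i).1 x)
    have h2 : ∫ x, φ x * pd i (pd i ψ) x = - ∫ x, pd i φ x * pd i ψ x := this
    rw [h2, neg_neg]
  unfold BB
  rw [integral_add (int_sum h h') (int_W hΩ hW (test_cont h) h'),
    integral_finsetSum _ (fun i _ => int_mul_test (test_cont (test_pd h i)) (test_pd h' i)),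
    Finset.sum_congr rfl (fun i _ => e i), Finset.sum_neg_distrib, ← integral_finsetSum _
      (fun i _ => int_mul_test (test_cont h) (test_pd (test_pd h' i) i)), add_comm,
    ← sub_eq_add_neg, ← integral_sub (int_W hΩ hW (test_cont h) h')
      (integrable_finsetSum _ (fun i _ => int_mul_test (test_cont h) (test_pd (test_pd h' i) i)))]
  refine integral_congr_ae (ae_of_all _ fun x => ?_)
  simp only [lap_eq, ← Finset.mul_sum]
  ring

lemma grad_norm {n : ℕ} (φ : EE n → ℝ) (x : EE n) :
    ‖gradient φ x‖^2 = ∑ i, pd i φ x * pd i φ x := by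
  rw [EuclideanSpace.norm_sq_eq]
  refine Finset.sum_congr rfl fun i _ => ?_
  have : gradient φ x i = pd i φ x := by
    have h1 : inner ℝ (gradient φ x) (EuclideanSpace.single i (1:ℝ)) = pd i φ x := by
      rw [gradient, InnerProductSpace.toDual_symm_apply, pd]
    rw [← h1, EuclideanSpace.inner_single_right]; simp
  rw [this, Real.norm_eq_abs, sq_abs, sq]

lemma BB_eq_set {n : ℕ} {Ω : Set (EE n)} (V : EE n → ℝ) {φ : EE n → ℝ}
    (h : IsTestFun Ω φ) :
    ∫ x in Ω, (‖gradient φ x‖ ^ 2 + V x * (φ x) ^ 2) = BB V φ φ := by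
  rw [setIntegral_eq_integral_of_forall_compl_eq_zero]
  · unfold BB
    refine integral_congr_ae (ae_of_all _ fun x => ?_)
    simp only [grad_norm]; ring
  · intro x hx
    have h1 : φ x = 0 := image_eq_zero_of_notMem_tsupport fun h' => hx (h.2.2 h')
    have h2 : ∀ i, pd i φ x = 0 := fun i =>
      image_eq_zero_of_notMem_tsupport fun h' => hx ((test_pd h i).2.2 h')
    rw [grad_norm]; simp [h1, h2]

/-- The energy functional. -/
def JJ {n : ℕ} (W f φ : EE n → ℝ) : ℝ := BB W φ φ - 2 * ∫ x, f x * φ x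

lemma JJ_expand {n : ℕ} {Ω : Set (EE n)} (hΩ : IsOpen Ω) {W f : EE n → ℝ} (hW : ContinuousOn W Ω)
    (hf : Continuous f)
    {φ ψ : EE n → ℝ} (h : IsTestFun Ω φ) (h' : IsTestFun Ω ψ) (t : ℝ) :
    JJ W f (fun x => φ x + t * ψ x) =
      JJ W f φ + t * (2 * (BB W φ ψ - ∫ x, f x * ψ x)) + t^2 * BB W ψ ψ := by
  unfold JJ
  rw [BB_expand hΩ hW h h' t]
  have : ∫ x, f x * (φ x + t * ψ x) = (∫ x, f x * φ x) + t * ∫ x, f x * ψ x := by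
    rw [← integral_const_mul, ← integral_add (int_mul_test hf h) ((int_mul_test hf h').const_mul t)]
    refine integral_congr_ae (ae_of_all _ fun x => ?_)
    simp only; ring
  rw [this]; ring

end AAP

namespace AAP
open Filter Topology Set

lemma JJ_eq {n : ℕ} {Ω : Set (EE n)} (hΩ : IsOpen Ω) {W f : EE n → ℝ} (hW : ContinuousOn W Ω)
    (hf : Continuous f) {φ : EE n → ℝ} (h : IsTestFun Ω φ) :
    JJ W f φ = ∫ x, (((∑ i, pd i φ x * pd i φ x) + W x * (φ x * φ x)) - 2 * (f x * φ x)) := by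
  rw [JJ, BB, integral_sub (int_BB hΩ hW h h) ((int_mul_test hf h).const_mul 2), integral_const_mul]

lemma reg_abs {n : ℕ} {Ω : Set (EE n)} {φ : EE n → ℝ} (h : IsTestFun Ω φ) {δ : ℝ} (hδ : 0 < δ) :
    IsTestFun Ω (fun x => √(φ x ^ 2 + δ^2) - δ) ∧
    ∀ i x, pd i (fun x => √(φ x ^ 2 + δ^2) - δ) x * pd i (fun x => √(φ x ^ 2 + δ^2) - δ) x ≤
      pd i φ x * pd i φ x := by
  have hne : ∀ x, φ x ^ 2 + δ^2 ≠ 0 := fun x => by positivity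
  have hsub : Function.support (fun x => √(φ x ^ 2 + δ^2) - δ) ⊆ Function.support φ := by
    intro x hx h0
    apply hx
    simp only [h0]
    simp [Real.sqrt_sq hδ.le]
  refine ⟨⟨?_, h.2.1.mono hsub, (closure_mono hsub).trans h.2.2⟩, fun i x => ?_⟩
  · exact (((h.1.pow 2).add contDiff_const).sqrt hne).sub contDiff_const
  · have hd := (diff_of_smooth h.1 x).hasFDerivAt
    have h1 := (((hd.pow 2).add_const (δ^2)).sqrt (hne x)).sub_const δ
    have h2 : pd i (fun x => √(φ x ^ 2 + δ^2) - δ) x = φ x / √(φ x ^ 2 + δ^2) * pd i φ x := by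
      rw [pd, HasFDerivAt.fderiv h1]
      simp [pd]
      field_simp
    rw [h2]
    have hsq : √(φ x ^ 2 + δ^2) ^ 2 = φ x ^ 2 + δ^2 := Real.sq_sqrt (by positivity)
    have h3 : φ x / √(φ x ^ 2 + δ^2) * (φ x / √(φ x ^ 2 + δ^2)) ≤ 1 := by
      rw [div_mul_div_comm, ← sq, ← sq, hsq, div_le_one (by positivity)]
      nlinarith [sq_nonneg δ]
    nlinarith [mul_self_nonneg (pd i φ x)]

lemma pos_part {n : ℕ} {Ω : Set (EE n)} (hΩ : IsOpen Ω) {W f : EE n → ℝ} (hW : ContinuousOn W Ω)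
    (hf : IsTestFun Ω f) (hf0 : ∀ x, 0 ≤ f x) {φ : EE n → ℝ} (h : IsTestFun Ω φ) {η : ℝ}
    (hη : 0 < η) : ∃ ψ, IsTestFun Ω ψ ∧ (∀ x, 0 ≤ ψ x) ∧ JJ W f ψ ≤ JJ W f φ + η := by
  have hcf := test_cont hf
  have habs : Integrable (fun x => |W x| * |φ x|) :=
    (cont_mul hΩ hW.abs (test_cont h).abs (by
      refine (closure_mono ?_).trans h.2.2
      intro x hx; simpa using hx)).integrable_of_hasCompactSupport
      (HasCompactSupport.mul_left (h.2.1.comp_left (g := fun t : ℝ => |t|) (by simp)))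
  have hfi : Integrable f := hcf.integrable_of_hasCompactSupport hf.2.1
  have hI := habs.add hfi
  set D := ∫ x, (|W x| * |φ x| + f x) with hD
  have hD0 : 0 ≤ D := integral_nonneg fun x => by have := hf0 x; positivity
  set δ := η / (2 * (D + 1)) with hδd
  have hδ : 0 < δ := by positivity
  obtain ⟨ht, hpd⟩ := reg_abs h hδ
  have hψ0 : ∀ x, 0 ≤ √(φ x ^ 2 + δ^2) - δ := fun x => by
    have : δ ≤ √(φ x ^ 2 + δ^2) := Real.le_sqrt_of_sq_le (by nlinarith [sq_nonneg (φ x)])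
    linarith
  refine ⟨_, ht, hψ0, ?_⟩
  set ψ := fun x => √(φ x ^ 2 + δ^2) - δ with hψ
  have hψ1 : ∀ x, ψ x ≤ |φ x| := fun x => by
    have : √(φ x ^ 2 + δ^2) ≤ |φ x| + δ := by
      rw [Real.sqrt_le_left (by positivity)]
      nlinarith [sq_abs (φ x), abs_nonneg (φ x)]
    simp only [hψ]; linarith
  have hψ2 : ∀ x, |φ x| - δ ≤ ψ x := fun x => by
    have : |φ x| ≤ √(φ x ^ 2 + δ^2) := Real.abs_le_sqrt (by nlinarith [sq_nonneg δ])
    simp only [hψ]; linarith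
  have key : JJ W f ψ ≤ JJ W f φ + 2 * δ * D := by
    have i1 : Integrable (fun x => 2 * δ * (|W x| * |φ x| + f x)) := hI.const_mul _
    have i2 : Integrable (fun x => ((∑ i, pd i φ x * pd i φ x) + W x * (φ x * φ x)) -
        2 * (f x * φ x)) := (int_BB hΩ hW h h).sub ((int_mul_test hcf h).const_mul 2)
    rw [JJ_eq hΩ hW hcf ht, JJ_eq hΩ hW hcf h, hD, ← integral_const_mul, ← integral_add i2 i1]
    refine integral_mono ((int_BB hΩ hW ht ht).sub ((int_mul_test hcf ht).const_mul 2)) (i2.add i1)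
      (fun x => ?_)
    simp only [Pi.sub_apply]
    have hs : ∑ i, pd i ψ x * pd i ψ x ≤ ∑ i, pd i φ x * pd i φ x :=
      Finset.sum_le_sum fun i _ => hpd i x
    have hw : W x * (ψ x * ψ x) ≤ W x * (φ x * φ x) + 2 * δ * (|W x| * |φ x|) := by
      have e1 : φ x * φ x - ψ x * ψ x ≤ 2 * δ * |φ x| := by
        have e2 : φ x * φ x = |φ x| * |φ x| := (abs_mul_abs_self _).symm
        rw [e2]
        nlinarith [hψ1 x, hψ2 x, hψ0 x, abs_nonneg (φ x)]
      have e3 : 0 ≤ φ x * φ x - ψ x * ψ x := by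
        have e2 : φ x * φ x = |φ x| * |φ x| := (abs_mul_abs_self _).symm
        rw [e2]
        have := mul_self_le_mul_self (hψ0 x) (hψ1 x)
        linarith
      have e4 : -|W x| ≤ W x := neg_abs_le _
      have e5 := mul_le_mul_of_nonneg_left e1 (abs_nonneg (W x))
      have e6 := mul_le_mul_of_nonneg_right e4 e3
      nlinarith
    have hff : f x * φ x ≤ f x * ψ x + δ * f x := by
      have e1 : φ x ≤ ψ x + δ := by linarith [hψ2 x, le_abs_self (φ x)]
      nlinarith [mul_le_mul_of_nonneg_left e1 (hf0 x)]
    linarith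
  refine key.trans ?_
  have : 2 * δ * D ≤ η := by
    rw [hδd]
    have : 2 * (η / (2 * (D+1))) * D = η * (D / (D+1)) := by field_simp
    rw [this]
    have : D / (D+1) ≤ 1 := by rw [div_le_one (by positivity)]; linarith
    nlinarith
  linarith

lemma L2_norm {n : ℕ} {f : EE n → ℝ} (hf : MemLp f 2 (volume : Measure (EE n))) :
    ‖hf.toLp f‖^2 = ∫ x, f x * f x := by
  rw [← real_inner_self_eq_norm_sq, L2.inner_def]
  refine integral_congr_ae ?_
  filter_upwards [hf.coeFn_toLp] with x hx
  rw [hx]; simp [sq]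

lemma L2_inner {n : ℕ} {f : EE n → ℝ} (hf : MemLp f 2 (volume : Measure (EE n)))
    (u : Lp ℝ 2 (volume : Measure (EE n))) :
    inner ℝ u (hf.toLp f) = ∫ x, f x * u x := by
  rw [L2.inner_def]
  refine integral_congr_ae ?_
  filter_upwards [hf.coeFn_toLp] with x hx
  rw [hx]; simp

lemma test_memLp {n : ℕ} {f : EE n → ℝ} (hf : Continuous f) (hc : HasCompactSupport f) :
    MemLp f 2 (volume : Measure (EE n)) := hf.memLp_of_hasCompactSupport hc

lemma exists_weak {n : ℕ} {Ω : Set (EE n)} (hΩ : IsOpen Ω) {W f : EE n → ℝ}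
    (hW : ContinuousOn W Ω) {ε : ℝ} (hε : 0 < ε)
    (hQ : ∀ φ, IsTestFun Ω φ → ε * ∫ x, φ x * φ x ≤ BB W φ φ)
    (hf : IsTestFun Ω f) (hf0 : ∀ x, 0 ≤ f x) :
    ∃ u : EE n → ℝ, LocallyIntegrable u volume ∧ (∀ᵐ x, 0 ≤ u x) ∧
      ∀ φ, IsTestFun Ω φ → ∫ x, (W x * φ x - lap φ x) * u x = ∫ x, f x * φ x := by
  have hcf := test_cont hf
  have hff : Integrable (fun x => f x * f x) := int_mul_test hcf hf
  -- lower bound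
  have hlow : ∀ φ, IsTestFun Ω φ → -(∫ x, f x * f x) / ε ≤ JJ W f φ := by
    intro φ h
    have h1 := hQ φ h
    have h2 : 2 * ∫ x, f x * φ x ≤ ε * (∫ x, φ x * φ x) + (∫ x, f x * f x) / ε := by
      have i1 : Integrable (fun x => ε * (φ x * φ x)) := (int_mul_test (test_cont h) h).const_mul ε
      rw [div_eq_inv_mul, ← integral_const_mul, ← integral_const_mul, ← integral_const_mul,
        ← integral_add i1 (hff.const_mul _)]
      refine integral_mono ((int_mul_test hcf h).const_mul 2) (i1.add (hff.const_mul _)) fun x => ?_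
      simp only
      have : ε * (φ x * φ x) + ε⁻¹ * (f x * f x) - 2 * (f x * φ x) = ε * (φ x - f x / ε)^2 := by
        field_simp; ring
      nlinarith [mul_nonneg hε.le (sq_nonneg (φ x - f x / ε))]
    rw [JJ, neg_div]; linarith
  set J : Set ℝ := {r | ∃ φ, IsTestFun Ω φ ∧ JJ W f φ = r} with hJ
  have hbdd : BddBelow J := ⟨_, by rintro r ⟨φ, h, rfl⟩; exact hlow φ h⟩
  have hne : J.Nonempty := ⟨_, f, hf, rfl⟩
  set m := sInf J with hm
  have hmle : ∀ φ, IsTestFun Ω φ → m ≤ JJ W f φ := fun φ h => csInf_le hbdd ⟨φ, h, rfl⟩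
  have hex : ∀ k : ℕ, ∃ φ, IsTestFun Ω φ ∧ (∀ x, 0 ≤ φ x) ∧ JJ W f φ ≤ m + 1 / ((k:ℝ)+1) := by
    intro k
    have hk : (0:ℝ) < 1 / ((k:ℝ)+1) / 2 := by positivity
    obtain ⟨r, ⟨φ, h, rfl⟩, hr⟩ := Real.lt_sInf_add_pos hne hk
    obtain ⟨ψ, h1, h2, h3⟩ := pos_part hΩ hW hf hf0 h hk
    exact ⟨ψ, h1, h2, by linarith⟩
  choose φ hφ hφ0 hφJ using hex
  -- Cauchy
  have hq : ∀ i j : ℕ, ε * ∫ x, (φ i x - φ j x) * (φ i x - φ j x) ≤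
      2 * (1 / ((i:ℝ)+1) + 1 / ((j:ℝ)+1)) := by
    intro i j
    have ht : IsTestFun Ω (fun x => φ i x + (-1) * φ j x) := test_add (hφ i) (hφ j) (-1)
    have e1 := JJ_expand hΩ hW hcf (hφ j) ht 1
    have e2 := JJ_expand hΩ hW hcf (hφ j) ht (1/2)
    have e3 : (fun x => φ j x + 1 * (φ i x + (-1) * φ j x)) = φ i := by ext x; ring
    rw [e3] at e1
    have e4 := hmle _ (test_add (hφ j) ht (1/2))
    have e5 := hQ _ ht
    have e6 : (fun x => (φ i x + (-1) * φ j x) * (φ i x + (-1) * φ j x)) =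
      fun x => (φ i x - φ j x) * (φ i x - φ j x) := by ext x; ring
    rw [e6] at e5
    have := hφJ i
    have := hφJ j
    linarith
  have hmem : ∀ k, MemLp (φ k) 2 (volume : Measure (EE n)) := fun k =>
    test_memLp (test_cont (hφ k)) (hφ k).2.1
  set F : ℕ → Lp ℝ 2 (volume : Measure (EE n)) := fun k => (hmem k).toLp (φ k) with hF
  have hFn : ∀ i j, ‖F i - F j‖^2 ≤ 2 / ε * (1 / ((i:ℝ)+1) + 1 / ((j:ℝ)+1)) := by
    intro i j
    rw [hF]
    simp only
    rw [← MemLp.toLp_sub, L2_norm, div_mul_eq_mul_div, le_div_iff₀ hε, mul_comm]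
    exact hq i j
  have hc : CauchySeq F := by
    rw [Metric.cauchySeq_iff']
    intro η hη
    have hz : Tendsto (fun k : ℕ => 2 / ε * (2 * (1 / ((k:ℝ)+1)))) atTop (𝓝 0) := by
      simpa using ((tendsto_one_div_add_atTop_nhds_zero_nat (𝕜 := ℝ)).const_mul 2).const_mul (2/ε)
    obtain ⟨N, hN⟩ := (hz.eventually (gt_mem_nhds (by positivity : 0 < η^2))).exists
    refine ⟨N, fun k hk => ?_⟩
    rw [dist_eq_norm]
    refine lt_of_pow_lt_pow_left₀ 2 hη.le ((hFn k N).trans_lt (lt_of_le_of_lt ?_ hN))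
    have : 1 / ((k:ℝ)+1) ≤ 1 / ((N:ℝ)+1) := one_div_le_one_div_of_le (by positivity)
      (by have : (N:ℝ) ≤ k := by exact_mod_cast hk
          linarith)
    gcongr
    linarith
  obtain ⟨u, hu⟩ := cauchySeq_tendsto_of_complete hc
  refine ⟨u, (Lp.memLp u).locallyIntegrable (by norm_num), ?_, fun ψ hψ => ?_⟩
  · have h0 : (0 : Lp ℝ 2 (volume : Measure (EE n))) ≤ u := by
      refine ge_of_tendsto' hu fun k => ?_
      rw [← Lp.coeFn_nonneg]
      filter_upwards [(hmem k).coeFn_toLp] with x hx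
      rw [hF]; simp only; rw [hx]; exact hφ0 k x
    exact (Lp.coeFn_nonneg u).2 h0
  · set h : EE n → ℝ := fun x => W x * ψ x - lap ψ x with hh
    have hlap := IsTestFun.lap_test hψ
    have hhc : Continuous h := (cont_mul hΩ hW (test_cont hψ) hψ.2.2).sub (test_cont hlap)
    have hhs : HasCompactSupport h :=
      HasCompactSupport.sub (hψ.2.1.mul_left) hlap.2.1
    have hhm := test_memLp hhc hhs
    have t1 : Tendsto (fun k => inner ℝ (F k) (hhm.toLp h)) atTop (𝓝 (inner ℝ u (hhm.toLp h))) :=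
      hu.inner tendsto_const_nhds
    have t2 : ∀ k, inner ℝ (F k) (hhm.toLp h) = BB W (φ k) ψ := by
      intro k
      rw [L2_inner, BB_parts hΩ hW (hφ k) hψ]
      refine integral_congr_ae ?_
      filter_upwards [(hmem k).coeFn_toLp] with x hx
      rw [hF]; simp only; rw [hx]
    rw [← L2_inner hhm u]
    simp_rw [t2] at t1
    refine tendsto_nhds_unique t1 ?_
    -- quadratic estimate
    have hest : ∀ k : ℕ, (BB W (φ k) ψ - ∫ x, f x * ψ x)^2 ≤ 1 / ((k:ℝ)+1) * BB W ψ ψ := by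
      intro k
      have hk : (0:ℝ) < 1 / ((k:ℝ)+1) := by positivity
      have hd := discrim_le_zero (a := BB W ψ ψ) (b := 2 * (BB W (φ k) ψ - ∫ x, f x * ψ x))
        (c := 1 / ((k:ℝ)+1)) (fun t => by
          have e1 := hmle _ (test_add (hφ k) hψ t)
          rw [JJ_expand hΩ hW hcf (hφ k) hψ t] at e1
          have := hφJ k
          nlinarith)
      rw [discrim] at hd
      nlinarith
    have hz : Tendsto (fun k : ℕ => (BB W (φ k) ψ - ∫ x, f x * ψ x)^2) atTop (𝓝 0) := by
      refine squeeze_zero (fun k => sq_nonneg _) hest ?_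
      simpa using (tendsto_one_div_add_atTop_nhds_zero_nat (𝕜 := ℝ)).mul_const (BB W ψ ψ)
    have hz2 := hz.sqrt
    simp only [Real.sqrt_sq_eq_abs, Real.sqrt_zero] at hz2
    have hz3 := (tendsto_zero_iff_abs_tendsto_zero _).2 hz2
    simpa using hz3.add_const (∫ x, f x * ψ x)

end AAP

namespace AAP
open Filter Topology Set

/-- Weak solution of `-Δu + W u = f` on `Ω`, `u ≥ 0`. -/
structure Sol {n : ℕ} (Ω : Set (EE n)) (W f u : EE n → ℝ) : Prop where
  iu : LocallyIntegrable u volume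
  nn : ∀ᵐ x, 0 ≤ u x
  fc : Continuous f
  f0 : ∀ x, 0 ≤ f x
  eq : ∀ φ, IsTestFun Ω φ → ∫ x, (W x * φ x - lap φ x) * u x = ∫ x, f x * φ x

lemma int_cu {n : ℕ} {h u : EE n → ℝ} (hc : Continuous h) (hs : HasCompactSupport h)
    (hu : LocallyIntegrable u volume) : Integrable (fun x => h x * u x) := by
  simpa using hu.integrable_smul_left_of_hasCompactSupport hc hs

lemma Sol.localize {n : ℕ} {Ω : Set (EE n)} (hΩ : IsOpen Ω) {W f u : EE n → ℝ}
    (hW : ContinuousOn W Ω) (h : Sol Ω W f u) {p : EE n} {ρ : ℝ}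
    (hp : Metric.closedBall p ρ ⊆ Ω) :
    WeakLap (Metric.ball p ρ) u ((Metric.ball p ρ).indicator fun x => W x * u x - f x) := by
  have hbΩ : Metric.ball p ρ ⊆ Ω := Metric.ball_subset_closedBall.trans hp
  refine ⟨h.iu, ?_, fun φ hφ => ?_⟩
  · refine Integrable.locallyIntegrable ?_
    rw [integrable_indicator_iff Metric.isOpen_ball.measurableSet]
    refine IntegrableOn.mono_set ?_ Metric.ball_subset_closedBall
    refine IntegrableOn.sub ?_ (h.fc.continuousOn.integrableOn_compact (isCompact_closedBall _ _))
    exact IntegrableOn.continuousOn_mul (hW.mono hp)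
      (h.iu.integrableOn_isCompact (isCompact_closedBall _ _)) (isCompact_closedBall _ _)
  · have hφΩ : IsTestFun Ω φ := ⟨hφ.1, hφ.2.1, hφ.2.2.trans hbΩ⟩
    have hl := IsTestFun.lap_test hφΩ
    have i1 : Integrable (fun x => (W x * φ x) * u x) :=
      int_cu (cont_mul hΩ hW (test_cont hφΩ) hφΩ.2.2) hφΩ.2.1.mul_left h.iu
    have i2 : Integrable (fun x => lap φ x * u x) := int_cu (test_cont hl) hl.2.1 h.iu
    have i3 : Integrable (fun x => f x * φ x) := int_mul_test h.fc hφ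
    have e := h.eq φ hφΩ
    simp_rw [sub_mul] at e
    rw [integral_sub i1 i2] at e
    have e2 : ∫ y, u y * lap φ y = ∫ x, lap φ x * u x := by simp_rw [mul_comm]
    rw [e2]
    have e3 : ∫ x, lap φ x * u x = (∫ x, (W x * φ x) * u x) - ∫ x, f x * φ x := by linarith
    rw [e3, ← integral_sub i1 i3]
    refine integral_congr_ae (ae_of_all _ fun x => ?_)
    simp only
    by_cases hx : x ∈ Metric.ball p ρ
    · rw [indicator_of_mem hx]; ring
    · have : φ x = 0 := image_eq_zero_of_notMem_tsupport fun h' => hx (hφ.2.2 h')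
      rw [this]; ring

/-- `u` has positive mass near `x`. -/
def Pos {n : ℕ} (u : EE n → ℝ) (x : EE n) : Prop :=
  ∀ r : ℝ, 0 < r → 0 < ∫ y in Metric.closedBall x r, u y

lemma super_hg {n : ℕ} {W f u : EE n → ℝ} (hu : ∀ᵐ x, 0 ≤ u x) (hf : ∀ x, 0 ≤ f x)
    {U : Set (EE n)} {M : ℝ} (hM : ∀ x ∈ U, |W x| ≤ M) :
    ∀ᵐ y, y ∈ U → (U.indicator fun x => W x * u x - f x) y ≤ M * u y := by
  filter_upwards [hu] with y hy hyU
  rw [indicator_of_mem hyU]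
  have h1 := (le_abs_self _).trans (hM y hyU)
  nlinarith [mul_le_mul_of_nonneg_right h1 hy, hf y]

lemma Sol.pos_step {n : ℕ} {Ω : Set (EE n)} (hΩ : IsOpen Ω) {W f u : EE n → ℝ}
    (hW : ContinuousOn W Ω) (h : Sol Ω W f u) {p : EE n} (hp : p ∈ Ω) :
    ∃ r : ℝ, 0 < r ∧ ∀ x ∈ Metric.ball p r, ∀ y ∈ Metric.ball p r, Pos u x → Pos u y := by
  obtain ⟨ρ, hρ, hρΩ⟩ := Metric.nhds_basis_closedBall.mem_iff.1 (hΩ.mem_nhds hp)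
  set r := ρ / 9 with hr
  have hr0 : 0 < r := by positivity
  have hw := h.localize hΩ hW hρΩ
  obtain ⟨M, hM⟩ := (isCompact_closedBall p ρ).exists_bound_of_continuousOn (hW.mono hρΩ)
  have hM0 : 0 ≤ M := (norm_nonneg _).trans (hM p (Metric.mem_closedBall_self hρ.le))
  have hg := super_hg h.nn h.f0 (U := Metric.ball p ρ) (M := M)
    (fun x hx => hM x (Metric.ball_subset_closedBall hx))
  obtain ⟨C, hC, hmass⟩ := mass_le n hr0
  have hmS := mS_pos n
  refine ⟨r, hr0, fun x hx y hy hpos => ?_⟩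
  have hae : ∀ᵐ z, z ∈ Metric.ball p r → 0 < u z := by
    filter_upwards [FF_ae_tendsto h.iu] with z hz hzp
    have hb : Metric.ball z (8*r) ⊆ Metric.ball p ρ := by
      refine Metric.ball_subset_ball' ?_
      rw [Metric.mem_ball] at hzp; linarith
    have h1 := super_lower hw h.nn hM0 hg (by positivity : 0 < 8*r) hb hz
      (s := 1/(4*r)) (one_div_lt_one_div_of_lt (by positivity) (by linarith))
    have h2 := hmass u z h.iu h.nn
    have h3 : ∫ y in Metric.closedBall x r, u y ≤ ∫ y in Metric.closedBall z (3*r), u y := by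
      refine setIntegral_mono_set (h.iu.integrableOn_isCompact (isCompact_closedBall _ _))
        (ae_restrict_of_ae h.nn) (HasSubset.Subset.eventuallyLE ?_)
      refine Metric.closedBall_subset_closedBall' ?_
      rw [Metric.mem_ball] at hzp hx
      linarith [dist_triangle_right x z p]
    have h4 := hpos r hr0
    have h5 : 0 < FF S n u z (1/(4*r)) := by
      by_contra hc
      have := mul_nonpos_of_nonneg_of_nonpos hC.le (not_lt.1 hc)
      linarith
    have h6 : 0 < mS n * u z := lt_of_lt_of_le (mul_pos h5 (Real.exp_pos _)) h1
    exact (mul_pos_iff_of_pos_left hmS).1 h6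
  intro t ht
  have hInt1 := h.iu.integrableOn_isCompact (isCompact_closedBall y t)
  rw [setIntegral_pos_iff_support_of_nonneg_ae (ae_restrict_of_ae h.nn) hInt1]
  have hV : 0 < volume (Metric.ball y t ∩ Metric.ball p r) :=
    (Metric.isOpen_ball.inter Metric.isOpen_ball).measure_pos volume
      ⟨y, Metric.mem_ball_self ht, hy⟩
  refine hV.trans_le (measure_mono_ae ?_)
  filter_upwards [hae] with z hz hz2
  exact ⟨(hz hz2.2).ne', Metric.ball_subset_closedBall hz2.1⟩

lemma Sol.exists_pos {n : ℕ} {Ω : Set (EE n)} {W f u : EE n → ℝ}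
    (h : Sol Ω W f u) (hf : IsTestFun Ω f) {x1 : EE n} (hx1 : 0 < f x1) :
    ∃ x ∈ Ω, Pos u x := by
  by_contra hc
  push Not at hc
  have hz : volume {x | x ∈ Ω ∧ u x ≠ 0} = 0 := by
    refine measure_null_of_locally_null _ fun x hx => ?_
    have h1 := hc x hx.1
    unfold Pos at h1
    push Not at h1
    obtain ⟨r, hr, hr2⟩ := h1
    have h0 : ∫ y in Metric.closedBall x r, u y = 0 :=
      le_antisymm hr2 (integral_nonneg_of_ae (ae_restrict_of_ae h.nn))
    rw [setIntegral_eq_zero_iff_of_nonneg_ae (ae_restrict_of_ae h.nn)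
      (h.iu.integrableOn_isCompact (isCompact_closedBall x r))] at h0
    refine ⟨{x | x ∈ Ω ∧ u x ≠ 0} ∩ Metric.closedBall x r, inter_mem_nhdsWithin _
      (Metric.closedBall_mem_nhds x hr), ?_⟩
    have h2 := (ae_restrict_iff' Metric.isClosed_closedBall.measurableSet).1 h0
    refine measure_mono_null ?_ h2
    intro y hy hy2
    exact hy.1.2 (hy2 hy.2)
  have h1 : ∀ᵐ x, (W x * f x - lap f x) * u x = 0 := by
    have h2 : ∀ᵐ x, ¬ (x ∈ Ω ∧ u x ≠ 0) := by
      rw [ae_iff]; simpa using hz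
    filter_upwards [h2] with x hx
    by_cases hxΩ : x ∈ Ω
    · have : u x = 0 := by by_contra h3; exact hx ⟨hxΩ, h3⟩
      rw [this, mul_zero]
    · have e1 : f x = 0 := image_eq_zero_of_notMem_tsupport fun h' => hxΩ (hf.2.2 h')
      have e2 : lap f x = 0 := image_eq_zero_of_notMem_tsupport fun h' =>
        hxΩ ((IsTestFun.lap_test hf).2.2 h')
      rw [e1, e2]; simp
  have h3 := h.eq f hf
  rw [integral_congr_ae h1, integral_zero] at h3
  have h4 : 0 < ∫ x, f x * f x :=
    (test_cont hf |>.mul (test_cont hf)).integral_pos_of_hasCompactSupport_nonneg_nonzero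
      hf.2.1.mul_left (fun x => mul_self_nonneg _) (x := x1) (mul_pos hx1 hx1).ne'
  linarith

lemma Sol.pos_all {n : ℕ} {Ω : Set (EE n)} (hΩ : IsOpen Ω) (hc : IsPreconnected Ω)
    {W f u : EE n → ℝ} (hW : ContinuousOn W Ω)
    (h : Sol Ω W f u) (hf : IsTestFun Ω f) {x1 : EE n} (hx1 : 0 < f x1) :
    ∀ x ∈ Ω, Pos u x := by
  intro x hx
  obtain ⟨y, hy, hpos⟩ := h.exists_pos hf hx1
  refine hc.induction₂' (fun x y => Pos u x → Pos u y) (fun p hp => ?_)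
    (fun a b c _ _ _ h1 h2 h3 => h2 (h1 h3)) hy hx hpos
  obtain ⟨r, hr, h1⟩ := h.pos_step hΩ hW hp
  filter_upwards [mem_nhdsWithin_of_mem_nhds (Metric.ball_mem_nhds p hr)] with z hz
  exact ⟨h1 p (Metric.mem_ball_self hr) z hz, h1 z hz p (Metric.mem_ball_self hr)⟩

lemma Sol.toLoc {n : ℕ} {Ω : Set (EE n)} (hΩ : IsOpen Ω) {W f u : EE n → ℝ}
    (hW : ContinuousOn W Ω) (h : Sol Ω W f u) {p : EE n} {ρ M : ℝ} (hM0 : 0 ≤ M)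
    (hp : Metric.closedBall p ρ ⊆ Ω) (hM : ∀ x ∈ Metric.ball p ρ, |W x| ≤ M)
    (hf : ∀ x ∈ Metric.ball p ρ, f x = 0) :
    Loc (Metric.ball p ρ) u ((Metric.ball p ρ).indicator fun x => W x * u x - f x) M := by
  refine ⟨h.localize hΩ hW hp, h.nn, hM0, super_hg h.nn h.f0 hM, ?_⟩
  filter_upwards [h.nn] with y hy hyU
  rw [indicator_of_mem hyU, hf y hyU]
  have h1 := (neg_le_abs _).trans (hM y hyU)
  nlinarith [mul_le_mul_of_nonneg_right h1 hy]

end AAP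

namespace AAP
open Filter Topology Set

lemma lap_congr {n : ℕ} {u v : EE n → ℝ} {p : EE n} (h : u =ᶠ[𝓝 p] v) : lap u p = lap v p := by
  unfold lap
  refine Finset.sum_congr rfl fun i _ => ?_
  have h1 : (fun y => fderiv ℝ u y (EuclideanSpace.single i 1)) =ᶠ[𝓝 p]
      (fun y => fderiv ℝ v y (EuclideanSpace.single i 1)) := by
    filter_upwards [h.fderiv (𝕜 := ℝ)] with y hy
    rw [hy]
  rw [h1.fderiv_eq]

lemma LocallyHolderOn.continuousOn {n : ℕ} {Ω : Set (EE n)} {V : EE n → ℝ}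
    (h : LocallyHolderOn Ω V) : ContinuousOn V Ω := by
  intro x hx
  obtain ⟨U, hU, C, α, hα, -, hC⟩ := h x hx
  have h1 : Tendsto (fun y => C * ‖y - x‖ ^ α) (𝓝[Ω] x) (𝓝 0) := by
    have : Continuous (fun y : EE n => C * ‖y - x‖ ^ α) := by
      refine continuous_const.mul (Continuous.rpow_const (by fun_prop) fun y => Or.inr hα.le)
    have := (this.tendsto x).mono_left (nhdsWithin_le_nhds (s := Ω))
    simpa [Real.zero_rpow hα.ne'] using this
  rw [ContinuousWithinAt, tendsto_iff_norm_sub_tendsto_zero]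
  refine squeeze_zero' (Eventually.of_forall fun _ => norm_nonneg _) ?_ h1
  filter_upwards [mem_nhdsWithin_of_mem_nhds hU, self_mem_nhdsWithin] with y hy hy2
  exact hC y ⟨hy, hy2⟩ x ⟨mem_of_mem_nhds hU, hx⟩

/-- Uniform convergence on compact sets along a filter from pointwise convergence and
equi-Hölder bounds. -/
lemma unif_conv {n : ℕ} {F : Filter ℕ} {v : ℕ → EE n → ℝ} {w : EE n → ℝ} {s : Set (EE n)}
    (hs : IsCompact s) {C β : ℝ} (hβ : 0 < β)
    (hH : ∀ᶠ k in F, ∀ x ∈ s, ∀ y ∈ s, |v k x - v k y| ≤ C * dist x y ^ β)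
    (hw : ∀ x ∈ s, ∀ y ∈ s, |w x - w y| ≤ C * dist x y ^ β)
    (ht : ∀ x ∈ s, Tendsto (fun k => v k x) F (𝓝 (w x))) {η : ℝ} (hη : 0 < η) :
    ∀ᶠ k in F, ∀ x ∈ s, |w x - v k x| ≤ η := by
  obtain ⟨δ, hδ, hδ2⟩ : ∃ δ : ℝ, 0 < δ ∧ ∀ d, 0 ≤ d → d < δ → C * d ^ β ≤ η / 3 := by
    have hc : Continuous (fun d : ℝ => C * d ^ β) :=
      continuous_const.mul (Continuous.rpow_const continuous_id fun y => Or.inr hβ.le)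
    have h0 := hc.tendsto 0
    simp only [Real.zero_rpow hβ.ne', mul_zero] at h0
    have h1 := h0.eventually (eventually_le_nhds (show (0:ℝ) < η / 3 by positivity))
    obtain ⟨δ, hδ, h2⟩ := Metric.eventually_nhds_iff.1 h1
    refine ⟨δ, hδ, fun d hd hd2 => h2 ?_⟩
    rwa [Real.dist_eq, sub_zero, abs_of_nonneg hd]
  obtain ⟨t, hts, htf, hcov⟩ := hs.finite_cover_balls hδ
  have h1 : ∀ᶠ k in F, ∀ y ∈ t, |v k y - w y| < η / 3 := by
    rw [htf.eventually_all]
    intro y hy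
    exact (Metric.tendsto_nhds.1 (ht y (hts hy)) (η/3) (by positivity))
  filter_upwards [h1, hH] with k hk hk2 x hx
  obtain ⟨y, hy, hxy⟩ := mem_iUnion₂.1 (hcov hx)
  have a1 := hk2 x hx y (hts hy)
  have a2 := hw x hx y (hts hy)
  have a3 := hk y hy
  have a4 := hδ2 _ dist_nonneg hxy
  rw [abs_le] at a1 a2 ⊢
  rw [abs_lt] at a3
  constructor <;> linarith [a1.1, a1.2, a2.1, a2.2, a3.1, a3.2]

lemma rpow_min_bound {d a b : ℝ} (hd : 0 ≤ d) (hd1 : d ≤ 1) (hb : 0 < b) (hab : b ≤ a) :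
    d ^ a ≤ d ^ b :=
  Real.rpow_le_rpow_of_exponent_ge_of_imp hd hd1 hab (fun _ h => absurd h (hb.trans_le hab).ne')

/-- Passage to the limit. -/
lemma limit_local {n : ℕ} {Ω : Set (EE n)} (hΩ : IsOpen Ω) {V : EE n → ℝ}
    (hV : LocallyHolderOn Ω V) {F : Filter ℕ} [F.NeBot] {v : ℕ → EE n → ℝ} {w : EE n → ℝ}
    {ε : ℕ → ℝ} (hε : Tendsto ε F (𝓝 0)) {p : EE n} {r C β : ℝ} (hr : 0 < r) (hβ : 0 < β)
    (hrΩ : Metric.ball p r ⊆ Ω)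
    (hH : ∀ᶠ k in F, ∀ x ∈ Metric.ball p r, ∀ y ∈ Metric.ball p r,
      |v k x - v k y| ≤ C * dist x y ^ β)
    (ht : ∀ x ∈ Metric.ball p r, Tendsto (fun k => v k x) F (𝓝 (w x)))
    (hI : ∀ k, LocallyIntegrable (v k) volume)
    (hE : ∀ φ, IsTestFun (Metric.ball p r) φ →
      ∀ᶠ k in F, ∫ x, ((V x + ε k) * φ x - lap φ x) * v k x = 0) :
    ContDiffAt ℝ 2 w p ∧ lap w p = V p * w p := by
  have hVc := LocallyHolderOn.continuousOn hV
  have hpΩ : p ∈ Ω := hrΩ (Metric.mem_ball_self hr)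
  have hwH : ∀ x ∈ Metric.ball p r, ∀ y ∈ Metric.ball p r, |w x - w y| ≤ C * dist x y ^ β := by
    intro x hx y hy
    refine le_of_tendsto (((ht x hx).sub (ht y hy)).abs) ?_
    filter_upwards [hH] with k hk using hk x hx y hy
  obtain ⟨U, hU, CV, α, hα, -, hCV⟩ := hV p hpΩ
  obtain ⟨r1, hr1, hr1U⟩ := Metric.mem_nhds_iff.1 hU
  set R := min (r/2) (min r1 (1/2)) with hRdef
  have hR : 0 < R := by positivity
  have hRr : R < r := (min_le_left _ _).trans_lt (by linarith)
  have hRr1 : R ≤ r1 := (min_le_right _ _).trans (min_le_left _ _)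
  have hRh : R ≤ 1/2 := (min_le_right _ _).trans (min_le_right _ _)
  set K := Metric.closedBall p R with hK
  have hKb : K ⊆ Metric.ball p r := Metric.closedBall_subset_ball hRr
  have hBK : Metric.ball p R ⊆ K := Metric.ball_subset_closedBall
  have hKc : IsCompact K := isCompact_closedBall _ _
  have hKm : MeasurableSet K := Metric.isClosed_closedBall.measurableSet
  have hwc : ContinuousOn w (Metric.ball p r) := by
    intro x hx
    have h1 : Tendsto (fun y => C * dist y x ^ β) (𝓝[Metric.ball p r] x) (𝓝 0) := by
      have : Continuous (fun y : EE n => C * dist y x ^ β) := by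
        refine continuous_const.mul (Continuous.rpow_const (by fun_prop) fun y => Or.inr hβ.le)
      have := (this.tendsto x).mono_left (nhdsWithin_le_nhds (s := Metric.ball p r))
      simpa [Real.zero_rpow hβ.ne'] using this
    rw [ContinuousWithinAt, tendsto_iff_norm_sub_tendsto_zero]
    refine squeeze_zero' (Eventually.of_forall fun _ => norm_nonneg _) ?_ h1
    filter_upwards [self_mem_nhdsWithin] with y hy
    exact hwH y hy x hx
  set W := K.indicator w with hW
  set G := K.indicator (fun x => V x * w x) with hG
  have iW : LocallyIntegrable W volume := by
    refine Integrable.locallyIntegrable ?_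
    rw [hW, integrable_indicator_iff hKm]
    exact (hwc.mono hKb).integrableOn_compact hKc
  have iG : LocallyIntegrable G volume := by
    refine Integrable.locallyIntegrable ?_
    rw [hG, integrable_indicator_iff hKm]
    exact ((hVc.mono (hKb.trans hrΩ)).mul (hwc.mono hKb)).integrableOn_compact hKc
  have hWB : EqOn W w (Metric.ball p R) := fun x hx => indicator_of_mem (hBK hx) _
  have hwl : WeakLap (Metric.ball p R) W G := by
    refine ⟨iW, iG, fun φ hφ => ?_⟩
    have hφr : IsTestFun (Metric.ball p r) φ := ⟨hφ.1, hφ.2.1, hφ.2.2.trans (hBK.trans hKb)⟩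
    have hφΩ : IsTestFun Ω φ := ⟨hφ.1, hφ.2.1, hφr.2.2.trans hrΩ⟩
    have hl := IsTestFun.lap_test hφ
    have hφ0 : ∀ x, x ∉ K → φ x = 0 := fun x hx =>
      image_eq_zero_of_notMem_tsupport fun h => hx (hBK (hφ.2.2 h))
    have hl0 : ∀ x, x ∉ K → lap φ x = 0 := fun x hx =>
      image_eq_zero_of_notMem_tsupport fun h => hx (hBK (hl.2.2 h))
    set h := fun x => V x * φ x - lap φ x with hh
    have hVφ : Continuous (fun x => V x * φ x) := cont_mul hΩ hVc (test_cont hφΩ) hφΩ.2.2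
    have hhc : Continuous h := hVφ.sub (test_cont hl)
    have hhs : HasCompactSupport h := HasCompactSupport.sub hφ.2.1.mul_left hl.2.1
    have hh0 : ∀ x, x ∉ K → h x = 0 := fun x hx => by simp [hh, hφ0 x hx, hl0 x hx]
    have iφW : Integrable (fun x => φ x * W x) := int_cu (test_cont hφ) hφ.2.1 iW
    have ihW : Integrable (fun x => h x * W x) := int_cu hhc hhs iW
    have iA : Integrable (fun x => |h x| + |φ x|) :=
      (hhc.integrable_of_hasCompactSupport hhs).abs.add
        ((test_cont hφ).integrable_of_hasCompactSupport hφ.2.1).abs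
    have main : ∫ x, h x * W x = 0 := by
      have key : ∀ η : ℝ, 0 < η → |∫ x, h x * W x| ≤ η * ∫ x, (|h x| + |φ x|) := by
        intro η hη
        have hu := unif_conv hKc hβ (F := F) (v := v) (w := w) (C := C)
          (by filter_upwards [hH] with k hk x hx y hy using hk x (hKb hx) y (hKb hy))
          (fun x hx y hy => hwH x (hKb hx) y (hKb hy)) (fun x hx => ht x (hKb hx)) hη
        have hlim : Tendsto (fun k => η * (∫ x, (|h x| + |φ x|)) + |ε k| * |∫ x, φ x * W x|) F
            (𝓝 (η * (∫ x, (|h x| + |φ x|)) + |0| * |∫ x, φ x * W x|)) :=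
          (hε.abs.mul_const _).const_add _
        have hlim2 : |∫ x, h x * W x| ≤ η * (∫ x, (|h x| + |φ x|)) + |0| * |∫ x, φ x * W x| := by
          refine ge_of_tendsto hlim ?_
          have hε1 : ∀ᶠ k in F, |ε k| < 1 := by
            have := Metric.tendsto_nhds.1 hε 1 one_pos
            simpa [Real.dist_eq] using this
          filter_upwards [hu, hE φ hφr, hε1] with k hk hk2 hk3
          have ihv : Integrable (fun x => ((V x + ε k) * φ x - lap φ x) * v k x) := by
            have e : (fun x => ((V x + ε k) * φ x - lap φ x) * v k x)
                = fun x => (h x + ε k * φ x) * v k x := by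
              funext x; simp only [hh]; ring
            rw [e]
            exact int_cu (hhc.add (continuous_const.mul (test_cont hφ)))
              (hhs.add (hφ.2.1.mul_left (f := fun _ => ε k))) (hI k)
          have e1 : ∫ x, h x * W x = (∫ x, ((h x * W x + ε k * (φ x * W x))
              - ((V x + ε k) * φ x - lap φ x) * v k x)) - ε k * ∫ x, φ x * W x := by
            have i2 : Integrable (fun x => h x * W x + ε k * (φ x * W x)) :=
              ihW.add (iφW.const_mul _)
            rw [integral_sub i2 ihv, hk2, integral_add ihW (iφW.const_mul _), integral_const_mul]
            ring
          rw [e1]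
          refine (abs_sub _ _).trans (add_le_add ?_ (abs_mul _ _).le)
          rw [← integral_const_mul]
          refine (abs_integral_le_integral_abs).trans (integral_mono_of_nonneg
            (Eventually.of_forall fun _ => abs_nonneg _) (iA.const_mul _)
            (Eventually.of_forall fun x => ?_))
          show |h x * W x + ε k * (φ x * W x) - ((V x + ε k) * φ x - lap φ x) * v k x|
            ≤ η * (|h x| + |φ x|)
          have e2 : h x * W x + ε k * (φ x * W x) - ((V x + ε k) * φ x - lap φ x) * v k x
            = (h x + ε k * φ x) * (W x - v k x) := by simp only [hh]; ring
          rw [e2]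
          by_cases hx : x ∈ K
          · rw [hW, indicator_of_mem hx, abs_mul, mul_comm]
            refine mul_le_mul (hk x hx) ?_ (abs_nonneg _) hη.le
            refine (abs_add_le _ _).trans ?_
            rw [abs_mul]
            nlinarith [abs_nonneg (φ x)]
          · simp [hh0 x hx, hφ0 x hx]
        simpa using hlim2
      have hA : 0 ≤ ∫ x, (|h x| + |φ x|) := integral_nonneg fun x => by positivity
      by_contra hne
      have hpos := abs_pos.2 hne
      have := key (|∫ x, h x * W x| / (2 * ((∫ x, (|h x| + |φ x|)) + 1))) (by positivity)
      set I := |∫ x, h x * W x|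
      set A := ∫ x, (|h x| + |φ x|)
      rw [div_mul_eq_mul_div, le_div_iff₀ (by positivity)] at this
      nlinarith
    have iG' : Integrable (fun x => (V x * φ x) * W x) := int_cu hVφ hφ.2.1.mul_left iW
    have il' : Integrable (fun x => lap φ x * W x) := int_cu (test_cont hl) hl.2.1 iW
    have e3 : ∫ x, h x * W x = (∫ x, (V x * φ x) * W x) - ∫ x, lap φ x * W x := by
      rw [← integral_sub iG' il']
      congr 1; funext x; simp only [hh]; ring
    rw [main] at e3
    have e4 : ∫ y, W y * lap φ y = ∫ x, lap φ x * W x := by simp_rw [mul_comm]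
    have e5 : ∫ y, G y * φ y = ∫ x, (V x * φ x) * W x := by
      congr 1; funext x
      by_cases hx : x ∈ K
      · simp only [hG, hW, indicator_of_mem hx]; ring
      · simp [hφ0 x hx]
    rw [e4, e5]; linarith
  have hreg := regularity Metric.isOpen_ball hwl
    ((hwc.mono (hBK.trans hKb)).congr hWB) (Metric.mem_ball_self hR) (by
      obtain ⟨Bw, hBw⟩ := hKc.exists_bound_of_continuousOn (hwc.mono hKb)
      obtain ⟨BV, hBV⟩ := hKc.exists_bound_of_continuousOn (hVc.mono (hKb.trans hrΩ))
      refine ⟨R, |CV| * |Bw| + |BV| * |C|, min α β, hR, lt_min hα hβ, fun y hy z hz => ?_⟩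
      have hyK := hBK hy
      have hzK := hBK hz
      have hd1 : ‖y - z‖ ≤ 1 := by
        rw [← dist_eq_norm]
        rw [Metric.mem_ball] at hy hz
        linarith [dist_triangle_right y z p]
      have hd0 := norm_nonneg (y - z)
      have hm : 0 < min α β := lt_min hα hβ
      have b1 := rpow_min_bound hd0 hd1 hm (min_le_left α β)
      have b2 := rpow_min_bound hd0 hd1 hm (min_le_right α β)
      have c1 := hCV y ⟨hr1U (Metric.ball_subset_ball hRr1 hy), hrΩ (hKb hyK)⟩ z
        ⟨hr1U (Metric.ball_subset_ball hRr1 hz), hrΩ (hKb hzK)⟩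
      have c2 := hwH y (hKb hyK) z (hKb hzK)
      rw [dist_eq_norm] at c2
      have d1 : |V y - V z| ≤ |CV| * ‖y - z‖ ^ min α β :=
        c1.trans (mul_le_mul (le_abs_self _) b1 (by positivity) (abs_nonneg _))
      have d2 : |w y - w z| ≤ |C| * ‖y - z‖ ^ min α β :=
        c2.trans (mul_le_mul (le_abs_self _) b2 (by positivity) (abs_nonneg _))
      have d3 : |w y| ≤ |Bw| := (hBw y hyK).trans (le_abs_self _)
      have d4 : |V z| ≤ |BV| := (hBV z hzK).trans (le_abs_self _)
      rw [hG, indicator_of_mem hyK, indicator_of_mem hzK]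
      have e : V y * w y - V z * w z = (V y - V z) * w y + V z * (w y - w z) := by ring
      rw [e]
      refine (abs_add_le _ _).trans ?_
      rw [abs_mul, abs_mul]
      have f1 := mul_le_mul d1 d3 (abs_nonneg _) (by positivity)
      have f2 := mul_le_mul d4 d2 (abs_nonneg _) (by positivity)
      nlinarith)
  have hev : W =ᶠ[𝓝 p] w := hWB.eventuallyEq_of_mem (Metric.ball_mem_nhds p hR)
  refine ⟨hreg.1.congr_of_eventuallyEq hev.symm, ?_⟩
  rw [← lap_congr hev, hreg.2, hG, indicator_of_mem (hBK (Metric.mem_ball_self hR))]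

end AAP

namespace AAP
open Filter Topology Set

lemma exists_escape {n : ℕ} (hn : 1 ≤ n) {Ω : Set (EE n)} (hΩ : IsOpen Ω) (hne : Ω.Nonempty) :
    ∃ x : ℕ → EE n, (∀ k, x k ∈ Ω) ∧
      ∀ p ∈ Ω, ∃ ρ : ℝ, 0 < ρ ∧ ∀ᶠ k in atTop, ρ ≤ dist p (x k) := by
  by_cases hu : Ω = univ
  · refine ⟨fun k => EuclideanSpace.single ⟨0, hn⟩ (k : ℝ), fun k => by simp [hu],
      fun p _ => ⟨1, one_pos, ?_⟩⟩
    filter_upwards [tendsto_natCast_atTop_atTop.eventually_ge_atTop (1 + ‖p‖)] with k hk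
    have h1 : ‖(EuclideanSpace.single ⟨0, hn⟩ (k : ℝ) : EE n)‖ = k := by simp
    have h2 := norm_sub_norm_le (EuclideanSpace.single ⟨0, hn⟩ (k : ℝ) : EE n) p
    rw [h1] at h2
    rw [dist_comm, dist_eq_norm]
    linarith
  · obtain ⟨z, hz⟩ : (frontier Ω).Nonempty := nonempty_frontier_iff.2 ⟨hne, hu⟩
    have hzΩ : z ∉ Ω := by
      rw [hΩ.frontier_eq] at hz
      exact hz.2
    have hzc : z ∈ closure Ω := frontier_subset_closure hz
    obtain ⟨x, hx, hxz⟩ := mem_closure_iff_seq_limit.1 hzc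
    refine ⟨x, hx, fun p hp => ?_⟩
    have hd : 0 < dist p z := dist_pos.2 fun h => hzΩ (h ▸ hp)
    refine ⟨dist p z / 2, by positivity, ?_⟩
    have : Tendsto (fun k => dist p (x k)) atTop (𝓝 (dist p z)) := tendsto_const_nhds.dist hxz
    exact (this.eventually (lt_mem_nhds (by linarith))).mono fun k hk => le_of_lt hk

lemma exists_bumps {n : ℕ} (hn : 1 ≤ n) {Ω : Set (EE n)} (hΩ : IsOpen Ω) (hne : Ω.Nonempty) :
    ∃ f : ℕ → EE n → ℝ, (∀ k, IsTestFun Ω (f k)) ∧ (∀ k x, 0 ≤ f k x) ∧ (∀ k, ∃ x, 0 < f k x) ∧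
      ∀ p ∈ Ω, ∃ ρ : ℝ, 0 < ρ ∧ ∀ᶠ k in atTop, ∀ x ∈ Metric.ball p ρ, f k x = 0 := by
  obtain ⟨x, hx, hesc⟩ := exists_escape hn hΩ hne
  have h1 : ∀ k : ℕ, ∃ f : EE n → ℝ, IsTestFun Ω f ∧ (∀ y, 0 ≤ f y) ∧ 0 < f (x k) ∧
      ∀ y, f y ≠ 0 → dist y (x k) ≤ 1 / ((k:ℝ) + 1) := by
    intro k
    obtain ⟨ρ, hρ, hρΩ⟩ := Metric.nhds_basis_closedBall.mem_iff.1 (hΩ.mem_nhds (hx k))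
    have hm : 0 < min ρ (1 / ((k:ℝ) + 1)) := by positivity
    let b : ContDiffBump (x k) := ⟨min ρ (1 / ((k:ℝ) + 1)) / 2, min ρ (1 / ((k:ℝ) + 1)),
      by positivity, by linarith⟩
    refine ⟨b, ⟨b.contDiff, b.hasCompactSupport, ?_⟩, fun y => b.nonneg, ?_, ?_⟩
    · rw [b.tsupport_eq]
      exact (Metric.closedBall_subset_closedBall (min_le_left _ _)).trans hρΩ
    · exact b.pos_of_mem_ball (Metric.mem_ball_self b.rOut_pos)
    · intro y hy
      have : y ∈ Function.support b := hy
      rw [b.support_eq] at this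
      exact (le_of_lt (Metric.mem_ball.1 this)).trans (min_le_right _ _)
  choose f hf hf0 hfp hfs using h1
  refine ⟨f, hf, hf0, fun k => ⟨x k, hfp k⟩, fun p hp => ?_⟩
  obtain ⟨ρ, hρ, hev⟩ := hesc p hp
  refine ⟨ρ / 2, by positivity, ?_⟩
  filter_upwards [hev, tendsto_one_div_add_atTop_nhds_zero_nat.eventually
    (gt_mem_nhds (show (0:ℝ) < ρ / 2 by positivity))] with k hk hk2 y hy
  by_contra hne
  have := hfs k y hne
  rw [Metric.mem_ball, dist_comm] at hy
  linarith [dist_triangle p y (x k)]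

/-- The approximating sequence. -/
structure Seq {n : ℕ} (Ω : Set (EE n)) (V : EE n → ℝ) (f u : ℕ → EE n → ℝ) : Prop where
  sol : ∀ k : ℕ, Sol Ω (fun x => V x + 1 / ((k:ℝ) + 1)) (f k) (u k)
  pos : ∀ k, ∀ x ∈ Ω, Pos (u k) x
  van : ∀ p ∈ Ω, ∃ ρ : ℝ, 0 < ρ ∧ ∀ᶠ k in atTop, ∀ x ∈ Metric.ball p ρ, f k x = 0

lemma exists_seq {n : ℕ} (hn : 1 ≤ n) {Ω : Set (EE n)} (hΩ : IsOpen Ω) (hc : IsConnected Ω)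
    {V : EE n → ℝ} (hV : ContinuousOn V Ω) (hQ : ∀ φ, IsTestFun Ω φ → 0 ≤ BB V φ φ) :
    ∃ f u, Seq Ω V f u := by
  obtain ⟨f, hf, hf0, hfp, hfv⟩ := exists_bumps hn hΩ hc.nonempty
  have h1 : ∀ k : ℕ, ∃ u, Sol Ω (fun x => V x + 1 / ((k:ℝ) + 1)) (f k) u := by
    intro k
    have hq : ∀ φ, IsTestFun Ω φ → 1 / ((k:ℝ) + 1) * ∫ x, φ x * φ x
        ≤ BB (fun x => V x + 1 / ((k:ℝ) + 1)) φ φ := by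
      intro φ hφ
      have e : BB (fun x => V x + 1 / ((k:ℝ) + 1)) φ φ
          = BB V φ φ + 1 / ((k:ℝ) + 1) * ∫ x, φ x * φ x := by
        unfold BB
        rw [← integral_const_mul, ← integral_add (int_BB hΩ hV hφ hφ)
          ((int_mul_test (test_cont hφ) hφ).const_mul _)]
        congr 1; funext x; ring
      rw [e]
      linarith [hQ φ hφ]
    obtain ⟨u, h1, h2, h3⟩ := exists_weak hΩ (W := fun x => V x + 1 / ((k:ℝ) + 1)) (f := f k)
      (hV.add continuousOn_const) (ε := 1 / ((k:ℝ) + 1)) (by positivity) hq (hf k) (hf0 k)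
    exact ⟨u, h1, h2, test_cont (hf k), hf0 k, h3⟩
  choose u hu using h1
  refine ⟨f, u, hu, fun k => ?_, hfv⟩
  obtain ⟨x1, hx1⟩ := hfp k
  exact (hu k).pos_all hΩ hc.isPreconnected (hV.add continuousOn_const) (hf k) hx1

lemma Seq.loc {n : ℕ} {Ω : Set (EE n)} (hΩ : IsOpen Ω) {V : EE n → ℝ} (hV : ContinuousOn V Ω)
    {f u : ℕ → EE n → ℝ} (h : Seq Ω V f u) {p : EE n} (hp : p ∈ Ω) :
    ∃ r M : ℝ, 0 < r ∧ Metric.closedBall p (9*r) ⊆ Ω ∧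
      (∀ᶠ k in atTop, ∃ g, Loc (Metric.ball p (9*r)) (u k) g M) ∧
      ∀ᶠ k in atTop, ∀ x ∈ Metric.ball p (9*r), f k x = 0 := by
  obtain ⟨ρ1, hρ1, hρ1Ω⟩ := Metric.nhds_basis_closedBall.mem_iff.1 (hΩ.mem_nhds hp)
  obtain ⟨ρ2, hρ2, hev⟩ := h.van p hp
  obtain ⟨M, hM⟩ := (isCompact_closedBall p ρ1).exists_bound_of_continuousOn (hV.mono hρ1Ω)
  have hr : 0 < min ρ1 ρ2 / 9 := by positivity
  have e : 9 * (min ρ1 ρ2 / 9) = min ρ1 ρ2 := by ring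
  refine ⟨min ρ1 ρ2 / 9, M + 1, hr, ?_⟩
  rw [e]
  have h1 : Metric.closedBall p (min ρ1 ρ2) ⊆ Ω :=
    (Metric.closedBall_subset_closedBall (min_le_left _ _)).trans hρ1Ω
  have hev2 : ∀ᶠ k in atTop, ∀ x ∈ Metric.ball p (min ρ1 ρ2), f k x = 0 := by
    filter_upwards [hev] with k hk x hx
    exact hk x (Metric.ball_subset_ball (min_le_right _ _) hx)
  have hM0 : 0 ≤ M := (norm_nonneg _).trans (hM p (Metric.mem_closedBall_self hρ1.le))
  refine ⟨h1, ?_, hev2⟩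
  filter_upwards [hev2] with k hk
  refine ⟨_, (h.sol k).toLoc hΩ (hV.add continuousOn_const) (by linarith) h1 ?_ hk⟩
  intro x hx
  have a1 := hM x (Metric.closedBall_subset_closedBall (min_le_left _ _)
    (Metric.ball_subset_closedBall hx))
  have a2 : |1 / ((k:ℝ) + 1)| ≤ 1 := by
    rw [abs_of_pos (by positivity), div_le_one (by positivity)]
    linarith [(Nat.cast_nonneg k : (0:ℝ) ≤ k)]
  exact (abs_add_le _ _).trans (add_le_add a1 a2)

lemma Seq.uhat_pos {n : ℕ} {Ω : Set (EE n)} (hΩ : IsOpen Ω) {V : EE n → ℝ}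
    (hV : ContinuousOn V Ω)
    {f u : ℕ → EE n → ℝ} (h : Seq Ω V f u) {p : EE n} (hp : p ∈ Ω) :
    ∀ᶠ k in atTop, 0 < uhat (u k) p := by
  obtain ⟨r, M, hr, -, hl, -⟩ := h.loc hΩ hV hp
  obtain ⟨C, hC, hm⟩ := mass_le_uhat n (M := M) hr
  filter_upwards [hl] with k ⟨g, hk⟩
  have h1 := hm _ _ _ p hk (Metric.ball_subset_ball (by linarith))
  exact pos_of_mul_pos_right ((h.pos k p hp (3*r) (by positivity)).trans_le h1) hC.le

lemma Seq.chain {n : ℕ} {Ω : Set (EE n)} (hΩ : IsOpen Ω) (hc : IsPreconnected Ω) {V : EE n → ℝ}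
    (hV : ContinuousOn V Ω)
    {f u : ℕ → EE n → ℝ} (h : Seq Ω V f u) {x y : EE n} (hx : x ∈ Ω) (hy : y ∈ Ω) :
    ∃ C : ℝ, 0 < C ∧ ∀ᶠ k in atTop, uhat (u k) x ≤ C * uhat (u k) y := by
  refine hc.induction₂' (fun x y => ∃ C : ℝ, 0 < C ∧ ∀ᶠ k in atTop, uhat (u k) x ≤ C * uhat (u k) y)
    (fun p hp => ?_) (fun a b c _ _ _ h1 h2 => ?_) hx hy
  · obtain ⟨r, M, hr, -, hl, -⟩ := h.loc hΩ hV hp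
    obtain ⟨C, hC, hm⟩ := harnack n (M := M) hr
    filter_upwards [mem_nhdsWithin_of_mem_nhds (Metric.ball_mem_nhds p hr)] with z hz
    rw [Metric.mem_ball] at hz
    have b1 : Metric.ball p (8*r) ⊆ Metric.ball p (9*r) := Metric.ball_subset_ball (by linarith)
    have b2 : Metric.ball z (8*r) ⊆ Metric.ball p (9*r) := Metric.ball_subset_ball' (by linarith)
    refine ⟨⟨C, hC, ?_⟩, ⟨C, hC, ?_⟩⟩
    · filter_upwards [hl] with k ⟨g, hk⟩
      exact hm _ _ _ p z hk b1 b2 (by rw [dist_comm]; linarith)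
    · filter_upwards [hl] with k ⟨g, hk⟩
      exact hm _ _ _ z p hk b2 b1 (by linarith)
  · obtain ⟨C1, hC1, e1⟩ := h1
    obtain ⟨C2, hC2, e2⟩ := h2
    refine ⟨C1 * C2, by positivity, ?_⟩
    filter_upwards [e1, e2] with k k1 k2
    rw [mul_assoc]
    exact k1.trans (mul_le_mul_of_nonneg_left k2 hC1.le)

lemma exists_solution {n : ℕ} (hn : 1 ≤ n) {Ω : Set (EE n)} (hΩ : IsOpen Ω) (hc : IsConnected Ω)
    {V : EE n → ℝ} (hV : LocallyHolderOn Ω V) (hQ : ∀ φ, IsTestFun Ω φ → 0 ≤ BB V φ φ) :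
    ∃ w : EE n → ℝ, (∀ x ∈ Ω, 0 < w x) ∧
      ∀ p ∈ Ω, ContDiffAt ℝ 2 w p ∧ lap w p = V p * w p := by
  have hVc := LocallyHolderOn.continuousOn hV
  obtain ⟨f, u, h⟩ := exists_seq hn hΩ hc hVc hQ
  obtain ⟨x0, hx0⟩ := hc.nonempty
  have hp0 := h.uhat_pos hΩ hVc hx0
  set v : ℕ → EE n → ℝ := fun k x => uhat (u k) x / uhat (u k) x0 with hv
  set F : Ultrafilter ℕ := hyperfilter ℕ with hF
  have hFt : (F : Filter ℕ) ≤ atTop := by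
    rw [← Nat.cofinite_eq_atTop]; exact hyperfilter_le_cofinite
  have hbd : ∀ x ∈ Ω, ∃ c C : ℝ, 0 < c ∧ ∀ᶠ k in atTop, v k x ∈ Icc c C := by
    intro x hx
    obtain ⟨C1, hC1, e1⟩ := h.chain hΩ hc.isPreconnected hVc hx hx0
    obtain ⟨C2, hC2, e2⟩ := h.chain hΩ hc.isPreconnected hVc hx0 hx
    refine ⟨C2⁻¹, C1, by positivity, ?_⟩
    filter_upwards [e1, e2, hp0] with k k1 k2 k3
    refine ⟨?_, (div_le_iff₀ k3).2 k1⟩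
    rw [hv, le_div_iff₀ k3, inv_mul_le_iff₀ hC2]
    exact k2
  have hlim : ∀ x, ∃ c : ℝ, x ∈ Ω → 0 < c ∧ Tendsto (fun k => v k x) F (𝓝 c) := by
    intro x
    by_cases hx : x ∈ Ω
    · obtain ⟨c, C, hc0, hev⟩ := hbd x hx
      obtain ⟨a, ha, hle⟩ := (isCompact_Icc (a := c) (b := C)).ultrafilter_le_nhds
        (F.map fun k => v k x) (by
          rw [le_principal_iff]
          exact hev.filter_mono hFt)
      exact ⟨a, fun _ => ⟨hc0.trans_le ha.1, hle⟩⟩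
    · exact ⟨0, fun h => absurd h hx⟩
  choose w hw using hlim
  refine ⟨w, fun x hx => (hw x hx).1, fun p hp => ?_⟩
  obtain ⟨r, M, hr, hrΩ, hl, hf⟩ := h.loc hΩ hVc hp
  obtain ⟨C, h0, hC, hh0, hH⟩ := holder n (M := M) hr
  obtain ⟨c, C', hc0, hev⟩ := hbd p hp
  set R := min r (h0 / 2) with hR
  have hRr : R ≤ r := min_le_left _ _
  have hRh : R ≤ h0/2 := min_le_right _ _
  have hb9 : Metric.ball p R ⊆ Metric.ball p (9*r) := Metric.ball_subset_ball (by linarith)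
  have hbΩ : Metric.ball p R ⊆ Ω := hb9.trans (Metric.ball_subset_closedBall.trans hrΩ)
  have hε : Tendsto (fun k : ℕ => 1 / ((k:ℝ) + 1)) F (𝓝 0) :=
    tendsto_one_div_add_atTop_nhds_zero_nat.mono_left hFt
  have hI : ∀ k, LocallyIntegrable (v k) volume := by
    intro k
    have h1 : LocallyIntegrable (fun x => (uhat (u k) x0)⁻¹ * u k x) volume := by
      exact (h.sol k).iu.smul ((uhat (u k) x0)⁻¹)
    have h2 : (fun x => (uhat (u k) x0)⁻¹ * u k x) =ᵐ[volume] v k := by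
      filter_upwards [uhat_ae (h.sol k).iu] with x hx
      rw [hv]; simp only [hx]; ring
    intro x
    exact (h1 x).congr h2
  refine limit_local hΩ hV (F := (F : Filter ℕ)) (v := v) (w := w) hε (p := p) (r := R)
    (C := C * C') (β := (((n+2 : ℕ) : ℝ))⁻¹) (by positivity) (by positivity) hbΩ ?_
    (fun x hx => (hw x (hbΩ hx)).2) hI ?_
  · refine Eventually.filter_mono hFt ?_
    filter_upwards [hl, hev, hp0] with k ⟨g, hk⟩ hk2 hk3 x hx y hy
    have hd : dist x y ≤ h0 := by
      rw [Metric.mem_ball] at hx hy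
      linarith [dist_triangle_right x y p]
    have h1 := hH _ _ _ p x y hk subset_rfl (Metric.ball_subset_ball hRr hx)
      (Metric.ball_subset_ball hRr hy) hd
    have e : v k x - v k y = (uhat (u k) x - uhat (u k) y) / uhat (u k) x0 := by
      rw [hv]; ring
    rw [e, abs_div, abs_of_pos hk3, div_le_iff₀ hk3]
    refine h1.trans ?_
    have h2 : uhat (u k) p ≤ C' * uhat (u k) x0 := (div_le_iff₀ hk3).1 hk2.2
    have h3 : 0 ≤ dist x y ^ (((n+2 : ℕ) : ℝ))⁻¹ := by positivity
    calc C * uhat (u k) p * dist x y ^ (((n+2 : ℕ) : ℝ))⁻¹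
        ≤ C * (C' * uhat (u k) x0) * dist x y ^ (((n+2 : ℕ) : ℝ))⁻¹ := by gcongr
      _ = _ := by ring
  · intro φ hφ
    refine Eventually.filter_mono hFt ?_
    filter_upwards [hf] with k hk
    have h1 := (h.sol k).eq φ ⟨hφ.1, hφ.2.1, hφ.2.2.trans hbΩ⟩
    have h2 : ∫ x, f k x * φ x = 0 := by
      refine integral_eq_zero_of_ae (Eventually.of_forall fun x => ?_)
      by_cases hx : x ∈ tsupport φ
      · simp [hk x (hb9 (hφ.2.2 hx))]
      · simp [image_eq_zero_of_notMem_tsupport hx]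
    rw [h2] at h1
    have h3 : ∫ x, ((V x + 1 / ((k:ℝ) + 1)) * φ x - lap φ x) * v k x
        = ∫ x, (uhat (u k) x0)⁻¹ * (((V x + 1 / ((k:ℝ) + 1)) * φ x - lap φ x) * u k x) := by
      refine integral_congr_ae ?_
      filter_upwards [uhat_ae (h.sol k).iu] with x hx
      rw [hv]; simp only [hx]; ring
    rw [h3, integral_const_mul, h1, mul_zero]

end AAP

namespace AAP
open Filter Topology Set

lemma contDiff_mul {n : ℕ} {Ω : Set (EE n)} {h φ : EE n → ℝ}
    (hh : ∀ x ∈ Ω, ContDiffAt ℝ 1 h x) (hφ : ContDiff ℝ 1 φ) (hs : tsupport φ ⊆ Ω) :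
    ContDiff ℝ 1 (fun x => h x * φ x) := by
  rw [contDiff_iff_contDiffAt]
  intro x
  by_cases hx : x ∈ Ω
  · exact (hh x hx).mul hφ.contDiffAt
  · have hx' : x ∉ tsupport φ := fun h => hx (hs h)
    have h0 : (fun x => h x * φ x) =ᶠ[𝓝 x] fun _ => 0 := by
      filter_upwards [notMem_tsupport_iff_eventuallyEq.1 hx'] with y hy
      rw [hy]; simp
    exact contDiffAt_const.congr_of_eventuallyEq h0

lemma pd_quot {n : ℕ} {u φ : EE n → ℝ} {x : EE n} (hu : ContDiffAt ℝ 2 u x) (hux : 0 < u x)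
    (hφ : DifferentiableAt ℝ φ x) (i : Fin n) (hd : DifferentiableAt ℝ (pd i u) x) :
    pd i (fun y => (pd i u y / u y) * (φ y * φ y)) x =
      2 * φ x * pd i φ x * (pd i u x / u x) + φ x ^ 2 * (pd i (pd i u) x / u x)
        - φ x ^ 2 * (pd i u x / u x)^2 := by
  have h1 : HasFDerivAt (pd i u) (fderiv ℝ (pd i u) x) x := hd.hasFDerivAt
  have h2 : HasFDerivAt u (fderiv ℝ u x) x := (hu.differentiableAt (by simp)).hasFDerivAt
  have h3 : HasFDerivAt φ (fderiv ℝ φ x) x := hφ.hasFDerivAt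
  have h4 := (h1.mul ((hasDerivAt_inv hux.ne').comp_hasFDerivAt x h2)).mul (h3.mul h3)
  have e : (fun y => (pd i u y / u y) * (φ y * φ y)) =
    ((pd i u * (Inv.inv ∘ u)) * (φ * φ)) := by
    funext y; simp [div_eq_mul_inv]
  rw [pd, e, h4.fderiv]
  simp only [_root_.add_apply, _root_.smul_apply, smul_eq_mul, Pi.mul_apply, Function.comp]
  change _ = 2 * φ x * pd i φ x * (pd i u x / u x) + φ x ^ 2 * (pd i (pd i u) x / u x)
        - φ x ^ 2 * (pd i u x / u x)^2
  change (pd i u x * (u x)⁻¹) * (φ x * pd i φ x + φ x * pd i φ x) + φ x * φ x *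
    (pd i u x * (-(u x ^ 2)⁻¹ * pd i u x) + (u x)⁻¹ * pd i (pd i u) x) = _
  field_simp
  ring

lemma easy {n : ℕ} {Ω : Set (EE n)} (hΩ : IsOpen Ω) {V u : EE n → ℝ} (hV : ContinuousOn V Ω)
    (hu : ContDiffOn ℝ 2 u Ω) (hpos : ∀ x ∈ Ω, 0 < u x)
    (heq : ∀ x ∈ Ω, -lap u x + V x * u x = 0) {φ : EE n → ℝ} (hφ : IsTestFun Ω φ) :
    0 ≤ BB V φ φ := by
  have hua : ∀ x ∈ Ω, ContDiffAt ℝ 2 u x := fun x hx => hu.contDiffAt (hΩ.mem_nhds hx)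
  have hpa : ∀ i, ∀ x ∈ Ω, ContDiffAt ℝ 1 (pd i u) x := fun i x hx => by
    unfold pd
    exact ((hua x hx).fderiv_right (m := 1) (by norm_num)).clm_apply contDiffAt_const
  have hφ1 : ContDiff ℝ 1 φ := hφ.1.of_le (by simp)
  set G : Fin n → EE n → ℝ := fun i y => (pd i u y / u y) * (φ y * φ y) with hG
  have hsq : tsupport (fun y => φ y * φ y) ⊆ Ω := (tsupport_mul_subset_left).trans hφ.2.2
  have hGc : ∀ i, ContDiff ℝ 1 (G i) := fun i =>
    contDiff_mul (fun x hx => (hpa i x hx).div ((hua x hx).of_le (by norm_num)) (hpos x hx).ne')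
      (hφ1.mul hφ1) hsq
  have hGs : ∀ i, HasCompactSupport (G i) := fun i =>
    HasCompactSupport.mul_left (f := fun y => pd i u y / u y) (hφ.2.1.mul_left (f := φ))
  have hGi : ∀ i, Integrable (pd i (G i)) := fun i => by
    have hcont : Continuous (pd i (G i)) :=
      ((hGc i).continuous_fderiv (by simp)).clm_apply continuous_const
    exact hcont.integrable_of_hasCompactSupport
      (HasCompactSupport.mono' (hGs i) ((subset_tsupport _).trans (pd_tsupport i (G i))))
  have iS : Integrable (fun x => ∑ i, pd i (G i) x) := integrable_finsetSum _ fun i _ => hGi i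
  have zS : ∫ x, ∑ i, pd i (G i) x = 0 := by
    rw [integral_finsetSum _ fun i _ => hGi i]
    exact Finset.sum_eq_zero fun i _ => integral_pd_zero i (hGc i) (hGs i)
  have e : BB V φ φ = ∫ x, (((∑ i, pd i φ x * pd i φ x) + V x * (φ x * φ x))
      - ∑ i, pd i (G i) x) := by
    rw [integral_sub (int_BB hΩ hV hφ hφ) iS, zS, sub_zero]; rfl
  rw [e]
  refine integral_nonneg fun x => ?_
  show 0 ≤ (((∑ i, pd i φ x * pd i φ x) + V x * (φ x * φ x)) - ∑ i, pd i (G i) x)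
  by_cases hx : x ∈ Ω
  · have h1 : ∀ i, pd i (G i) x = 2 * φ x * pd i φ x * (pd i u x / u x)
        + φ x ^ 2 * (pd i (pd i u) x / u x) - φ x ^ 2 * (pd i u x / u x)^2 := fun i =>
      pd_quot (hua x hx) (hpos x hx) (diff_of_smooth hφ.1 x) i
        ((hpa i x hx).differentiableAt (by simp))
    have h2 : V x * (φ x * φ x) = ∑ i, φ x ^ 2 * (pd i (pd i u) x / u x) := by
      rw [← Finset.mul_sum, ← Finset.sum_div, ← lap_eq]
      have h3 : lap u x = V x * u x := by linarith [heq x hx]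
      rw [h3, mul_div_assoc, div_self (hpos x hx).ne']; ring
    rw [h2, ← Finset.sum_add_distrib, ← Finset.sum_sub_distrib]
    refine Finset.sum_nonneg fun i _ => ?_
    rw [h1]
    nlinarith [sq_nonneg (pd i φ x - φ x * (pd i u x / u x))]
  · have hφx : φ x = 0 := image_eq_zero_of_notMem_tsupport fun h => hx (hφ.2.2 h)
    have hGx : ∀ i, pd i (G i) x = 0 := fun i => by
      refine image_eq_zero_of_notMem_tsupport fun h => hx ?_
      exact hsq (tsupport_mul_subset_right (pd_tsupport i (G i) h))
    simp only [hφx, hGx]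
    simp only [mul_zero, Finset.sum_const_zero, add_zero, sub_zero]
    exact Finset.sum_nonneg fun i _ => mul_self_nonneg _

end AAP

/-- Agmon–Allegretto–Piepenbrink theorem. -/
theorem aap {n : ℕ} (hn : 1 ≤ n) (Ω : Set (EuclideanSpace ℝ (Fin n)))
    (hΩo : IsOpen Ω) (hΩc : IsConnected Ω)
    (V : EuclideanSpace ℝ (Fin n) → ℝ) (hV : LocallyHolderOn Ω V) :
    (∀ φ : EuclideanSpace ℝ (Fin n) → ℝ, IsTestFun Ω φ →
      0 ≤ ∫ x in Ω, (‖gradient φ x‖ ^ 2 + V x * (φ x) ^ 2)) ↔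
    ∃ u : EuclideanSpace ℝ (Fin n) → ℝ, ContDiffOn ℝ 2 u Ω ∧ (∀ x ∈ Ω, 0 < u x) ∧
      ∀ x ∈ Ω, -lap u x + V x * u x = 0 := by
  constructor
  · intro h
    obtain ⟨w, hw, hw2⟩ := AAP.exists_solution hn hΩo hΩc hV fun φ hφ => by
      rw [← AAP.BB_eq_set V hφ]
      exact h φ hφ
    exact ⟨w, fun x hx => (hw2 x hx).1.contDiffWithinAt, hw, fun x hx => by
      rw [(hw2 x hx).2]; ring⟩
  · rintro ⟨u, hu, hpos, heq⟩ φ hφ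
    rw [AAP.BB_eq_set V hφ]
    exact AAP.easy hΩo (AAP.LocallyHolderOn.continuousOn hV) hu hpos heq hφ
end
end

section
/- Spherical-slice inequality implies a Hardy inequality in the cone (Proposition 5.1 via Remark 5.3): let n ≥ 2, let Σ be a nonempty open subset of the unit sphere S^{n−1} ⊆ ℝⁿ, and let Ω := {rω : r > 0, ω ∈ Σ} be the open cone over Σ. Let μ, σ ∈ ℝ. For φ ∈ C_c^∞(Ω) and r > 0 define g_{r,φ} : ℝⁿ ∖ {0} → ℝ by g_{r,φ}(x) := φ(r x/|x|) (a smooth 0-homogeneous function). Assume that for every φ ∈ C_c^∞(Ω) and every r > 0 one has ∫_Σ ( |∇g_{r,φ}(ω)|² − μ g_{r,φ}(ω)²/δ_Ω(ω)² − σ g_{r,φ}(ω)² ) dH^{n−1}(ω) ≥ 0, where H^{n−1} is the (n−1)-dimensional Hausdorff measure on S^{n−1}. Then for every φ ∈ C_c^∞(Ω): ∫_Ω |∇φ(x)|² dx − μ ∫_Ω φ(x)²/δ_Ω(x)² dx ≥ ((n−2)²/4 + σ) ∫_Ω φ(x)²/|x|² dx. -/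
open MeasureTheory

noncomputable section

lemma christensen {X : Type*} [MetricSpace X] [CompactSpace X] [MeasurableSpace X] [BorelSpace X]
    [Nonempty X] (ν₁ ν₂ : Measure X) [IsFiniteMeasure ν₁] [IsFiniteMeasure ν₂]
    [ν₂.IsOpenPosMeasure] (h1 : ∀ x y r, ν₁ (Metric.ball x r) = ν₁ (Metric.ball y r))
    (h2 : ∀ x y r, ν₂ (Metric.ball x r) = ν₂ (Metric.ball y r)) (hν : ν₁ Set.univ ≠ 0) :
    ∃ c : ℝ, 0 < c ∧ ∀ f : X → ℝ, Continuous f → ∫ x, f x ∂ν₁ = c * ∫ x, f x ∂ν₂ := by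
  have hM1 : 0 < ν₁.real Set.univ := by
    rw [measureReal_def]; exact ENNReal.toReal_pos hν (measure_ne_top _ _)
  have hM2 : 0 < ν₂.real Set.univ := by
    rw [measureReal_def]
    exact ENNReal.toReal_pos (isOpen_univ.measure_ne_zero _ Set.univ_nonempty) (measure_ne_top _ _)
  obtain ⟨x0⟩ := ‹Nonempty X›
  refine ⟨ν₁.real Set.univ / ν₂.real Set.univ, by positivity, fun f hf => ?_⟩
  -- the kernel identity
  have key : ∀ δ > 0, ∀ f : X → ℝ, Continuous f →
      Integrable (fun p : X × X => (Metric.ball p.1 δ).indicator (fun _ => f p.1) p.2) (ν₁.prod ν₂) ∧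
      Integrable (fun p : X × X => (Metric.ball p.1 δ).indicator (fun _ => f p.2) p.2) (ν₁.prod ν₂) ∧
      ∫ p : X × X, (Metric.ball p.1 δ).indicator (fun _ => f p.1) p.2 ∂(ν₁.prod ν₂)
        = ν₂.real (Metric.ball x0 δ) * ∫ x, f x ∂ν₁ ∧
      ∫ p : X × X, (Metric.ball p.1 δ).indicator (fun _ => f p.2) p.2 ∂(ν₁.prod ν₂)
        = ν₁.real (Metric.ball x0 δ) * ∫ x, f x ∂ν₂ := by
    intro δ hδ f hf
    have hS : MeasurableSet {p : X × X | dist p.2 p.1 < δ} :=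
      (isOpen_lt (by fun_prop) (by fun_prop)).measurableSet
    have e1 : (fun p : X × X => (Metric.ball p.1 δ).indicator (fun _ => f p.1) p.2)
        = {p : X × X | dist p.2 p.1 < δ}.indicator (fun p => f p.1) := by
      ext p; simp [Set.indicator]
    have e2 : (fun p : X × X => (Metric.ball p.1 δ).indicator (fun _ => f p.2) p.2)
        = {p : X × X | dist p.2 p.1 < δ}.indicator (fun p => f p.2) := by
      ext p; simp [Set.indicator]
    have i1 : Integrable (fun p : X × X => f p.1) (ν₁.prod ν₂) :=
      (BoundedContinuousFunction.mkOfCompact ⟨fun p : X × X => f p.1, by fun_prop⟩).integrable _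
    have i2 : Integrable (fun p : X × X => f p.2) (ν₁.prod ν₂) :=
      (BoundedContinuousFunction.mkOfCompact ⟨fun p : X × X => f p.2, by fun_prop⟩).integrable _
    have I1 := i1.indicator hS
    have I2 := i2.indicator hS
    rw [← e1] at I1
    rw [← e2] at I2
    refine ⟨I1, I2, ?_, ?_⟩
    · rw [integral_prod _ I1, ← integral_const_mul]
      congr 1; ext x
      simp only
      rw [integral_indicator_const _ Metric.isOpen_ball.measurableSet, smul_eq_mul,
        measureReal_def, h2 x x0, measureReal_def]
    · rw [integral_prod_symm _ I2, ← integral_const_mul]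
      congr 1; ext y
      have : (fun x : X => (Metric.ball x δ).indicator (fun _ => f y) y)
        = (Metric.ball y δ).indicator (fun _ => f y) := by
        ext x; simp [Set.indicator, dist_comm]
      simp only
      rw [this, integral_indicator_const _ Metric.isOpen_ball.measurableSet, smul_eq_mul,
        measureReal_def, h1 y x0, measureReal_def]
  have huc := CompactSpace.uniformContinuous_of_continuous hf
  rw [← sub_eq_zero, ← abs_nonpos_iff]
  refine le_of_forall_pos_le_add fun η hη => ?_
  rw [zero_add]
  set ε := η / ν₁.real Set.univ with hε
  have hε0 : 0 < ε := by positivity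
  obtain ⟨δ, hδ, hd⟩ := Metric.uniformContinuous_iff.1 huc ε hε0
  obtain ⟨a1, a2, a3, a4⟩ := key δ hδ f hf
  obtain ⟨b1, b2, b3, b4⟩ := key δ hδ (fun _ => 1) continuous_const
  have hb : ν₂.real (Metric.ball x0 δ) * ν₁.real Set.univ
      = ν₁.real (Metric.ball x0 δ) * ν₂.real Set.univ := by
    have := b3.symm.trans b4
    simpa using this
  have hA2 : 0 < ν₂.real (Metric.ball x0 δ) := by
    rw [measureReal_def]
    exact ENNReal.toReal_pos (Metric.isOpen_ball.measure_ne_zero _ ⟨x0, by simpa⟩) (measure_ne_top _ _)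
  have hmain : |ν₂.real (Metric.ball x0 δ) * ∫ x, f x ∂ν₁ - ν₁.real (Metric.ball x0 δ) * ∫ x, f x ∂ν₂|
      ≤ ε * (ν₂.real (Metric.ball x0 δ) * ν₁.real Set.univ) := by
    have b3' : ∫ p : X × X, (Metric.ball p.1 δ).indicator (fun _ => (1:ℝ)) p.2 ∂(ν₁.prod ν₂)
      = ν₂.real (Metric.ball x0 δ) * ν₁.real Set.univ := by rw [b3]; simp
    rw [← a3, ← a4, ← integral_sub a1 a2, ← b3', ← integral_const_mul, ← Real.norm_eq_abs]
    refine norm_integral_le_of_norm_le (b1.const_mul ε) (Filter.Eventually.of_forall fun p => ?_)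
    by_cases hp : p.2 ∈ Metric.ball p.1 δ
    · simp only [Set.indicator_of_mem hp, mul_one]
      have := hd (a := p.1) (b := p.2) (by rw [dist_comm]; exact hp)
      rw [← dist_eq_norm]; exact this.le
    · simp [Set.indicator_of_notMem hp]
  have hA1 : ν₁.real (Metric.ball x0 δ) = ν₂.real (Metric.ball x0 δ) * (ν₁.real Set.univ / ν₂.real Set.univ) := by
    field_simp; linarith
  rw [hA1, mul_assoc, ← mul_sub, abs_mul, abs_of_pos hA2] at hmain
  have : ε * ν₁.real Set.univ = η := by rw [hε]; field_simp
  rw [← this]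
  refine le_of_mul_le_mul_left ?_ hA2
  linarith
open scoped Pointwise in
lemma toSphere_ball_eq {n : ℕ} (x y : Metric.sphere (0 : EuclideanSpace ℝ (Fin n)) 1) (r : ℝ) :
    (volume : Measure (EuclideanSpace ℝ (Fin n))).toSphere (Metric.ball x r)
      = (volume : Measure (EuclideanSpace ℝ (Fin n))).toSphere (Metric.ball y r) := by
  set e := (Submodule.span ℝ {x.1 - y.1})ᗮ.reflection with he
  have hxy : e x.1 = y.1 := Submodule.reflection_sub (by simp)
  rw [Measure.toSphere_apply' _ Metric.isOpen_ball.measurableSet,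
    Measure.toSphere_apply' _ Metric.isOpen_ball.measurableSet]
  congr 1
  symm
  rw [← e.measurePreserving.measure_preimage_emb e.toHomeomorph.measurableEmbedding]
  symm
  congr 1
  ext z
  simp only [Set.mem_preimage, Set.mem_smul, Set.mem_image, Subtype.exists]
  constructor
  · rintro ⟨t, ht, _, ⟨w, hw, hw2, rfl⟩, h⟩
    subst h
    refine ⟨t, ht, _, ⟨e w, by simpa using hw, ?_, rfl⟩, by simp⟩
    simp only [Metric.mem_ball, Subtype.dist_eq] at hw2 ⊢
    rwa [← hxy, e.dist_map]
  · rintro ⟨t, ht, _, ⟨w, hw, hw2, rfl⟩, h⟩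
    have hz : e.symm (e z) = z := by simp
    refine ⟨t, ht, _, ⟨e.symm w, by simpa using hw, ?_, rfl⟩, ?_⟩
    · simp only [Metric.mem_ball, Subtype.dist_eq] at hw2 ⊢
      rwa [← e.dist_map, hxy, e.apply_symm_apply]
    · rw [← hz, ← h]; simp

lemma hausdorff_ball_eq {n : ℕ} (d : ℝ) (hd : 0 ≤ d)
    (x y : Metric.sphere (0 : EuclideanSpace ℝ (Fin n)) 1) (r : ℝ) :
    (Measure.hausdorffMeasure d : Measure (Metric.sphere (0 : EuclideanSpace ℝ (Fin n)) 1)) (Metric.ball x r)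
      = (Measure.hausdorffMeasure d : Measure (Metric.sphere (0 : EuclideanSpace ℝ (Fin n)) 1)) (Metric.ball y r) := by
  set e := (Submodule.span ℝ {x.1 - y.1})ᗮ.reflection with he
  have hxy : e x.1 = y.1 := Submodule.reflection_sub (by simp)
  have hi : Isometry (Subtype.val : Metric.sphere (0 : EuclideanSpace ℝ (Fin n)) 1 → _) :=
    isometry_subtype_coe
  rw [← hi.hausdorffMeasure_image (Or.inl hd), ← hi.hausdorffMeasure_image (Or.inl hd)]
  rw [← e.toIsometryEquiv.hausdorffMeasure_preimage d (Subtype.val '' (Metric.ball y r))]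
  congr 1
  ext z
  simp only [Set.mem_preimage, Set.mem_image, Subtype.exists]
  constructor
  · rintro ⟨w, hw, hw2, rfl⟩
    refine ⟨e w, by simpa using hw, ?_, rfl⟩
    simp only [Metric.mem_ball, Subtype.dist_eq] at hw2 ⊢
    rwa [← hxy, e.dist_map]
  · rintro ⟨w, hw, hw2, h⟩
    change w = e z at h
    subst h
    refine ⟨z, by simpa using hw, ?_, rfl⟩
    simp only [Metric.mem_ball, Subtype.dist_eq] at hw2 ⊢
    rwa [← hxy, e.dist_map] at hw2

lemma hausdorff_sphere_ne_zero {m : ℕ} :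
    Measure.hausdorffMeasure (m : ℝ) (Metric.sphere (0 : EuclideanSpace ℝ (Fin (m+1))) 1) ≠ 0 := by
  set P : EuclideanSpace ℝ (Fin (m+1)) → (Fin m → ℝ) := fun x i => x i.succ with hP
  have hL : LipschitzWith 1 P := by
    refine LipschitzWith.of_dist_le_mul fun x y => ?_
    rw [NNReal.coe_one, one_mul, dist_pi_le_iff dist_nonneg]
    intro i
    rw [dist_eq_norm, dist_eq_norm]
    exact PiLp.norm_apply_le (x - y) i.succ
  have h := hL.hausdorffMeasure_image_le (d := m) (by positivity) (Metric.sphere 0 1)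
  intro h0
  rw [h0, mul_zero] at h
  have hvol : (Measure.hausdorffMeasure (m : ℝ) : Measure (Fin m → ℝ)) = volume := by
    have := hausdorffMeasure_pi_real (ι := Fin m)
    simpa using this
  rw [hvol] at h
  have hop : IsOpen {u : Fin m → ℝ | ∑ i, u i ^ 2 < 1} := isOpen_lt (by fun_prop) (by fun_prop)
  refine hop.measure_ne_zero volume ⟨0, by simp⟩ (measure_mono_null ?_ (le_antisymm h bot_le))
  intro u hu
  have hu : ∑ i, u i ^ 2 < 1 := hu
  refine ⟨WithLp.toLp 2 (Fin.cons (√(1 - ∑ i, u i ^ 2)) u), ?_, ?_⟩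
  · rw [mem_sphere_zero_iff_norm, EuclideanSpace.norm_eq, Fin.sum_univ_succ]
    simp only [Fin.cons_zero, Fin.cons_succ, Real.norm_eq_abs, sq_abs]
    rw [Real.sq_sqrt (by linarith)]
    simp
  · ext i; simp [hP]

lemma hausdorff_sphere_ne_top {m : ℕ} :
    Measure.hausdorffMeasure (m : ℝ) (Metric.sphere (0 : EuclideanSpace ℝ (Fin (m+1))) 1) ≠ ⊤ := by
  have hvol : (Measure.hausdorffMeasure (m : ℝ) : Measure (Fin m → ℝ)) = volume := by
    have := hausdorffMeasure_pi_real (ι := Fin m)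
    simpa using this
  set F : Fin (m+1) → ℝ → (Fin m → ℝ) → EuclideanSpace ℝ (Fin (m+1)) :=
    fun i s u => WithLp.toLp 2 (i.insertNth s u) with hF
  set N : EuclideanSpace ℝ (Fin (m+1)) → EuclideanSpace ℝ (Fin (m+1)) := fun x => ‖x‖⁻¹ • x with hN
  have hNL : LipschitzOnWith 2 N {x | 1 ≤ ‖x‖} := by
    refine LipschitzOnWith.of_dist_le_mul fun x hx y hy => ?_
    have hx : 1 ≤ ‖x‖ := hx
    have hy : 1 ≤ ‖y‖ := hy
    have : N x - N y = ‖x‖⁻¹ • ((x - y) + (‖y‖ - ‖x‖) • (‖y‖⁻¹ • y)) := by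
      have : y = ‖y‖ • ‖y‖⁻¹ • y := by rw [smul_smul, mul_inv_cancel₀ (by positivity), one_smul]
      have h2 : N y = ‖x‖⁻¹ • (‖x‖ • ‖y‖⁻¹ • y) := by
        rw [smul_smul, inv_mul_cancel₀ (by positivity), one_smul]
      rw [sub_smul, ← this, h2, ← smul_sub]; congr 1; abel
    rw [dist_eq_norm, dist_eq_norm, this, norm_smul]
    have h1 : ‖(x - y) + (‖y‖ - ‖x‖) • (‖y‖⁻¹ • y)‖ ≤ 2 * ‖x - y‖ := by
      refine (norm_add_le _ _).trans ?_
      rw [norm_smul, norm_smul, norm_inv, norm_norm, inv_mul_cancel₀ (by positivity), mul_one]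
      have := abs_norm_sub_norm_le y x
      rw [norm_sub_rev] at this
      rw [Real.norm_eq_abs]; linarith
    have h3 : ‖‖x‖⁻¹‖ ≤ 1 := by rw [norm_inv, norm_norm]; exact inv_le_one_of_one_le₀ hx
    calc _ ≤ 1 * (2 * ‖x - y‖) := by gcongr
      _ = _ := by simp
  have hFL : ∀ i s, LipschitzWith (↑((m:NNReal) + 1)) (F i s) := by
    intro i s
    refine LipschitzWith.of_dist_le_mul fun u v => ?_
    rw [EuclideanSpace.dist_eq]
    refine Real.sqrt_le_iff.2 ⟨by positivity, ?_⟩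
    have : ∀ j, dist ((F i s u) j) ((F i s v) j) ≤ dist u v := by
      intro j
      simp only [hF]
      refine Fin.succAboveCases i ?_ ?_ j
      · simp
      · intro k; simpa using dist_le_pi_dist u v k
    calc _ ≤ ∑ j : Fin (m+1), (dist u v)^2 := by gcongr with j; exact this j
      _ = (m+1) * (dist u v)^2 := by simp
      _ ≤ _ := by
        push_cast; rw [mul_pow]; gcongr
        have : (0:ℝ) ≤ m := by positivity
        nlinarith
  have hcov : Metric.sphere (0 : EuclideanSpace ℝ (Fin (m+1))) 1 ⊆
      ⋃ i : Fin (m+1), ((N ∘ F i 1) '' Set.Icc (fun _ => -1) (fun _ => 1)) ∪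
        ((N ∘ F i (-1)) '' Set.Icc (fun _ => -1) (fun _ => 1)) := by
    intro x hx
    have hx1 : ‖x‖ = 1 := by simpa using hx
    obtain ⟨i, -, hi⟩ := Finset.exists_max_image Finset.univ (fun i => |x i|) Finset.univ_nonempty
    have hi0 : 0 < |x i| := by
      by_contra h
      have : x = 0 := by
        ext j; have := hi j (by simp); simpa using (this.trans (not_lt.1 h))
      simp [this] at hx1
    have main : ∀ s : ℝ, x i = s * |x i| →
        x ∈ (N ∘ F i s) '' Set.Icc (fun _ => -1) (fun _ => 1) := by
      intro s hs
      refine ⟨fun k => |x i|⁻¹ * x (i.succAbove k), ?_, ?_⟩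
      · have : ∀ k, |(|x i|⁻¹ * x (i.succAbove k))| ≤ 1 := by
          intro k
          rw [abs_mul, abs_inv, abs_abs, inv_mul_le_one₀ hi0]
          exact hi _ (by simp)
        exact ⟨fun k => (abs_le.1 (this k)).1, fun k => (abs_le.1 (this k)).2⟩
      · have hFx : F i s (fun k => |x i|⁻¹ * x (i.succAbove k)) = |x i|⁻¹ • x := by
          ext j
          simp only [hF]
          refine Fin.succAboveCases i ?_ ?_ j
          · simp; rw [eq_inv_mul_iff_mul_eq₀ hi0.ne']; linarith
          · intro k; simp
        simp only [Function.comp, hFx, hN]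
        rw [norm_smul, hx1, smul_smul, norm_inv, Real.norm_eq_abs, abs_abs]
        field_simp; simp
    refine Set.mem_iUnion.2 ⟨i, ?_⟩
    rcases le_total 0 (x i) with h | h
    · left; exact main 1 (by rw [abs_of_nonneg h]; ring)
    · right; exact main (-1) (by rw [abs_of_nonpos h]; ring)
  have hfin : ∀ i s, |s| = 1 → Measure.hausdorffMeasure (m : ℝ)
      ((N ∘ F i s) '' Set.Icc (fun _ => -1) (fun _ => 1)) ≠ ⊤ := by
    intro i s hs
    have hl : LipschitzOnWith (2 * (↑((m:NNReal) + 1))) (N ∘ F i s) Set.univ := by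
      refine hNL.comp ((hFL i s).lipschitzOnWith) ?_
      intro u _
      have := PiLp.norm_apply_le (F i s u) i
      simpa [hF, hs] using this
    have := (hl.mono (Set.subset_univ (Set.Icc (fun _ => -1) (fun _ => 1)))).hausdorffMeasure_image_le
      (d := m) (by positivity)
    refine ne_top_of_le_ne_top ?_ this
    rw [hvol]
    refine ENNReal.mul_ne_top (by finiteness) isCompact_Icc.measure_lt_top.ne
  refine ne_top_of_le_ne_top ?_ (measure_mono hcov)
  refine ne_top_of_le_ne_top ?_ (measure_iUnion_fintype_le _ _)
  refine ENNReal.sum_ne_top.2 fun i _ => ?_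
  exact ne_top_of_le_ne_top (ENNReal.add_ne_top.2 ⟨hfin i 1 (by simp), hfin i (-1) (by simp)⟩)
    (measure_union_le _ _)

lemma hausdorff_toSphere {n : ℕ} (hn : 2 ≤ n) :
    ∃ c : ℝ, 0 < c ∧ ∀ f : EuclideanSpace ℝ (Fin n) → ℝ,
      Continuous (fun ω : Metric.sphere (0 : EuclideanSpace ℝ (Fin n)) 1 => f ω) →
      ∫ ω in Metric.sphere (0 : EuclideanSpace ℝ (Fin n)) 1, f ω
          ∂(Measure.hausdorffMeasure ((n : ℝ) - 1))
        = c * ∫ ω : Metric.sphere (0 : EuclideanSpace ℝ (Fin n)) 1, f ω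
            ∂((volume : Measure (EuclideanSpace ℝ (Fin n))).toSphere) := by
  obtain ⟨m, rfl⟩ : ∃ m, n = m + 1 := ⟨n - 1, by omega⟩
  have hd : ((m + 1 : ℕ) : ℝ) - 1 = m := by push_cast; ring
  rw [hd]
  have hm : (0:ℝ) ≤ m := by positivity
  have hi : Isometry (Subtype.val : Metric.sphere (0 : EuclideanSpace ℝ (Fin (m+1))) 1 → _) :=
    isometry_subtype_coe
  have huniv := hi.hausdorffMeasure_image (Or.inl hm) Set.univ
  rw [Set.image_univ, Subtype.range_coe] at huniv
  set ν : Measure (Metric.sphere (0 : EuclideanSpace ℝ (Fin (m+1))) 1) :=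
    Measure.hausdorffMeasure (m:ℝ) with hν
  have : IsFiniteMeasure ν := ⟨by rw [← huniv]; exact hausdorff_sphere_ne_top.lt_top⟩
  have : Nonempty (Metric.sphere (0 : EuclideanSpace ℝ (Fin (m+1))) 1) :=
    (NormedSpace.sphere_nonempty.2 zero_le_one).to_subtype
  obtain ⟨c, hc, h⟩ := christensen ν ((volume : Measure (EuclideanSpace ℝ (Fin (m+1)))).toSphere)
    (hausdorff_ball_eq _ hm) toSphere_ball_eq (by rw [← huniv]; exact hausdorff_sphere_ne_zero)
  refine ⟨c, hc, fun f hf => ?_⟩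
  rw [← h _ hf]
  have := hi.map_hausdorffMeasure (Or.inl hm)
  rw [Subtype.range_coe] at this
  rw [← this, (MeasurableEmbedding.subtype_coe Metric.isClosed_sphere.measurableSet).integral_map]

lemma polar_nonneg {n : ℕ} (G : EuclideanSpace ℝ (Fin n) → ℝ) (hn : 2 ≤ n)
    (hG : Integrable G)
    (h : ∀ r : ℝ, 0 < r → 0 ≤ ∫ ω : Metric.sphere (0 : EuclideanSpace ℝ (Fin n)) 1, G (r • ω.1)
            ∂((volume : Measure (EuclideanSpace ℝ (Fin n))).toSphere)) :
    0 ≤ ∫ x, G x := by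
  have : Nontrivial (Fin n) := Fin.nontrivial_iff_two_le.2 hn
  have hmp := (volume : Measure (EuclideanSpace ℝ (Fin n))).measurePreserving_homeomorphUnitSphereProd
  have e1 : ∫ x, G x = ∫ x : ({(0)}ᶜ : Set (EuclideanSpace ℝ (Fin n))), G x.1 ∂((volume : Measure (EuclideanSpace ℝ (Fin n))).comap (↑)) := by
    rw [integral_subtype_comap (measurableSet_singleton _).compl fun x ↦ G x,
        restrict_compl_singleton]
  have hcomp : ∀ x : ({(0)}ᶜ : Set (EuclideanSpace ℝ (Fin n))),
      G ((homeomorphUnitSphereProd (EuclideanSpace ℝ (Fin n)) x).2.1 •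
        (homeomorphUnitSphereProd (EuclideanSpace ℝ (Fin n)) x).1.1) = G x.1 := by
    intro x
    have : ‖x.1‖ ≠ 0 := norm_ne_zero_iff.2 x.2
    simp [smul_smul, this]
  have e2 := hmp.integral_comp (Homeomorph.measurableEmbedding _)
    (fun p : (Metric.sphere (0 : EuclideanSpace ℝ (Fin n)) 1) × Set.Ioi (0:ℝ) => G (p.2.1 • p.1.1))
  have i2 := hmp.integrable_comp_emb (Homeomorph.measurableEmbedding _)
    (g := fun p : (Metric.sphere (0 : EuclideanSpace ℝ (Fin n)) 1) × Set.Ioi (0:ℝ) => G (p.2.1 • p.1.1))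
  simp only [hcomp] at e2
  simp only [Function.comp_def, hcomp] at i2
  have i1 : Integrable (fun x : ({(0)}ᶜ : Set (EuclideanSpace ℝ (Fin n))) => G x.1) ((volume : Measure (EuclideanSpace ℝ (Fin n))).comap (↑)) := by
    have := (integrableOn_iff_comap_subtypeVal (μ := volume) (f := G) (s := ({0}ᶜ : Set (EuclideanSpace ℝ (Fin n)))) (measurableSet_singleton _).compl).1 hG.integrableOn
    exact this
  rw [e1, e2, integral_prod_symm _ (i2.1 i1)]
  exact integral_nonneg fun r => h r.1 r.2

lemma euler_parts {n : ℕ} (ψ : EuclideanSpace ℝ (Fin n) → ℝ) (hψ : ContDiff ℝ 1 ψ)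
    (hs : HasCompactSupport ψ) :
    ∫ x, fderiv ℝ ψ x x = - n * ∫ x, ψ x := by
  have hc := hψ.continuous
  have hd := hψ.continuous_fderiv one_ne_zero
  have hdiff := hψ.differentiable one_ne_zero
  have hs' : HasCompactSupport (fderiv ℝ ψ) := hs.fderiv ℝ
  set e : Fin n → EuclideanSpace ℝ (Fin n) := fun i => EuclideanSpace.single i 1 with he
  have hsum : ∀ x : EuclideanSpace ℝ (Fin n), fderiv ℝ ψ x x = ∑ i, x i * fderiv ℝ ψ x (e i) := by
    intro x
    have : x = ∑ i, x i • e i := by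
      ext j; simp [he, Finset.sum_apply, Pi.single_apply]
    have h2 := congrArg (fderiv ℝ ψ x) this
    rw [map_sum] at h2
    simpa using h2
  have hi : ∀ i, Integrable (fun x : EuclideanSpace ℝ (Fin n) => x i * fderiv ℝ ψ x (e i)) := by
    intro i
    refine Continuous.integrable_of_hasCompactSupport (by fun_prop) ?_
    refine hs'.mono' (fun x hx => subset_tsupport _ ?_)
    contrapose! hx
    simp only [Function.mem_support, not_not] at hx ⊢
    simp [hx]
  simp_rw [hsum]
  rw [integral_finsetSum _ fun i _ => hi i]
  have : ∀ i, ∫ x : EuclideanSpace ℝ (Fin n), x i * fderiv ℝ ψ x (e i) = - ∫ x, ψ x := by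
    intro i
    have hfd : ∀ x : EuclideanSpace ℝ (Fin n), fderiv ℝ (fun x : EuclideanSpace ℝ (Fin n) => x i) x (e i) = 1 := by
      intro x
      have : HasFDerivAt (fun x : EuclideanSpace ℝ (Fin n) => x i) (EuclideanSpace.proj (𝕜 := ℝ) i) x :=
        (EuclideanSpace.proj (𝕜 := ℝ) i).hasFDerivAt
      rw [this.fderiv]; simp [he]
    have := integral_mul_fderiv_eq_neg_fderiv_mul_of_integrable (μ := volume) (v := e i)
      (f := fun x : EuclideanSpace ℝ (Fin n) => x i) (g := ψ) ?_ (hi i) ?_ (fun x _ => by fun_prop) (fun x _ => hdiff x)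
    · rw [this]; simp [hfd]
    · simp only [hfd, one_mul]
      exact hc.integrable_of_hasCompactSupport hs
    · exact Continuous.integrable_of_hasCompactSupport (by fun_prop) hs.mul_left
  simp [this]

lemma continuous_div_of_support {X : Type*} [TopologicalSpace X] {u w : X → ℝ} {K : Set X}
    (hK : IsClosed K) (hu : Continuous u) (hw : Continuous w) (h0 : ∀ x, x ∉ K → u x = 0)
    (hne : ∀ x ∈ K, w x ≠ 0) : Continuous (fun x => u x / w x) := by
  rw [continuous_iff_continuousAt]
  intro x
  by_cases hx : x ∈ K
  · exact hu.continuousAt.div hw.continuousAt (hne x hx)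
  · have : (fun x => u x / w x) =ᶠ[nhds x] fun _ => 0 := by
      filter_upwards [hK.isOpen_compl.mem_nhds hx] with y hy
      simp [h0 y hy]
    exact continuousAt_const.congr this.symm

lemma radial_hardy {n : ℕ} (φ : EuclideanSpace ℝ (Fin n) → ℝ) (hφ : ContDiff ℝ 1 φ)
    (hs : HasCompactSupport φ) (h0 : (0 : EuclideanSpace ℝ (Fin n)) ∉ tsupport φ) :
    ((n : ℝ) - 2) ^ 2 / 4 * ∫ x, (φ x) ^ 2 / ‖x‖ ^ 2
      ≤ ∫ x, (fderiv ℝ φ x x) ^ 2 / ‖x‖ ^ 2 := by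
  have hc := hφ.continuous
  have hd := hφ.continuous_fderiv one_ne_zero
  have hdiff := hφ.differentiable one_ne_zero
  have hz : ∀ x, x ∉ tsupport φ → φ x = 0 := fun x hx => image_eq_zero_of_notMem_tsupport hx
  have hz' : ∀ x, x ∉ tsupport φ → fderiv ℝ φ x = 0 := fun x hx =>
    image_eq_zero_of_notMem_tsupport (fun h => hx (tsupport_fderiv_subset ℝ h))
  have hne : ∀ x ∈ tsupport φ, ‖x‖ ^ 2 ≠ 0 := by
    intro x hx
    have : x ≠ 0 := fun h => h0 (h ▸ hx)
    positivity
  have hint : ∀ u : EuclideanSpace ℝ (Fin n) → ℝ, Continuous u → (∀ x, x ∉ tsupport φ → u x = 0) →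
      Integrable (fun x => u x / ‖x‖ ^ 2) := by
    intro u hu hu0
    refine Continuous.integrable_of_hasCompactSupport
      (continuous_div_of_support (isClosed_tsupport φ) hu (by fun_prop) hu0 hne) ?_
    exact HasCompactSupport.intro hs (fun x hx => by simp [hu0 x hx])
  have i1 := hint (fun x => φ x ^ 2) (by fun_prop) (fun x hx => by simp [hz x hx])
  have i2 := hint (fun x => fderiv ℝ φ x x ^ 2) (by fun_prop) (fun x hx => by simp [hz' x hx])
  have i3 := hint (fun x => fderiv ℝ φ x x * φ x) (by fun_prop) (fun x hx => by simp [hz x hx])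
  have hψ : ContDiff ℝ 1 (fun x => φ x ^ 2 / ‖x‖ ^ 2) := by
    rw [contDiff_iff_contDiffAt]
    intro x
    by_cases hx : x ∈ tsupport φ
    · exact (hφ.contDiffAt.pow 2).div (contDiff_norm_sq ℝ).contDiffAt (hne x hx)
    · have : (fun x => φ x ^ 2 / ‖x‖ ^ 2) =ᶠ[nhds x] fun _ => 0 := by
        filter_upwards [(isClosed_tsupport φ).isOpen_compl.mem_nhds hx] with y hy
        simp [hz y hy]
      exact contDiffAt_const.congr_of_eventuallyEq this
  have hE := euler_parts _ hψ (HasCompactSupport.intro hs (fun x hx => by simp [hz x hx]))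
  have hder : ∀ x, fderiv ℝ (fun x => φ x ^ 2 / ‖x‖ ^ 2) x x
      = 2 * (fderiv ℝ φ x x * φ x / ‖x‖ ^ 2) - 2 * (φ x ^ 2 / ‖x‖ ^ 2) := by
    intro x
    by_cases hx : x ∈ tsupport φ
    · have h2 := hne x hx
      have hA : HasFDerivAt (fun x => φ x ^ 2) ((2 * φ x) • fderiv ℝ φ x) x := by
        simpa using (hdiff x).hasFDerivAt.pow 2
      have hB := (hasStrictFDerivAt_norm_sq x).hasFDerivAt
      have hB' := (hasDerivAt_inv h2).comp_hasFDerivAt x hB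
      have := hA.mul hB'
      have e : (fun x : EuclideanSpace ℝ (Fin n) => φ x ^ 2 / ‖x‖ ^ 2)
        = fun x => φ x ^ 2 * ((fun y => y⁻¹) ∘ fun x => ‖x‖ ^ 2) x := by ext; simp [div_eq_mul_inv]
      rw [e]
      erw [this.fderiv]
      simp
      field_simp
      ring
    · have : (fun x => φ x ^ 2 / ‖x‖ ^ 2) =ᶠ[nhds x] fun _ => 0 := by
        filter_upwards [(isClosed_tsupport φ).isOpen_compl.mem_nhds hx] with y hy
        simp [hz y hy]
      rw [this.fderiv_eq]; simp [hz x hx]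
  simp_rw [hder] at hE
  rw [integral_sub (i3.const_mul 2) (i1.const_mul 2), integral_const_mul, integral_const_mul] at hE
  have hsq : 0 ≤ ∫ x, (fderiv ℝ φ x x + ((n:ℝ) - 2) / 2 * φ x) ^ 2 / ‖x‖ ^ 2 :=
    integral_nonneg fun x => by positivity
  have hexp : (fun x => (fderiv ℝ φ x x + ((n:ℝ) - 2) / 2 * φ x) ^ 2 / ‖x‖ ^ 2)
    = fun x => fderiv ℝ φ x x ^ 2 / ‖x‖ ^ 2 + (((n:ℝ) - 2) * (fderiv ℝ φ x x * φ x / ‖x‖ ^ 2)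
      + ((n:ℝ) - 2) ^ 2 / 4 * (φ x ^ 2 / ‖x‖ ^ 2)) := by
    ext x; ring
  rw [hexp, integral_add i2 (by exact (i3.const_mul _).add (i1.const_mul _)),
    integral_add (i3.const_mul _) (i1.const_mul _), integral_const_mul, integral_const_mul] at hsq
  set A := ∫ x, fderiv ℝ φ x x * φ x / ‖x‖ ^ 2
  set B := ∫ x, φ x ^ 2 / ‖x‖ ^ 2
  have hA : A = - (((n:ℝ) - 2) / 2) * B := by linarith
  rw [hA] at hsq
  linarith

lemma gradient_slice {n : ℕ} (φ : EuclideanSpace ℝ (Fin n) → ℝ) (hφ : Differentiable ℝ φ)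
    (r : ℝ) (ω : EuclideanSpace ℝ (Fin n)) (hω : ‖ω‖ = 1) :
    ‖gradient (fun x => φ (r • (‖x‖⁻¹ • x))) ω‖ ^ 2
      = r ^ 2 * (‖gradient φ (r • ω)‖ ^ 2 - (fderiv ℝ φ (r • ω) ω) ^ 2) := by
  have hg := (hφ (r • ω)).hasGradientAt
  have hfg : fderiv ℝ φ (r • ω) ω = inner ℝ (gradient φ (r • ω)) ω := by
    rw [← toDual_gradient]; simp
  set v := gradient φ (r • ω) with hv
  have hN : HasFDerivAt (fun x : EuclideanSpace ℝ (Fin n) => ‖x‖⁻¹) (-(innerSL ℝ ω)) ω := by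
    have h1 := (hasStrictFDerivAt_norm_sq ω).hasFDerivAt.sqrt (by simp [hω])
    have h2 := (hasDerivAt_inv (x := √(‖ω‖ ^ 2)) (by simp [hω])).comp_hasFDerivAt ω h1
    have e : (fun x : EuclideanSpace ℝ (Fin n) => ‖x‖⁻¹)
      = (fun y => y⁻¹) ∘ fun x => √(‖x‖ ^ 2) := by ext; simp
    rw [e]
    refine h2.congr_fderiv ?_
    ext y; simp [hω]
  have h3 := (hN.smul (hasFDerivAt_id ω)).const_smul r
  have h4 : HasFDerivAt φ (fderiv ℝ φ (r • ω)) (r • (‖ω‖⁻¹ • ω)) := by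
    rw [hω, inv_one, one_smul]; exact (hφ _).hasFDerivAt
  have h5 := h4.comp ω h3
  have hG : HasGradientAt (fun x => φ (r • (‖x‖⁻¹ • x))) (r • (v - inner ℝ v ω • ω)) ω := by
    rw [hasGradientAt_iff_hasFDerivAt]
    refine HasFDerivAt.congr_fderiv h5 ?_
    ext y
    rw [← toDual_gradient, ← hv]
    simp [hω, inner_add_right, inner_sub_left, inner_smul_left, inner_smul_right]
    ring
  rw [hG.gradient, hfg, norm_smul, mul_pow, ← real_inner_self_eq_norm_sq (v - _)]
  simp only [inner_sub_left, inner_sub_right, inner_smul_left, inner_smul_right,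
    real_inner_self_eq_norm_sq, hω, real_inner_comm ω v, Real.norm_eq_abs, sq_abs]
  simp [real_inner_comm]
  left
  ring

open scoped Pointwise in
lemma infDist_of_scale {n : ℕ} (S : Set (EuclideanSpace ℝ (Fin n))) (r : ℝ) (hr : 0 < r)
    (h : ∀ y, r⁻¹ • y ∈ S ↔ y ∈ S) (x : EuclideanSpace ℝ (Fin n)) :
    Metric.infDist (r • x) S = r * Metric.infDist x S := by
  have hset : r • S = S := by
    ext y
    rw [Set.mem_smul_set_iff_inv_smul_mem₀ hr.ne', h]
  have := infDist_smul₀ hr.ne' S x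
  rwa [hset, Real.norm_of_nonneg hr.le] at this

theorem slice_to_cone_hardy {n : ℕ} (hn : 2 ≤ n) (Sig : Set (EuclideanSpace ℝ (Fin n)))
    (hne : Sig.Nonempty) (hsub : Sig ⊆ Metric.sphere 0 1)
    (hopen : ∃ U : Set (EuclideanSpace ℝ (Fin n)), IsOpen U ∧ Sig = U ∩ Metric.sphere 0 1)
    (μ σ : ℝ) (Ω : Set (EuclideanSpace ℝ (Fin n)))
    (hΩ : Ω = {x | ∃ r : ℝ, 0 < r ∧ ∃ ω ∈ Sig, x = r • ω})
    (hslice : ∀ φ : EuclideanSpace ℝ (Fin n) → ℝ, IsTestFun Ω φ → ∀ r : ℝ, 0 < r →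
      0 ≤ ∫ ω in Sig,
        (‖gradient (fun x => φ (r • (‖x‖⁻¹ • x))) ω‖ ^ 2
          - μ * (φ (r • (‖ω‖⁻¹ • ω))) ^ 2 / (Metric.infDist ω Ωᶜ) ^ 2
          - σ * (φ (r • (‖ω‖⁻¹ • ω))) ^ 2)
        ∂(Measure.hausdorffMeasure ((n : ℝ) - 1))) :
    ∀ φ : EuclideanSpace ℝ (Fin n) → ℝ, IsTestFun Ω φ →
      (((n : ℝ) - 2) ^ 2 / 4 + σ) * ∫ x in Ω, (φ x) ^ 2 / ‖x‖ ^ 2 ≤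
        (∫ x in Ω, ‖gradient φ x‖ ^ 2)
          - μ * ∫ x in Ω, (φ x) ^ 2 / (Metric.infDist x Ωᶜ) ^ 2 := by
  intro φ hφ
  have hsl := hslice φ hφ
  obtain ⟨hsm, hcs, hsupp⟩ := hφ
  have hC1 : ContDiff ℝ 1 φ := hsm.of_le (by exact_mod_cast le_top)
  have hc := hC1.continuous
  have hd := hC1.continuous_fderiv one_ne_zero
  have hdiff := hC1.differentiable one_ne_zero
  -- geometry of the cone
  have hmem : ∀ x, x ∈ Ω ↔ x ≠ 0 ∧ ‖x‖⁻¹ • x ∈ Sig := by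
    intro x
    rw [hΩ]
    constructor
    · rintro ⟨r, hr, ω, hω, rfl⟩
      have h1 : ‖ω‖ = 1 := by simpa using hsub hω
      have h2 : ω ≠ 0 := by rintro rfl; simp at h1
      refine ⟨smul_ne_zero hr.ne' h2, ?_⟩
      rw [norm_smul, h1, mul_one, Real.norm_of_nonneg hr.le, smul_smul, inv_mul_cancel₀ hr.ne', one_smul]
      exact hω
    · rintro ⟨h0, h1⟩
      refine ⟨‖x‖, by positivity, _, h1, ?_⟩
      rw [smul_smul, mul_inv_cancel₀ (by positivity), one_smul]
  have h0Ω : (0 : EuclideanSpace ℝ (Fin n)) ∉ Ω := by simp [hmem]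
  have hΩo : IsOpen Ω := by
    obtain ⟨U, hU, hS⟩ := hopen
    have hco : ContinuousOn (fun x : EuclideanSpace ℝ (Fin n) => ‖x‖⁻¹ • x) {0}ᶜ := by
      intro x hx
      exact ((continuous_norm.continuousAt.inv₀ (norm_ne_zero_iff.2 hx)).smul
        continuousAt_id).continuousWithinAt
    have : Ω = {0}ᶜ ∩ (fun x : EuclideanSpace ℝ (Fin n) => ‖x‖⁻¹ • x) ⁻¹' U := by
      ext x
      rw [hmem, hS]
      constructor
      · rintro ⟨a, b⟩; exact ⟨a, b.1⟩
      · rintro ⟨a, b⟩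
        refine ⟨a, b, ?_⟩
        have : ‖x‖ ≠ 0 := norm_ne_zero_iff.2 a
        simp [norm_smul, this]
    rw [this]
    exact hco.isOpen_inter_preimage isOpen_compl_singleton hU
  have hscale : ∀ r : ℝ, 0 < r → ∀ x, r • x ∈ Ω ↔ x ∈ Ω := by
    intro r hr x
    rw [hmem, hmem, norm_smul, Real.norm_of_nonneg hr.le, smul_smul]
    have : (r * ‖x‖)⁻¹ * r = ‖x‖⁻¹ := by field_simp
    rw [this]
    simp [hr.ne']
  have hdist : ∀ r : ℝ, 0 < r → ∀ x, Metric.infDist (r • x) Ωᶜ = r * Metric.infDist x Ωᶜ := by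
    intro r hr x
    exact infDist_of_scale Ωᶜ r hr (fun y => not_congr (hscale _ (inv_pos.2 hr) y)) x
  have hdpos : ∀ x ∈ Ω, 0 < Metric.infDist x Ωᶜ := by
    intro x hx
    refine (hΩo.isClosed_compl.notMem_iff_infDist_pos ⟨0, h0Ω⟩).1 ?_
    simpa using hx
  -- continuity and supports
  have hz : ∀ x, x ∉ tsupport φ → φ x = 0 := fun x hx => image_eq_zero_of_notMem_tsupport hx
  have hz' : ∀ x, x ∉ tsupport φ → fderiv ℝ φ x = 0 := fun x hx =>
    image_eq_zero_of_notMem_tsupport (fun h => hx (tsupport_fderiv_subset ℝ h))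
  have hgn : ∀ x, ‖gradient φ x‖ = ‖fderiv ℝ φ x‖ := by
    intro x; rw [← toDual_gradient, LinearIsometryEquiv.norm_map]
  have c1 : Continuous (fun x => ‖gradient φ x‖ ^ 2) := by simp_rw [hgn]; fun_prop
  have hnn : ∀ x ∈ tsupport φ, ‖x‖ ^ 2 ≠ 0 := by
    intro x hx
    have : x ≠ 0 := fun h => h0Ω (h ▸ hsupp hx)
    positivity
  have c2 : Continuous (fun x => (fderiv ℝ φ x x) ^ 2 / ‖x‖ ^ 2) :=
    continuous_div_of_support (isClosed_tsupport φ) (by fun_prop) (by fun_prop)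
      (fun x hx => by simp [hz' x hx]) hnn
  have c3 : Continuous (fun x => (φ x) ^ 2 / ‖x‖ ^ 2) :=
    continuous_div_of_support (isClosed_tsupport φ) (by fun_prop) (by fun_prop)
      (fun x hx => by simp [hz x hx]) hnn
  have c4 : Continuous (fun x => (φ x) ^ 2 / (Metric.infDist x Ωᶜ) ^ 2) :=
    continuous_div_of_support (isClosed_tsupport φ) (by fun_prop)
      ((Metric.continuous_infDist_pt _).pow 2)
      (fun x hx => by simp [hz x hx]) (fun x hx => pow_ne_zero 2 (hdpos x (hsupp hx)).ne')
  have z1 : ∀ x, x ∉ tsupport φ → ‖gradient φ x‖ ^ 2 = 0 := fun x hx => by simp [hgn, hz' x hx]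
  have z2 : ∀ x, x ∉ tsupport φ → (fderiv ℝ φ x x) ^ 2 / ‖x‖ ^ 2 = 0 := fun x hx => by simp [hz' x hx]
  have z3 : ∀ x, x ∉ tsupport φ → (φ x) ^ 2 / ‖x‖ ^ 2 = 0 := fun x hx => by simp [hz x hx]
  have z4 : ∀ x, x ∉ tsupport φ → (φ x) ^ 2 / (Metric.infDist x Ωᶜ) ^ 2 = 0 :=
    fun x hx => by simp [hz x hx]
  have i1 : Integrable (fun x => ‖gradient φ x‖ ^ 2) :=
    c1.integrable_of_hasCompactSupport (HasCompactSupport.intro hcs z1)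
  have i2 : Integrable (fun x => (fderiv ℝ φ x x) ^ 2 / ‖x‖ ^ 2) :=
    c2.integrable_of_hasCompactSupport (HasCompactSupport.intro hcs z2)
  have i3 : Integrable (fun x => (φ x) ^ 2 / ‖x‖ ^ 2) :=
    c3.integrable_of_hasCompactSupport (HasCompactSupport.intro hcs z3)
  have i4 : Integrable (fun x => (φ x) ^ 2 / (Metric.infDist x Ωᶜ) ^ 2) :=
    c4.integrable_of_hasCompactSupport (HasCompactSupport.intro hcs z4)
  rw [setIntegral_eq_integral_of_forall_compl_eq_zero (fun x hx => z1 x (fun h => hx (hsupp h))),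
    setIntegral_eq_integral_of_forall_compl_eq_zero (fun x hx => z3 x (fun h => hx (hsupp h))),
    setIntegral_eq_integral_of_forall_compl_eq_zero (fun x hx => z4 x (fun h => hx (hsupp h)))]
  have hrad := radial_hardy φ hC1 hcs (fun h => h0Ω (hsupp h))
  -- the angular part
  set G : EuclideanSpace ℝ (Fin n) → ℝ := fun x => ‖gradient φ x‖ ^ 2
    - (fderiv ℝ φ x x) ^ 2 / ‖x‖ ^ 2 - μ * ((φ x) ^ 2 / (Metric.infDist x Ωᶜ) ^ 2)
    - σ * ((φ x) ^ 2 / ‖x‖ ^ 2) with hG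
  have cG : Continuous G := ((c1.sub c2).sub (c4.const_mul μ)).sub (c3.const_mul σ)
  have zG : ∀ x, x ∉ tsupport φ → G x = 0 := fun x hx => by
    simp only [hG, z1 x hx, z2 x hx, z3 x hx, z4 x hx]; ring
  have iG : Integrable G := cG.integrable_of_hasCompactSupport (HasCompactSupport.intro hcs zG)
  have hGint : ∫ x, G x = (∫ x, ‖gradient φ x‖ ^ 2) - (∫ x, (fderiv ℝ φ x x) ^ 2 / ‖x‖ ^ 2)
      - μ * (∫ x, (φ x) ^ 2 / (Metric.infDist x Ωᶜ) ^ 2) - σ * ∫ x, (φ x) ^ 2 / ‖x‖ ^ 2 := by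
    rw [hG, integral_sub (by exact (i1.sub i2).sub (i4.const_mul μ)) (i3.const_mul σ),
      integral_sub (by exact i1.sub i2) (i4.const_mul μ), integral_sub i1 i2,
      integral_const_mul, integral_const_mul]
  obtain ⟨c, hc0, hcH⟩ := hausdorff_toSphere hn
  have hGpos : 0 ≤ ∫ x, G x := by
    refine polar_nonneg G hn iG fun r hr => ?_
    have h := hsl r hr
    have hfG : ∀ ω ∈ Metric.sphere (0 : EuclideanSpace ℝ (Fin n)) 1,
        (‖gradient (fun x => φ (r • (‖x‖⁻¹ • x))) ω‖ ^ 2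
          - μ * (φ (r • (‖ω‖⁻¹ • ω))) ^ 2 / (Metric.infDist ω Ωᶜ) ^ 2
          - σ * (φ (r • (‖ω‖⁻¹ • ω))) ^ 2) = r ^ 2 * G (r • ω) := by
      intro ω hω
      have hω1 : ‖ω‖ = 1 := by simpa using hω
      rw [gradient_slice φ hdiff r ω hω1]
      simp only [hG, hdist r hr, norm_smul, hω1, inv_one, one_smul, map_smul, smul_eq_mul,
        Real.norm_eq_abs, mul_pow, sq_abs]
      have hr' : r ≠ 0 := hr.ne'
      by_cases hδ : Metric.infDist ω Ωᶜ = 0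
      · rw [hδ]; simp; field_simp
      · field_simp
    have hsig : ∀ ω ∈ Metric.sphere (0 : EuclideanSpace ℝ (Fin n)) 1, ω ∉ Sig → r • ω ∉ Ω := by
      intro ω hω hS
      have hω1 : ‖ω‖ = 1 := by simpa using hω
      rw [hscale r hr, hmem, hω1, inv_one, one_smul]
      exact fun h => hS h.2
    rw [← setIntegral_eq_of_subset_of_forall_sdiff_eq_zero Metric.isClosed_sphere.measurableSet hsub
      (fun ω hω => by
        rw [hfG ω hω.1, zG _ (fun h => hsig ω hω.1 hω.2 (hsupp h)), mul_zero]),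
      setIntegral_congr_fun Metric.isClosed_sphere.measurableSet hfG,
      hcH _ (by fun_prop), integral_const_mul] at h
    have hr2 : 0 < c * r ^ 2 := by positivity
    rw [← mul_assoc] at h
    exact nonneg_of_mul_nonneg_right h hr2
  rw [hGint] at hGpos
  linarith
end
end
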